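/- Let F be an area preserving homeomorphism of the annulus A = T^1 × R homotopic to the identity, and K an F-invariant essential continuum containing no periodic point of F. Then K is a filled essential continuum, i.e. A \ K has exactly two (unbounded) connected components. -/

import Mathlib

open MeasureTheory Filter Set

noncomputable section

/-- The infinite annulus `𝔸 = T¹ × ℝ`. -/
abbrev 𝔸 : Type := AddCircle (1 : ℝ) × ℝ

/-- The covering projection `π : ℝ² → 𝔸`. -/
def πA : ℝ × ℝ → 𝔸 := fun p => ((p.1 : AddCircle (1 : ℝ)), p.2)

/-- The deck transformation `T(x,y) = (x+1,y)`. -/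
def TA : ℝ × ℝ → ℝ × ℝ := fun p => (p.1 + 1, p.2)


section LogBasics
open Topology

/-- `f` has a continuous logarithm on `S`. -/
def HasLog {X : Type*} [TopologicalSpace X] (f : X → ℂ) (S : Set X) : Prop :=
  ∃ l : X → ℂ, ContinuousOn l S ∧ ∀ z ∈ S, Complex.exp (l z) = f z

variable {X : Type*} [TopologicalSpace X]

theorem HasLog.mono {f : X → ℂ} {S T : Set X} (h : HasLog f S) (hT : T ⊆ S) : HasLog f T := by
  obtain ⟨l, hl, h⟩ := h
  exact ⟨l, hl.mono hT, fun z hz => h z (hT hz)⟩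

theorem HasLog.congr {f g : X → ℂ} {S : Set X} (h : HasLog f S) (hfg : ∀ z ∈ S, f z = g z) :
    HasLog g S := by
  obtain ⟨l, hl, h⟩ := h
  exact ⟨l, hl, fun z hz => by rw [h z hz, hfg z hz]⟩

theorem HasLog.mul {f g : X → ℂ} {S : Set X} (hf : HasLog f S) (hg : HasLog g S) :
    HasLog (fun z => f z * g z) S := by
  obtain ⟨l, hl, h⟩ := hf
  obtain ⟨l', hl', h'⟩ := hg
  exact ⟨fun z => l z + l' z, hl.add hl', fun z hz => by rw [Complex.exp_add, h z hz, h' z hz]⟩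

theorem HasLog.inv {f : X → ℂ} {S : Set X} (hf : HasLog f S) :
    HasLog (fun z => (f z)⁻¹) S := by
  obtain ⟨l, hl, h⟩ := hf
  exact ⟨fun z => - l z, hl.neg, fun z hz => by rw [Complex.exp_neg, h z hz]⟩

theorem HasLog.div {f g : X → ℂ} {S : Set X} (hf : HasLog f S) (hg : HasLog g S) :
    HasLog (fun z => f z / g z) S := by
  simpa only [div_eq_mul_inv] using hf.mul hg.inv

theorem HasLog.zpow {f : X → ℂ} {S : Set X} (hf : HasLog f S) (n : ℤ) :
    HasLog (fun z => (f z) ^ n) S := by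
  obtain ⟨l, hl, h⟩ := hf
  exact ⟨fun z => n * l z, continuousOn_const.mul hl,
    fun z hz => by rw [Complex.exp_int_mul, h z hz]⟩

theorem HasLog.prod {ι : Type*} (s : Finset ι) {f : ι → X → ℂ} {S : Set X}
    (hf : ∀ i ∈ s, HasLog (f i) S) : HasLog (fun z => ∏ i ∈ s, f i z) S := by
  classical
  induction s using Finset.induction_on with
  | empty => exact ⟨fun _ => 0, continuousOn_const, by simp⟩
  | insert a s ha ih =>
    simp only [Finset.prod_insert ha]
    exact (hf a (by simp)).mul (ih fun i hi => hf i (by simp [hi]))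

theorem HasLog.comp {Y : Type*} [TopologicalSpace Y] {f : X → ℂ} {S : Set X} (hf : HasLog f S)
    {k : Y → X} {T : Set Y} (hk : ContinuousOn k T) (hm : MapsTo k T S) :
    HasLog (fun y => f (k y)) T := by
  obtain ⟨l, hl, h⟩ := hf
  exact ⟨fun y => l (k y), hl.comp hk hm, fun y hy => h _ (hm hy)⟩

theorem hasLog_const (c : ℂ) (hc : c ≠ 0) (S : Set X) : HasLog (fun _ => c) S :=
  ⟨fun _ => Complex.log c, continuousOn_const, fun _ _ => Complex.exp_log hc⟩

theorem hasLog_of_slitPlane {f : X → ℂ} {S : Set X} (hf : ContinuousOn f S)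
    (h : ∀ z ∈ S, f z ∈ Complex.slitPlane) : HasLog f S :=
  ⟨fun z => Complex.log (f z), hf.clog h,
    fun z hz => Complex.exp_log (Complex.slitPlane_ne_zero (h z hz))⟩

theorem hasLog_of_convex {E : Type*} [NormedAddCommGroup E] [NormedSpace ℝ E] {f : E → ℂ}
    {S : Set E} (hS : Convex ℝ S) (hSo : IsOpen S) (hf : ContinuousOn f S)
    (h0 : ∀ z ∈ S, f z ≠ 0) : HasLog f S := by
  rcases S.eq_empty_or_nonempty with rfl | hne
  · exact ⟨fun _ => 0, continuousOn_const, by simp⟩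
  have : ContractibleSpace S := hS.contractibleSpace hne
  have hsc : IsSimplyConnected S := by
    change SimplyConnectedSpace S
    infer_instance
  obtain ⟨l, hl, h⟩ := Complex.exists_continuousOn_eqOn_exp_comp hsc hSo hf (by
    rintro ⟨z, hz, h⟩; exact h0 z hz h)
  exact ⟨l, hl, fun z hz => h hz⟩

theorem exp_eq_exp_dist {a b : ℂ} (h : Complex.exp a = Complex.exp b) (hab : ‖a - b‖ < 6) :
    a = b := by
  obtain ⟨n, hn⟩ := Complex.exp_eq_exp_iff_exists_int.1 h
  have h1 : ‖a - b‖ = |(n : ℝ)| * (2 * Real.pi) := by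
    rw [hn]; simp [abs_of_pos Real.pi_pos]
  by_cases h0 : n = 0
  · simpa [h0] using hn
  · have : (1 : ℝ) ≤ |(n : ℝ)| := by
      rw [← Int.cast_abs]; exact_mod_cast Int.one_le_abs h0
    nlinarith [Real.pi_gt_three]

theorem int_valued_const {f : X → ℂ} {S : Set X} (hS : IsPreconnected S) (hf : ContinuousOn f S)
    (h : ∀ z ∈ S, ∃ m : ℤ, f z = m) : ∃ m : ℤ, ∀ z ∈ S, f z = m := by
  rcases S.eq_empty_or_nonempty with rfl | ⟨x, hx⟩
  · exact ⟨0, by simp⟩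
  choose! n hn using h
  have hc : ContinuousOn n S := by
    rw [Int.isClosedEmbedding_coe_real.isEmbedding.continuousOn_iff]
    refine (Complex.continuous_re.comp_continuousOn hf).congr fun z hz => ?_
    simp [hn z hz]
  exact ⟨n x, fun z hz => by rw [hn z hz, hS.constant hc hz hx]⟩

/-- two continuous logs on a preconnected set differ by a constant -/
theorem log_unique {l l' : X → ℂ} {S : Set X} (hS : IsPreconnected S) (hl : ContinuousOn l S)
    (hl' : ContinuousOn l' S) (h : ∀ z ∈ S, Complex.exp (l z) = Complex.exp (l' z)) :
    ∃ n : ℤ, ∀ z ∈ S, l z = l' z + n * (2 * Real.pi * Complex.I) := by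
  have hc : ContinuousOn (fun z => (l z - l' z) / (2 * Real.pi * Complex.I)) S :=
    (hl.sub hl').div_const _
  obtain ⟨n, hn⟩ := int_valued_const hS hc (by
    intro z hz
    obtain ⟨m, hm⟩ := Complex.exp_eq_exp_iff_exists_int.1 (h z hz)
    refine ⟨m, ?_⟩
    rw [hm, add_sub_cancel_left, mul_div_assoc, div_self Complex.two_pi_I_ne_zero, mul_one])
  refine ⟨n, fun z hz => ?_⟩
  have := hn z hz
  rw [div_eq_iff Complex.two_pi_I_ne_zero] at this
  rw [← this]; ring

/-- gluing: an open subset of the line -/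
theorem hasLog_open_real {f : ℝ → ℂ} {O : Set ℝ} (hO : IsOpen O) (hf : ContinuousOn f O)
    (h0 : ∀ z ∈ O, f z ≠ 0) : HasLog f O := by
  have h : ∀ x : ℝ, HasLog f (connectedComponentIn O x) := fun x =>
    hasLog_of_convex (isPreconnected_connectedComponentIn.ordConnected.convex)
      hO.connectedComponentIn (hf.mono (connectedComponentIn_subset O x))
      (fun z hz => h0 z (connectedComponentIn_subset O x hz))
  have h' : ∀ S : Set ℝ, ∃ l : ℝ → ℂ, (∃ x, S = connectedComponentIn O x) →
      ContinuousOn l S ∧ ∀ z ∈ S, Complex.exp (l z) = f z := by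
    intro S
    by_cases hS : ∃ x, S = connectedComponentIn O x
    · obtain ⟨x, rfl⟩ := hS
      obtain ⟨l, hl⟩ := h x
      exact ⟨l, fun _ => hl⟩
    · exact ⟨0, fun h => absurd h hS⟩
  choose L hL using h'
  refine ⟨fun x => L (connectedComponentIn O x) x, fun x hx => ?_, fun x hx => ?_⟩
  · have h1 := (hL _ ⟨x, rfl⟩).1
    have hmem : connectedComponentIn O x ∈ 𝓝 x :=
      hO.connectedComponentIn.mem_nhds (mem_connectedComponentIn hx)
    refine ContinuousAt.continuousWithinAt ?_
    refine (h1.continuousAt hmem).congr ?_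
    filter_upwards [hmem] with y hy
    rw [connectedComponentIn_eq hy]
  · exact (hL _ ⟨x, rfl⟩).2 x (mem_connectedComponentIn hx)

theorem exists_tietze {Y : Type*} [TopologicalSpace Y] [NormalSpace Y] {S : Set Y}
    (hS : IsClosed S) {f : Y → ℂ} (hf : ContinuousOn f S) :
    ∃ g : Y → ℂ, Continuous g ∧ ∀ z ∈ S, g z = f z := by
  obtain ⟨g, hg⟩ := ContinuousMap.exists_restrict_eq hS
    (⟨S.domRestrict f, hf.domRestrict⟩ : C(S, ℂ))
  refine ⟨g, g.continuous, fun z hz => ?_⟩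
  exact DFunLike.congr_fun hg ⟨z, hz⟩

theorem hasLog_closed_real {f : ℝ → ℂ} {S : Set ℝ} (hS : IsClosed S) (hf : ContinuousOn f S)
    (h0 : ∀ z ∈ S, f z ≠ 0) : HasLog f S := by
  obtain ⟨g, hg, hgf⟩ := exists_tietze hS hf
  have : HasLog g {z | g z ≠ 0} :=
    hasLog_open_real (isOpen_ne_fun hg continuous_const) hg.continuousOn (fun z hz => hz)
  refine (this.mono fun z hz => ?_).congr hgf
  rw [mem_ofPred_eq, hgf z hz]; exact h0 z hz

/-- A nonvanishing function on a compact set that embeds in a circle. -/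
theorem hasLog_circle {S : Set ℂ} (hS : IsCompact S) {θ f : ℂ → ℂ} (hθ : ContinuousOn θ S)
    (hinj : InjOn θ S) (hnorm : ∀ z ∈ S, ‖θ z‖ = 1) (hf : ContinuousOn f S)
    (h0 : ∀ z ∈ S, f z ≠ 0) : ∃ n : ℤ, HasLog (fun z => f z * (θ z) ^ n) S := by
  let p : ℝ → ℂ := fun t => Complex.exp (2 * Real.pi * t * Complex.I)
  have hp : Continuous p := by fun_prop
  have hSc : CompactSpace S := isCompact_iff_compactSpace.1 hS
  let P : Set (ℝ × ℂ) := {q | q.1 ∈ Icc (0:ℝ) 1 ∧ q.2 ∈ S ∧ θ q.2 = p q.1}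
  let T : Set ℝ := Prod.fst '' P
  have hPc : IsCompact P := by
    have h1 : IsCompact (Icc (0:ℝ) 1 ×ˢ S) := isCompact_Icc.prod hS
    have h2 : ContinuousOn (fun q : ℝ × ℂ => θ q.2 - p q.1) (Icc (0:ℝ) 1 ×ˢ S) :=
      (hθ.comp continuousOn_snd (fun q hq => hq.2)).sub (by fun_prop)
    have h3 := h2.preimage_isClosed_of_isClosed h1.isClosed (isClosed_singleton (x := (0:ℂ)))
    refine h1.of_isClosed_subset (s := Icc (0:ℝ) 1 ×ˢ S) ?_ (fun q hq => ⟨hq.1, hq.2.1⟩)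
    convert h3 using 1
    ext q
    simp [P, sub_eq_zero, and_assoc]
  have hTc : IsCompact T := hPc.image continuous_fst
  have hb : ∀ t ∈ T, ∃ z, z ∈ S ∧ θ z = p t := by
    rintro t ⟨q, hq, rfl⟩
    exact ⟨q.2, hq.2.1, hq.2.2⟩
  choose! b hbS hbθ using hb
  have hgraph : ∀ q ∈ P, q.2 = b q.1 := fun q hq =>
    hinj hq.2.1 (hbS _ ⟨q, hq, rfl⟩) (by rw [hq.2.2, hbθ _ ⟨q, hq, rfl⟩])
  have : CompactSpace P := isCompact_iff_compactSpace.1 hPc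
  have hm : ∃ m : ℝ → ℂ, ContinuousOn m T ∧ ∀ q ∈ P, Complex.exp (m q.1) = f q.2 := by
    have hbc : ContinuousOn b T := by
      rw [continuousOn_iff_isClosed]
      intro C hC
      refine ⟨Prod.fst '' (P ∩ Prod.snd ⁻¹' C), ?_, ?_⟩
      · exact ((hPc.inter_right (hC.preimage continuous_snd)).image continuous_fst).isClosed
      · ext t
        constructor
        · rintro ⟨h1, h2⟩
          refine ⟨?_, h2⟩
          obtain ⟨q, hq, rfl⟩ := h2
          exact ⟨q, ⟨hq, by rw [mem_preimage, hgraph q hq]; exact h1⟩, rfl⟩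
        · rintro ⟨⟨q, ⟨hq, h1⟩, rfl⟩, h2⟩
          exact ⟨by rw [mem_preimage, ← hgraph q hq]; exact h1, h2⟩
    obtain ⟨m, hm, h⟩ := hasLog_closed_real (f := fun t => f (b t)) hTc.isClosed
      (hf.comp hbc hbS) (fun t ht => h0 _ (hbS t ht))
    exact ⟨m, hm, fun q hq => (h _ ⟨q, hq, rfl⟩).trans (by simp only [← hgraph q hq])⟩
  obtain ⟨m, hmc, hm⟩ := hm
  have hcor : ∃ n : ℤ, ∀ q ∈ P, ∀ q' ∈ P, q.2 = q'.2 →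
      m q.1 + n * (2 * Real.pi * q.1 * Complex.I) = m q'.1 + n * (2 * Real.pi * q'.1 * Complex.I) := by
    have hpp : ∀ q ∈ P, ∀ q' ∈ P, q.2 = q'.2 → q.1 < q'.1 → q.1 = 0 ∧ q'.1 = 1 := by
      intro q hq q' hq' h hlt
      have h1 : p q.1 = p q'.1 := by rw [← hq.2.2, ← hq'.2.2, h]
      obtain ⟨k, hk⟩ := Complex.exp_eq_exp_iff_exists_int.1 h1
      have hk' : q.1 = q'.1 + k := by
        have h3 : (2 * Real.pi * Complex.I) * ((q.1 : ℂ) - (q'.1 + k)) = 0 := by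
          linear_combination hk
        have := (mul_eq_zero.1 h3).resolve_left Complex.two_pi_I_ne_zero
        have := sub_eq_zero.1 this
        exact_mod_cast this
      have hk1 : k < 0 := by
        have : (k : ℝ) < 0 := by linarith
        exact_mod_cast this
      have hk2 : (k : ℝ) ≤ -1 := by exact_mod_cast Int.le_sub_one_of_lt hk1
      have := hq.1.1; have := hq'.1.2
      constructor <;> linarith
    by_cases hex : ∃ q ∈ P, ∃ q' ∈ P, q.2 = q'.2 ∧ q.1 < q'.1
    · obtain ⟨q, hq, q', hq', h, hlt⟩ := hex
      obtain ⟨e0, e1⟩ := hpp q hq q' hq' h hlt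
      have : Complex.exp (m 0) = Complex.exp (m 1) := by
        rw [← e0, ← e1, hm q hq, hm q' hq', h]
      obtain ⟨n, hn⟩ := Complex.exp_eq_exp_iff_exists_int.1 this
      have main : ∀ q ∈ P, ∀ q' ∈ P, q.2 = q'.2 → q.1 < q'.1 →
          m q.1 + n * (2 * Real.pi * q.1 * Complex.I)
            = m q'.1 + n * (2 * Real.pi * q'.1 * Complex.I) := by
        intro q hq q' hq' h hlt
        obtain ⟨e0, e1⟩ := hpp q hq q' hq' h hlt
        rw [e0, e1, hn]; push_cast; ring
      refine ⟨n, fun q hq q' hq' h => ?_⟩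
      rcases lt_trichotomy q.1 q'.1 with hlt | heq | hlt
      · exact main q hq q' hq' h hlt
      · rw [heq]
      · exact (main q' hq' q hq h.symm hlt).symm
    · push Not at hex
      refine ⟨0, fun q hq q' hq' h => ?_⟩
      have : q.1 = q'.1 := le_antisymm (hex q' hq' q hq h.symm) (hex q hq q' hq' h)
      rw [this]
  obtain ⟨n, hn⟩ := hcor
  refine ⟨n, ?_⟩
  have ht : ∀ z ∈ S, ∃ t : ℝ, (t, z) ∈ P := by
    intro z hz
    have h1 : ∃ t : ℝ, t ∈ Icc (0:ℝ) 1 ∧ p t = θ z := by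
      have h2 := Complex.norm_mul_exp_arg_mul_I (θ z)
      rw [hnorm z hz] at h2
      set a := Complex.arg (θ z)
      have hpi := Real.pi_pos
      have ha1 := Complex.neg_pi_lt_arg (θ z)
      have ha2 := Complex.arg_le_pi (θ z)
      by_cases ha : 0 ≤ a
      · refine ⟨a / (2 * Real.pi), ⟨by positivity, by rw [div_le_one (by positivity)]; linarith⟩, ?_⟩
        rw [← h2]
        simp only [p]
        push_cast
        rw [one_mul]; congr 1
        have : (Real.pi : ℂ) ≠ 0 := by exact_mod_cast hpi.ne'
        field_simp
      · refine ⟨a / (2 * Real.pi) + 1, ⟨?_, ?_⟩, ?_⟩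
        · have : -1 ≤ a / (2 * Real.pi) := by rw [le_div_iff₀ (by positivity)]; linarith
          linarith
        · have : a / (2 * Real.pi) ≤ 0 := div_nonpos_of_nonpos_of_nonneg (by linarith) (by positivity)
          linarith
        · rw [← h2]
          simp only [p]
          push_cast
          rw [one_mul, Complex.exp_eq_exp_iff_exists_int]
          refine ⟨1, ?_⟩
          have : (Real.pi : ℂ) ≠ 0 := by exact_mod_cast hpi.ne'
          field_simp
          push_cast
          ring
    obtain ⟨t, h1, h2⟩ := h1
    exact ⟨t, h1, hz, h2.symm⟩
  choose! t ht using ht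
  let M : ℝ → ℂ := fun s => m s + n * (2 * Real.pi * s * Complex.I)
  have hM : ContinuousOn M T := hmc.add (by fun_prop)
  refine ⟨fun z => M (t z), ?_, ?_⟩
  · rw [continuousOn_iff_isClosed]
    intro C hC
    have hMP : ContinuousOn (fun q : ℝ × ℂ => M q.1) P :=
      hM.comp continuousOn_fst (fun q hq => ⟨q, hq, rfl⟩)
    have hcl := hMP.preimage_isClosed_of_isClosed hPc.isClosed hC
    refine ⟨Prod.snd '' (P ∩ (fun q : ℝ × ℂ => M q.1) ⁻¹' C), ?_, ?_⟩
    · exact ((hPc.of_isClosed_subset hcl inter_subset_left).image continuous_snd).isClosed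
    · ext z
      constructor
      · rintro ⟨h1, h2⟩
        exact ⟨⟨(t z, z), ⟨ht z h2, h1⟩, rfl⟩, h2⟩
      · rintro ⟨⟨q, ⟨hq, h1⟩, rfl⟩, h2⟩
        refine ⟨?_, h2⟩
        have := hn q hq _ (ht _ h2) rfl
        change M (t q.2) ∈ C
        change M q.1 ∈ C at h1
        have e : M q.1 = M (t q.2) := this
        rw [← e]; exact h1
  · intro z hz
    have h1 := ht z hz
    simp only [M]
    rw [Complex.exp_add, hm _ h1, Complex.exp_int_mul]
    have h2 := h1.2.2
    simp only at h2
    simp only [h2, p]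

end LogBasics


section LogDom
open Topology

theorem fill_lemma {A Q : Set ℂ} (hA : IsClosed A) (hQ : IsClosed Q) {f : ℂ → ℂ}
    (hf : ContinuousOn f A) (h0 : ∀ z ∈ A, f z ≠ 0) (hl : HasLog f (A ∩ Q)) :
    ∃ f' : ℂ → ℂ, ContinuousOn f' (A ∪ Q) ∧ (∀ z ∈ A ∪ Q, f' z ≠ 0) ∧ ∀ z ∈ A, f' z = f z := by
  classical
  obtain ⟨l, hl, hlf⟩ := hl
  obtain ⟨m, hm, hml⟩ := exists_tietze (hA.inter hQ) hl
  have hQ' : ∀ z ∈ Q, (if z ∈ A then f z else Complex.exp (m z)) = Complex.exp (m z) := by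
    intro z hz
    split_ifs with h
    · rw [hml z ⟨h, hz⟩, hlf z ⟨h, hz⟩]
    · rfl
  refine ⟨fun z => if z ∈ A then f z else Complex.exp (m z), ?_, ?_, ?_⟩
  · refine ContinuousOn.union_of_isClosed ?_ ?_ hA hQ
    · exact hf.congr fun z hz => by simp [hz]
    · exact (Complex.continuous_exp.comp hm).continuousOn.congr hQ'
  · rintro z hz
    simp only
    split_ifs with h
    · exact h0 z h
    · exact Complex.exp_ne_zero _
  · intro z hz; simp [hz]

/-- closed grid square -/
def Sq (h : ℝ) (i : ℤ × ℤ) : Set ℂ := {z | |z.re - i.1 * h| ≤ h / 2 ∧ |z.im - i.2 * h| ≤ h / 2}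

def sqc (h : ℝ) (i : ℤ × ℤ) : ℂ := ⟨i.1 * h, i.2 * h⟩

theorem sq_closed (h : ℝ) (i : ℤ × ℤ) : IsClosed (Sq h i) := by
  have h1 : IsClosed {z : ℂ | |z.re - i.1 * h| ≤ h / 2} :=
    isClosed_le (by fun_prop) continuous_const
  have h2 : IsClosed {z : ℂ | |z.im - i.2 * h| ≤ h / 2} :=
    isClosed_le (by fun_prop) continuous_const
  exact h1.inter h2

theorem sqU_closed (h : ℝ) (S : Finset (ℤ × ℤ)) : IsClosed (⋃ i ∈ S, Sq h i) :=
  S.finite_toSet.isClosed_biUnion fun i _ => sq_closed h i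

theorem int_sep {h x : ℝ} (hh : 0 < h) {i j : ℤ} (hi : |x - i * h| ≤ h / 2)
    (hj : |x - j * h| < h / 2) : i = j := by
  have h1 : |((i : ℝ) - j) * h| < h := by
    have : ((i : ℝ) - j) * h = (x - j * h) - (x - i * h) := by ring
    rw [this]
    calc _ ≤ |x - j * h| + |x - i * h| := abs_sub _ _
      _ < h := by linarith
  rw [abs_mul, abs_of_pos hh] at h1
  have h2 : |((i : ℝ) - j)| < 1 := by nlinarith
  have h3 : |i - j| < 1 := by exact_mod_cast h2
  have := Int.abs_lt_one_iff.1 h3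
  omega

theorem sq_sep {h : ℝ} (hh : 0 < h) {i j : ℤ × ℤ} {z : ℂ} (hi : z ∈ Sq h i)
    (h1 : |z.re - j.1 * h| < h / 2) (h2 : |z.im - j.2 * h| < h / 2) : i = j :=
  Prod.ext (int_sep hh hi.1 h1) (int_sep hh hi.2 h2)

theorem sqc_mem {h : ℝ} (hh : 0 < h) {i j : ℤ × ℤ} (hi : sqc h i ∈ Sq h j) : j = i :=
  sq_sep hh hi (by simp [sqc]; exact hh) (by simp [sqc]; exact hh)

theorem sq_compact (h : ℝ) (i : ℤ × ℤ) : IsCompact (Sq h i) := by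
  have : Sq h i = Icc (i.1 * h - h / 2) (i.1 * h + h / 2) ×ℂ Icc (i.2 * h - h / 2) (i.2 * h + h / 2) := by
    ext z
    simp only [Sq, mem_ofPred_eq, Complex.mem_reProdIm, mem_Icc, abs_le]
    constructor <;> rintro ⟨⟨a, b⟩, c, d⟩ <;> refine ⟨⟨?_, ?_⟩, ?_, ?_⟩ <;> linarith
  rw [this]
  exact isCompact_Icc.reProdIm isCompact_Icc

theorem sq_bdry_inj {h : ℝ} (hh : 0 < h) (j : ℤ × ℤ) :
    InjOn (fun z : ℂ => (z - sqc h j) / ‖z - sqc h j‖)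
      {z | z ∈ Sq h j ∧ ¬ (|z.re - j.1 * h| < h / 2 ∧ |z.im - j.2 * h| < h / 2)} := by
  have key : ∀ z ∈ {z | z ∈ Sq h j ∧ ¬ (|z.re - j.1 * h| < h / 2 ∧ |z.im - j.2 * h| < h / 2)},
      max |(z - sqc h j).re| |(z - sqc h j).im| = h / 2 ∧ 0 < ‖z - sqc h j‖ := by
    rintro z ⟨⟨h1, h2⟩, h3⟩
    have e : max |(z - sqc h j).re| |(z - sqc h j).im| = h / 2 := by
      simp only [sqc, Complex.sub_re, Complex.sub_im]
      refine le_antisymm (max_le h1 h2) ?_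
      by_contra hc
      push Not at hc
      exact h3 (max_lt_iff.1 hc)
    refine ⟨e, ?_⟩
    rw [norm_pos_iff]
    intro h0
    rw [h0] at e
    simp at e
    linarith
  intro z hz w hw hzw
  obtain ⟨a1, a2⟩ := key z hz
  obtain ⟨b1, b2⟩ := key w hw
  simp only at hzw
  set a := z - sqc h j
  set b := w - sqc h j
  have hab : a = ((‖a‖ / ‖b‖ : ℝ) : ℂ) * b := by
    have h1 : (‖a‖ : ℂ) ≠ 0 := by exact_mod_cast a2.ne'
    have h2 : (‖b‖ : ℂ) ≠ 0 := by exact_mod_cast b2.ne'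
    push_cast
    rw [div_eq_div_iff h1 h2] at hzw
    field_simp
    linear_combination hzw
  set t := ‖a‖ / ‖b‖
  have ht : 0 < t := div_pos a2 b2
  have : t * (h / 2) = h / 2 := by
    rw [hab] at a1
    simp only [Complex.re_ofReal_mul, Complex.im_ofReal_mul, abs_mul, abs_of_pos ht] at a1
    rw [← mul_max_of_nonneg _ _ ht.le, b1] at a1
    exact a1
  have ht1 : t = 1 := by
    have : (t - 1) * (h / 2) = 0 := by linarith
    rcases mul_eq_zero.1 this with h | h <;> linarith
  rw [ht1] at hab
  simp at hab
  have : z - sqc h j = w - sqc h j := hab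
  exact sub_left_injective this

theorem grid_extend {h : ℝ} (hh : 0 < h) (S B : Finset (ℤ × ℤ)) (hd : Disjoint S B) {f : ℂ → ℂ}
    (hf : ContinuousOn f (⋃ i ∈ S, Sq h i)) (h0 : ∀ z ∈ ⋃ i ∈ S, Sq h i, f z ≠ 0) :
    ∃ (n : ℤ × ℤ → ℤ) (f' : ℂ → ℂ), ContinuousOn f' (⋃ i ∈ S ∪ B, Sq h i) ∧
      (∀ z ∈ ⋃ i ∈ S ∪ B, Sq h i, f' z ≠ 0) ∧
      ∀ z ∈ ⋃ i ∈ S, Sq h i, f' z = f z * ∏ b ∈ B, (z - sqc h b) ^ (n b) := by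
  classical
  induction B using Finset.induction_on with
  | empty => exact ⟨0, f, by simpa using hf, by simpa using h0, by simp⟩
  | insert b B hb ih =>
    rw [Finset.disjoint_insert_right] at hd
    obtain ⟨n, f1, c1, n1, e1⟩ := ih hd.2
    set A := ⋃ i ∈ S ∪ B, Sq h i with hA
    have hbS : b ∉ S ∪ B := by simp [hd.1, hb]
    have hcA : ∀ z ∈ A, z ∈ A → ¬ (|z.re - b.1 * h| < h / 2 ∧ |z.im - b.2 * h| < h / 2) := by
      rintro z hz - ⟨h1, h2⟩
      simp only [hA, mem_iUnion] at hz
      obtain ⟨i, hi, hz⟩ := hz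
      exact hbS (sq_sep hh hz h1 h2 ▸ hi)
    have hne : ∀ z ∈ A, z - sqc h b ≠ 0 := by
      intro z hz hz0
      have : z = sqc h b := sub_eq_zero.1 hz0
      exact hcA z hz hz (by rw [this]; simp [sqc, hh])
    have hAc : IsClosed A := sqU_closed h _
    have hcomp : IsCompact (A ∩ Sq h b) := (sq_compact h b).inter_left hAc
    have hnc : ContinuousOn (fun z : ℂ => ((‖z - sqc h b‖ : ℝ) : ℂ)) (A ∩ Sq h b) := by
      fun_prop
    obtain ⟨k, hk⟩ := hasLog_circle hcomp (θ := fun z : ℂ => (z - sqc h b) / ‖z - sqc h b‖)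
      (f := f1)
      (ContinuousOn.div (by fun_prop) hnc (fun z hz => by
        simpa using hne z hz.1))
      (InjOn.mono (fun z (hz : z ∈ A ∩ Sq h b) => And.intro hz.2 (hcA z hz.1 hz.1))
        (sq_bdry_inj hh b))
      (fun z hz => by
        have := norm_ne_zero_iff.2 (hne z hz.1)
        simp [this])
      (c1.mono inter_subset_left) (fun z hz => n1 z hz.1)
    have hl : HasLog (fun z => f1 z * (z - sqc h b) ^ k) (A ∩ Sq h b) := by
      have h1 : HasLog (fun z : ℂ => ((‖z - sqc h b‖ : ℝ) : ℂ)) (A ∩ Sq h b) :=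
        hasLog_of_slitPlane hnc fun z hz => by
          rw [Complex.ofReal_mem_slitPlane]
          exact norm_pos_iff.2 (hne z hz.1)
      refine (hk.mul (h1.zpow k)).congr fun z hz => ?_
      have h3 : ((‖z - sqc h b‖ : ℝ) : ℂ) ≠ 0 := by
        simpa using hne z hz.1
      rw [div_zpow, mul_assoc, div_mul_cancel₀]
      exact zpow_ne_zero _ h3
    obtain ⟨f2, c2, n2, e2⟩ := fill_lemma hAc (sq_closed h b)
      (f := fun z => f1 z * (z - sqc h b) ^ k)
      (c1.mul (ContinuousOn.zpow₀ (by fun_prop) _ fun z hz => Or.inl (hne z hz)))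
      (fun z hz => mul_ne_zero (n1 z hz) (zpow_ne_zero _ (hne z hz))) hl
    have hun : (⋃ i ∈ S ∪ insert b B, Sq h i) = A ∪ Sq h b := by
      rw [hA, Finset.union_insert, Finset.set_biUnion_insert, union_comm]
    rw [hun]
    refine ⟨Function.update n b k, f2, c2, n2, fun z hz => ?_⟩
    have hzA : z ∈ A := by
      simp only [mem_iUnion] at hz
      obtain ⟨i, hi, hz⟩ := hz
      simp only [hA, mem_iUnion]
      exact ⟨i, by simp [hi], hz⟩
    rw [e2 z hzA, e1 z hz, Finset.prod_insert hb, Function.update_self]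
    have hp : ∏ x ∈ B, (z - sqc h x) ^ (Function.update n b k x)
        = ∏ x ∈ B, (z - sqc h x) ^ (n x) :=
      Finset.prod_congr rfl (fun x hx => by
        rw [Function.update_of_ne (by rintro rfl; exact hb hx)])
    rw [hp]
    ring

theorem hasLog_sub_near {C : Set ℂ} {a b : ℂ} {d : ℝ} (hd : ∀ z ∈ C, d ≤ ‖z - a‖)
    (hab : ‖b - a‖ < d) (ha : HasLog (fun z => z - a) C) : HasLog (fun z => z - b) C := by
  have hd0 : 0 < d := (norm_nonneg _).trans_lt hab
  have hne : ∀ z ∈ C, z - a ≠ 0 := fun z hz => norm_pos_iff.1 (hd0.trans_le (hd z hz))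
  have h1 : HasLog (fun z => (z - b) / (z - a)) C := by
    refine hasLog_of_slitPlane (ContinuousOn.div (by fun_prop) (by fun_prop) hne) fun z hz => ?_
    have : (z - b) / (z - a) = 1 + (a - b) / (z - a) := by
      have := hne z hz
      field_simp
      ring
    rw [this]
    refine Complex.mem_slitPlane_of_norm_lt_one ?_
    rw [norm_div, div_lt_one (norm_pos_iff.2 (hne z hz)), norm_sub_rev]
    exact hab.trans_le (hd z hz)
  refine (h1.mul ha).congr fun z hz => ?_
  rw [div_mul_cancel₀ _ (hne z hz)]

theorem hasLog_sub_of_unbdd {C Y : Set ℂ} (hC : IsCompact C) (hY : IsPreconnected Y)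
    (hd : Disjoint Y C) (hub : ¬ Bornology.IsBounded Y) {a : ℂ} (ha : a ∈ Y) :
    HasLog (fun z => z - a) C := by
  have near : ∀ a ∉ C, ∃ d > 0, ∀ z ∈ C, d ≤ ‖z - a‖ := by
    intro a ha
    obtain ⟨d, hd, h⟩ := Metric.isOpen_iff.1 hC.isClosed.isOpen_compl a ha
    refine ⟨d, hd, fun z hz => ?_⟩
    by_contra hc
    push Not at hc
    exact h (by rwa [Metric.mem_ball, dist_eq_norm]) hz
  have ho : ∀ P : Prop, IsOpen {a | a ∉ C ∧ (HasLog (fun z => z - a) C ↔ P)} := by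
    intro P
    rw [Metric.isOpen_iff]
    rintro a ⟨ha, hP⟩
    obtain ⟨d, hd, h⟩ := near a ha
    refine ⟨d / 2, by positivity, fun b hb => ?_⟩
    rw [Metric.mem_ball, dist_eq_norm] at hb
    have hb' : ∀ z ∈ C, d / 2 ≤ ‖z - b‖ := fun z hz => by
      have h1 := h z hz
      have h2 : ‖z - a‖ ≤ ‖z - b‖ + ‖b - a‖ := by
        simpa using norm_add_le (z - b) (b - a)
      linarith
    refine ⟨fun hbC => ?_, ?_⟩
    · have := hb' b hbC
      simp at this; linarith
    · rw [← hP]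
      exact ⟨hasLog_sub_near hb' (by rwa [norm_sub_rev]), hasLog_sub_near h (by linarith)⟩
  obtain ⟨R, hR⟩ := hC.isBounded.exists_norm_le
  obtain ⟨b, hbY, hb⟩ : ∃ b ∈ Y, |R| + 1 < ‖b‖ := by
    by_contra hc
    push Not at hc
    exact hub (isBounded_iff_forall_norm_le.2 ⟨_, hc⟩)
  have hbl : HasLog (fun z => z - b) C := by
    have hb0 : b ≠ 0 := by
      rintro rfl; simp at hb; linarith [abs_nonneg R]
    have h1 : HasLog (fun z => 1 + (- z / b)) C := by
      refine hasLog_of_slitPlane (by fun_prop) fun z hz => ?_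
      refine Complex.mem_slitPlane_of_norm_lt_one ?_
      rw [norm_div, norm_neg, div_lt_one (norm_pos_iff.2 hb0)]
      linarith [hR z hz, le_abs_self R]
    refine ((hasLog_const (-b) (neg_ne_zero.2 hb0) C).mul h1).congr fun z _ => ?_
    field_simp
    ring
  have := hY.subset_left_of_subset_union (ho True) (ho False) (by
      rw [Set.disjoint_left]
      rintro x ⟨_, h1⟩ ⟨_, h2⟩
      simp_all) (by
      intro x hx
      have := Set.disjoint_left.1 hd hx
      by_cases h : HasLog (fun z => z - x) C
      · left; exact ⟨this, by simp [h]⟩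
      · right; exact ⟨this, by simp [h]⟩)
      ⟨b, hbY, Set.disjoint_left.1 hd hbY, by simp [hbl]⟩
  simpa using (this ha).2

/-- clamping -/
theorem hasLog_box {N : ℝ} (hN : 0 ≤ N) {f : ℂ → ℂ} {Bx : Set ℂ}
    (hB : Bx = {z | |z.re| ≤ N ∧ |z.im| ≤ N}) (hf : ContinuousOn f Bx)
    (h0 : ∀ z ∈ Bx, f z ≠ 0) : HasLog f Bx := by
  have hcl : ∀ x : ℝ, |max (-N) (min N x)| ≤ N := fun x => by
    rw [abs_le]
    exact ⟨le_max_left _ _, max_le (by linarith) (min_le_left _ _)⟩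
  let r : ℂ → ℂ := fun z => ((max (-N) (min N z.re) : ℝ) : ℂ) + ((max (-N) (min N z.im) : ℝ) : ℂ) * Complex.I
  have hr : Continuous r := by fun_prop
  have hrB : ∀ z, r z ∈ Bx := fun z => by
    rw [hB]
    constructor
    · simpa [r] using hcl z.re
    · simpa [r] using hcl z.im
  have h1 : HasLog (fun z => f (r z)) univ :=
    hasLog_of_convex convex_univ isOpen_univ (hf.comp hr.continuousOn fun z _ => hrB z)
      fun z _ => h0 _ (hrB z)
  refine (h1.mono (subset_univ Bx)).congr fun z hz => ?_
  have : r z = z := by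
    rw [hB] at hz
    obtain ⟨h1, h2⟩ := hz
    rw [abs_le] at h1 h2
    simp only [r]
    rw [min_eq_right h1.2, max_eq_right h1.1, min_eq_right h2.2, max_eq_right h2.1]
    exact Complex.re_add_im z
  rw [this]

end LogDom


section LogDom2
open Topology

theorem grid_line {h x : ℝ} (hh : 0 < h) (N : ℕ) :
    |x| ≤ N * h + h / 2 ↔ ∃ i : ℤ, (-(N:ℤ) ≤ i ∧ i ≤ N) ∧ |x - i * h| ≤ h / 2 := by
  constructor
  · intro hx
    rw [abs_le] at hx
    by_cases h1 : N * h < x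
    · refine ⟨N, ⟨by omega, le_rfl⟩, ?_⟩
      rw [abs_le]; push_cast; constructor <;> linarith
    by_cases h2 : x < - (N * h)
    · refine ⟨-N, ⟨le_rfl, by omega⟩, ?_⟩
      rw [abs_le]; push_cast; constructor <;> linarith
    push Not at h1 h2
    have h3 := abs_sub_round (x / h)
    rw [abs_le] at h3
    have h4 : x / h ≤ N := by rwa [div_le_iff₀ hh]
    have h5 : -(N:ℝ) ≤ x / h := by rw [le_div_iff₀ hh]; linarith
    have h6 : (round (x / h) : ℝ) < N + 1 := by linarith
    have h7 : -(N:ℝ) - 1 < (round (x / h) : ℝ) := by linarith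
    refine ⟨round (x / h), ⟨?_, ?_⟩, ?_⟩
    · have : -(N:ℤ) - 1 < round (x / h) := by exact_mod_cast h7
      omega
    · have : round (x / h) < (N:ℤ) + 1 := by exact_mod_cast h6
      omega
    · have : x - round (x / h) * h = (x / h - round (x / h)) * h := by field_simp
      rw [this, abs_mul, abs_of_pos hh]
      have := abs_sub_round (x / h)
      nlinarith
  · rintro ⟨i, ⟨h1, h2⟩, h3⟩
    have h1' : -(N:ℝ) ≤ i := by exact_mod_cast h1
    have h2' : (i:ℝ) ≤ N := by exact_mod_cast h2
    rw [abs_le] at h3 ⊢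
    constructor <;> nlinarith

theorem grid_box {h : ℝ} (hh : 0 < h) (N : ℕ) :
    (⋃ i ∈ Finset.Icc (-(N:ℤ)) N ×ˢ Finset.Icc (-(N:ℤ)) N, Sq h i)
      = {z | |z.re| ≤ N * h + h / 2 ∧ |z.im| ≤ N * h + h / 2} := by
  ext z
  simp only [mem_iUnion, Finset.mem_product, Finset.mem_Icc, mem_ofPred_eq, grid_line hh]
  constructor
  · rintro ⟨i, ⟨h1, h2⟩, h3, h4⟩
    exact ⟨⟨i.1, h1, h3⟩, ⟨i.2, h2, h4⟩⟩
  · rintro ⟨⟨i, h1, h3⟩, ⟨j, h2, h4⟩⟩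
    exact ⟨(i, j), ⟨h1, h2⟩, h3, h4⟩

theorem hasLog_compact {Ω : Set ℂ} (hΩ : IsOpen Ω) (hb : Bornology.IsBounded Ω)
    (hc : IsPreconnected Ωᶜ) {f : ℂ → ℂ} (hf : ContinuousOn f Ω) (h0 : ∀ z ∈ Ω, f z ≠ 0)
    {L : Set ℂ} (hL : IsCompact L) (hLΩ : L ⊆ Ω) : HasLog f L := by
  classical
  obtain ⟨d, hd, hdL⟩ := hL.exists_thickening_subset_open hΩ hLΩ
  set h := d / 3 with hhd
  have hh : 0 < h := by positivity
  obtain ⟨R, hR⟩ := hb.exists_norm_le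
  obtain ⟨N, hN⟩ := exists_nat_gt (R / h)
  rw [div_lt_iff₀ hh] at hN
  set T := Finset.Icc (-(N:ℤ)) N ×ˢ Finset.Icc (-(N:ℤ)) N with hT
  set S := T.filter (fun i => Sq h i ⊆ Ω) with hS
  set B := T.filter (fun i => ¬ Sq h i ⊆ Ω) with hB
  have hSB : S ∪ B = T := Finset.filter_union_filter_not_eq _ T
  have hdis : Disjoint S B := Finset.disjoint_filter_filter_not _ _ _
  have hSΩ : (⋃ i ∈ S, Sq h i) ⊆ Ω := by
    intro z hz
    simp only [mem_iUnion, hS, Finset.mem_filter] at hz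
    obtain ⟨i, ⟨_, hi⟩, hz⟩ := hz
    exact hi hz
  have hSc : IsCompact (⋃ i ∈ S, Sq h i) :=
    S.finite_toSet.isCompact_biUnion fun i _ => sq_compact h i
  have hΩbox : Ω ⊆ ⋃ i ∈ T, Sq h i := by
    rw [hT, grid_box hh]
    intro z hz
    have := hR z hz
    exact ⟨by linarith [Complex.abs_re_le_norm z], by linarith [Complex.abs_im_le_norm z]⟩
  have hLS : L ⊆ ⋃ i ∈ S, Sq h i := by
    intro z hz
    have := hΩbox (hLΩ hz)
    simp only [mem_iUnion] at this ⊢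
    obtain ⟨i, hi, hzi⟩ := this
    refine ⟨i, ?_, hzi⟩
    rw [hS, Finset.mem_filter]
    refine ⟨hi, fun w hw => hdL ?_⟩
    rw [Metric.mem_thickening_iff]
    refine ⟨z, hz, ?_⟩
    rw [dist_eq_norm]
    have h1 := Complex.norm_le_abs_re_add_abs_im (w - z)
    have h2 : |(w - z).re| ≤ h := by
      have := abs_sub (w.re - i.1 * h) (z.re - i.1 * h)
      have e : (w.re - i.1 * h) - (z.re - i.1 * h) = (w - z).re := by simp
      rw [e] at this
      linarith [hw.1, hzi.1]
    have h3 : |(w - z).im| ≤ h := by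
      have := abs_sub (w.im - i.2 * h) (z.im - i.2 * h)
      have e : (w.im - i.2 * h) - (z.im - i.2 * h) = (w - z).im := by simp
      rw [e] at this
      linarith [hw.2, hzi.2]
    have : h + h < d := by rw [hhd]; linarith
    linarith
  obtain ⟨n, f', c', n', e'⟩ := grid_extend hh S B hdis (hf.mono hSΩ)
    (fun z hz => h0 z (hSΩ hz))
  rw [hSB, hT, grid_box hh] at c' n'
  have hl' := hasLog_box (by positivity) rfl c' n'
  have hSbox : (⋃ i ∈ S, Sq h i) ⊆ {z | |z.re| ≤ N * h + h / 2 ∧ |z.im| ≤ N * h + h / 2} := by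
    rw [← grid_box hh, ← hT]
    exact hSΩ.trans hΩbox
  have hprod : HasLog (fun z => ∏ b ∈ B, (z - sqc h b) ^ (n b)) (⋃ i ∈ S, Sq h i) := by
    refine HasLog.prod B fun b hbB => HasLog.zpow ?_ _
    have hbB' := hbB
    rw [hB, Finset.mem_filter, not_subset] at hbB
    obtain ⟨_, a, ha, haΩ⟩ := hbB
    have hbS : b ∉ S := fun h => Finset.disjoint_left.1 hdis h hbB'
    refine hasLog_sub_of_unbdd (Y := segment ℝ a (sqc h b) ∪ Ωᶜ) hSc ?_ ?_ ?_
      (Or.inl (right_mem_segment ℝ a (sqc h b)))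
    · exact (convex_segment _ _).isPreconnected.union a (left_mem_segment ℝ _ _) haΩ hc
    · rw [disjoint_union_left]
      constructor
      · rw [Set.disjoint_left]
        intro z hz hzS
        rw [segment_eq_image] at hz
        obtain ⟨t, ⟨ht0, ht1⟩, rfl⟩ := hz
        rcases eq_or_lt_of_le ht0 with rfl | ht
        · simp only [sub_zero, one_smul, zero_smul, add_zero] at hzS
          exact haΩ (hSΩ hzS)
        · simp only [mem_iUnion] at hzS
          obtain ⟨i, hi, hzi⟩ := hzS
          refine hbS ((sq_sep (j := b) hh hzi ?_ ?_) ▸ hi)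
          · have : ((1 - t) • a + t • sqc h b).re - b.1 * h = (1 - t) * (a.re - b.1 * h) := by
              simp [sqc]; ring
            rw [this, abs_mul, abs_of_nonneg (by linarith)]
            have := ha.1
            nlinarith [abs_nonneg (a.re - b.1 * h)]
          · have : ((1 - t) • a + t • sqc h b).im - b.2 * h = (1 - t) * (a.im - b.2 * h) := by
              simp [sqc]; ring
            rw [this, abs_mul, abs_of_nonneg (by linarith)]
            have := ha.2
            nlinarith [abs_nonneg (a.im - b.2 * h)]
      · exact (disjoint_compl_left).mono_right hSΩ
    · intro hbd
      have h1 : Bornology.IsBounded (Ω ∪ Ωᶜ) := hb.union (hbd.subset subset_union_right)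
      rw [union_compl_self] at h1
      exact NormedSpace.unbounded_univ ℝ ℂ h1
  refine (((hl'.mono hSbox).congr e').div hprod).mono hLS |>.congr fun z hz => ?_
  rw [mul_div_assoc, div_self, mul_one]
  obtain ⟨l, _, hl⟩ := hprod
  exact fun h => Complex.exp_ne_zero _ ((hl z (hLS hz)).trans h)

/-- every nonvanishing continuous function has a log -/
def LogDomain (Ω : Set ℂ) : Prop :=
  ∀ f : ℂ → ℂ, ContinuousOn f Ω → (∀ z ∈ Ω, f z ≠ 0) → HasLog f Ω

theorem logDomain_of_compl {Ω : Set ℂ} (hΩ : IsOpen Ω) (hcon : IsPreconnected Ω)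
    (hb : Bornology.IsBounded Ω) (hc : IsPreconnected Ωᶜ) : LogDomain Ω := by
  intro f hf h0
  rcases Ω.eq_empty_or_nonempty with rfl | ⟨p, hp⟩
  · exact ⟨fun _ => 0, continuousOn_const, by simp⟩
  have hpc : IsPathConnected Ω := hΩ.isConnected_iff_isPathConnected.1 ⟨⟨p, hp⟩, hcon⟩
  let v := Complex.log (f p)
  have ex : ∀ L : Set ℂ, IsCompact L → L ⊆ Ω → p ∈ L → ∃ m : ℂ → ℂ, ContinuousOn m L ∧
      (∀ z ∈ L, Complex.exp (m z) = f z) ∧ m p = v := by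
    intro L hL hLΩ hpL
    obtain ⟨m, hm, h⟩ := hasLog_compact hΩ hb hc hf h0 hL hLΩ
    refine ⟨fun z => m z + (v - m p), hm.add continuousOn_const, fun z hz => ?_, by ring⟩
    rw [Complex.exp_add, Complex.exp_sub, h p hpL, h z hz, Complex.exp_log (h0 p hp),
      div_self (h0 p hp), mul_one]
  have uni : ∀ L : Set ℂ, IsPreconnected L → p ∈ L → ∀ m m' : ℂ → ℂ, ContinuousOn m L →
      ContinuousOn m' L → (∀ z ∈ L, Complex.exp (m z) = f z) →
      (∀ z ∈ L, Complex.exp (m' z) = f z) → m p = m' p → ∀ z ∈ L, m z = m' z := by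
    intro L hL hpL m m' hm hm' h h' hp z hz
    obtain ⟨n, hn⟩ := log_unique hL hm hm' (fun z hz => by rw [h z hz, h' z hz])
    have h1 := hn p hpL
    rw [hn z hz]
    have h2 : (n : ℂ) * (2 * Real.pi * Complex.I) = 0 := by
      rw [hp] at h1
      linear_combination -h1
    rw [h2, add_zero]
  have ex2 : ∀ x ∈ Ω, ∃ L : Set ℂ, IsCompact L ∧ L ⊆ Ω ∧ p ∈ L ∧ x ∈ L ∧ IsPreconnected L := by
    intro x hx
    obtain ⟨γ, hγ⟩ := hpc.joinedIn p hp x hx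
    refine ⟨range γ, isCompact_range γ.continuous, by rintro _ ⟨t, rfl⟩; exact hγ t,
      ⟨0, γ.source⟩, ⟨1, γ.target⟩, isPreconnected_range γ.continuous⟩
  choose! L hLc hLΩ hpL hxL hLp using ex2
  have ex3 : ∀ x ∈ Ω, ∃ m : ℂ → ℂ, ContinuousOn m (L x) ∧
      (∀ z ∈ L x, Complex.exp (m z) = f z) ∧ m p = v :=
    fun x hx => ex _ (hLc x hx) (hLΩ x hx) (hpL x hx)
  choose! m hmc hme hmp using ex3
  have key : ∀ x ∈ Ω, ∀ L' : Set ℂ, IsCompact L' → L' ⊆ Ω → p ∈ L' → x ∈ L' → IsPreconnected L' →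
      ∀ m' : ℂ → ℂ, ContinuousOn m' L' → (∀ z ∈ L', Complex.exp (m' z) = f z) → m' p = v →
      m x x = m' x := by
    intro x hx L' h1 h2 h3 h4 h5 m' h6 h7 h8
    obtain ⟨M, hM, hMe, hMp⟩ := ex (L x ∪ L') ((hLc x hx).union h1) (union_subset (hLΩ x hx) h2)
      (Or.inr h3)
    have e1 := uni (L x) (hLp x hx) (hpL x hx) (m x) M (hmc x hx) (hM.mono subset_union_left)
      (hme x hx) (fun z hz => hMe z (Or.inl hz)) (by rw [hmp x hx, hMp]) x (hxL x hx)
    have e2 := uni L' h5 h3 m' M h6 (hM.mono subset_union_right)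
      h7 (fun z hz => hMe z (Or.inr hz)) (by rw [h8, hMp]) x h4
    rw [e1, e2]
  refine ⟨fun x => m x x, fun x hx => ContinuousAt.continuousWithinAt ?_,
    fun x hx => hme x hx x (hxL x hx)⟩
  obtain ⟨r, hr, hrΩ⟩ := Metric.nhds_basis_closedBall.mem_iff.1 (hΩ.mem_nhds hx)
  have hL1 : IsCompact (L x ∪ Metric.closedBall x r) :=
    (hLc x hx).union (isCompact_closedBall x r)
  have hL2 : L x ∪ Metric.closedBall x r ⊆ Ω := union_subset (hLΩ x hx) hrΩ
  have hL3 : IsPreconnected (L x ∪ Metric.closedBall x r) :=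
    (hLp x hx).union x (hxL x hx) (Metric.mem_closedBall_self hr.le)
      (convex_closedBall x r).isPreconnected
  obtain ⟨M, hM, hMe, hMp⟩ := ex _ hL1 hL2 (Or.inl (hpL x hx))
  have hMx : ContinuousAt M x := (hM.mono subset_union_right).continuousAt
    (Metric.closedBall_mem_nhds x hr)
  refine hMx.congr ?_
  filter_upwards [Metric.closedBall_mem_nhds x hr] with y hy
  exact (key y (hrΩ hy) _ hL1 hL2 (Or.inl (hpL x hx)) (Or.inr hy) hL3 M hM hMe hMp).symm

theorem compl_component_connected {X : Set ℂ} (hX : IsCompact X) (hXc : IsConnected X) (a : ℂ) :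
    IsPreconnected (connectedComponentIn Xᶜ a)ᶜ := by
  obtain ⟨x0, hx0⟩ := hXc.nonempty
  have hXo : IsOpen Xᶜ := hX.isClosed.isOpen_compl
  have hXs : X ⊆ (connectedComponentIn Xᶜ a)ᶜ := fun x hx h =>
    connectedComponentIn_subset _ _ h hx
  refine isPreconnected_of_forall x0 fun y hy => ?_
  by_cases hyX : y ∈ X
  · exact ⟨X, hXs, hx0, hyX, hXc.isPreconnected⟩
  set O := connectedComponentIn Xᶜ y with hO
  have hyO : y ∈ O := mem_connectedComponentIn hyX
  have hOo : IsOpen O := hXo.connectedComponentIn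
  obtain ⟨x, hx1, hx2⟩ : (closure O ∩ X).Nonempty := by
    by_contra hne
    rw [not_nonempty_iff_eq_empty] at hne
    have h1 : closure O ⊆ Xᶜ := fun z hz hzX => by
      have : z ∈ closure O ∩ X := ⟨hz, hzX⟩
      rw [hne] at this; exact this
    have h2 : closure O ⊆ O :=
      isPreconnected_connectedComponentIn.closure.subset_connectedComponentIn
        (subset_closure hyO) h1
    have h3 : IsClopen O := ⟨closure_subset_iff_isClosed.1 h2, hOo⟩
    have h4 : O = univ := h3.eq_univ ⟨y, hyO⟩
    exact connectedComponentIn_subset Xᶜ y (h4 ▸ mem_univ x0 : x0 ∈ O) hx0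
  have h5 : IsPreconnected (O ∪ {x}) :=
    isPreconnected_connectedComponentIn.subset_closure subset_union_left
      (union_subset subset_closure (singleton_subset_iff.2 hx1))
  refine ⟨(O ∪ {x}) ∪ X, ?_, Or.inr hx0, Or.inl (Or.inl hyO),
    h5.union x (Or.inr rfl) hx2 hXc.isPreconnected⟩
  refine union_subset (union_subset ?_ (singleton_subset_iff.2 (hXs hx2))) hXs
  intro z hz hza
  have e1 := connectedComponentIn_eq hz
  have e2 := connectedComponentIn_eq hza
  apply hy
  rw [e2, ← e1]
  exact hyO

theorem logDomain_component {X : Set ℂ} (hX : IsCompact X) (hXc : IsConnected X) (a : ℂ)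
    (hb : Bornology.IsBounded (connectedComponentIn Xᶜ a)) :
    LogDomain (connectedComponentIn Xᶜ a) :=
  logDomain_of_compl hX.isClosed.isOpen_compl.connectedComponentIn
    isPreconnected_connectedComponentIn hb (compl_component_connected hX hXc a)

/-- a continuous log of a holomorphic function is holomorphic -/
theorem log_differentiable {Ω : Set ℂ} (hΩ : IsOpen Ω) {f l : ℂ → ℂ} (hf : DifferentiableOn ℂ f Ω)
    (hl : ContinuousOn l Ω) (h : ∀ z ∈ Ω, Complex.exp (l z) = f z) : DifferentiableOn ℂ l Ω := by
  intro z hz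
  refine DifferentiableAt.differentiableWithinAt ?_
  have hne : f z ≠ 0 := by rw [← h z hz]; exact Complex.exp_ne_zero _
  have hfz : DifferentiableAt ℂ f z := hf.differentiableAt (hΩ.mem_nhds hz)
  have h1 : DifferentiableAt ℂ (fun w => l z + Complex.log (f w / f z)) z := by
    refine DifferentiableAt.const_add _ (DifferentiableAt.clog (hfz.div_const _) ?_)
    rw [div_self hne]; simp
  refine h1.congr_of_eventuallyEq ?_
  have c1 : Tendsto (fun w => ‖l w - (l z + Complex.log (f w / f z))‖) (𝓝 z) (𝓝 0) := by
    have h2 : ContinuousAt (fun w => ‖l w - (l z + Complex.log (f w / f z))‖) z :=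
      ((hl.continuousAt (hΩ.mem_nhds hz)).sub h1.continuousAt).norm
    have : ‖l z - (l z + Complex.log (f z / f z))‖ = 0 := by
      rw [div_self hne]; simp
    rw [← this]; exact h2
  filter_upwards [c1.eventually (gt_mem_nhds (by norm_num : (0:ℝ) < 6)), hΩ.mem_nhds hz] with w hw hwΩ
  refine exp_eq_exp_dist ?_ hw
  have hnw : f w ≠ 0 := by rw [← h w hwΩ]; exact Complex.exp_ne_zero _
  rw [Complex.exp_add, h w hwΩ, h z hz, Complex.exp_log (div_ne_zero hnw hne)]
  field_simp

end LogDom2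


section RMT
open Topology ComplexConjugate

/-- Blaschke factor -/
def Bla (b z : ℂ) : ℂ := (z - b) / (1 - conj b * z)

theorem bla_den {b z : ℂ} (hb : ‖b‖ < 1) (hz : ‖z‖ < 1) : 1 - conj b * z ≠ 0 := by
  intro h
  have h1 : conj b * z = 1 := (sub_eq_zero.1 h).symm
  have h2 : ‖conj b * z‖ = 1 := by rw [h1]; simp
  rw [norm_mul, RCLike.norm_conj] at h2
  nlinarith [norm_nonneg b, norm_nonneg z]

theorem bla_norm {b z : ℂ} (hb : ‖b‖ < 1) (hz : ‖z‖ < 1) : ‖Bla b z‖ < 1 := by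
  have hd := bla_den hb hz
  rw [Bla, norm_div, div_lt_one (norm_pos_iff.2 hd)]
  refine lt_of_pow_lt_pow_left₀ 2 (norm_nonneg _) ?_
  have e : ‖1 - conj b * z‖ ^ 2 - ‖z - b‖ ^ 2 = (1 - ‖z‖ ^ 2) * (1 - ‖b‖ ^ 2) := by
    simp only [← Complex.normSq_eq_norm_sq, Complex.normSq_apply]
    simp
    ring
  have h1 : ‖z‖ ^ 2 < 1 := by nlinarith [norm_nonneg z]
  have h2 : ‖b‖ ^ 2 < 1 := by nlinarith [norm_nonneg b]
  nlinarith [mul_pos (sub_pos.2 h1) (sub_pos.2 h2)]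

theorem bla_inj {b z w : ℂ} (hb : ‖b‖ < 1) (hz : ‖z‖ < 1) (hw : ‖w‖ < 1)
    (h : Bla b z = Bla b w) : z = w := by
  rw [Bla, Bla, div_eq_div_iff (bla_den hb hz) (bla_den hb hw)] at h
  have h1 : (z - w) * (1 - conj b * b) = 0 := by linear_combination h
  exact sub_eq_zero.1 ((mul_eq_zero.1 h1).resolve_right (bla_den hb hb))

theorem bla_diff {b : ℂ} (hb : ‖b‖ < 1) {f : ℂ → ℂ} {Ω : Set ℂ} (hf : DifferentiableOn ℂ f Ω)
    (hm : MapsTo f Ω (Metric.ball 0 1)) : DifferentiableOn ℂ (fun z => Bla b (f z)) Ω :=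
  (hf.sub_const b).div ((differentiableOn_const (1 : ℂ)).sub (hf.const_mul (conj b))) fun z hz =>
    bla_den hb (by simpa using hm hz)

structure RFam (Ω : Set ℂ) (p : ℂ) (f : ℂ → ℂ) : Prop where
  diff : DifferentiableOn ℂ f Ω
  maps : MapsTo f Ω (Metric.ball 0 1)
  inj : InjOn f Ω
  zero : f p = 0

theorem koebe {Ω : Set ℂ} (hΩ : IsOpen Ω) (hL : LogDomain Ω) {p q : ℂ} (hp : p ∈ Ω) (hq : q ∈ Ω)
    (hpq : q ≠ p) {f : ℂ → ℂ} (hf : RFam Ω p f) {a : ℂ} (ha : ‖a‖ < 1) (haf : ∀ z ∈ Ω, f z ≠ a) :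
    ∃ F : ℂ → ℂ, RFam Ω p F ∧ ‖f q‖ < ‖F q‖ := by
  have hf1 : ∀ z ∈ Ω, ‖f z‖ < 1 := fun z hz => by simpa using hf.maps hz
  have hgd := bla_diff ha hf.diff hf.maps
  have hg0 : ∀ z ∈ Ω, Bla a (f z) ≠ 0 := fun z hz =>
    div_ne_zero (sub_ne_zero.2 (haf z hz)) (bla_den ha (hf1 z hz))
  obtain ⟨l, hl, hle⟩ := hL _ hgd.continuousOn hg0
  have hld := log_differentiable hΩ hgd hl hle
  let s : ℂ → ℂ := fun z => Complex.exp (l z / 2)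
  have hs2 : ∀ z ∈ Ω, s z ^ 2 = Bla a (f z) := fun z hz => by
    simp only [s]
    refine Eq.trans ?_ (hle z hz)
    rw [← Complex.exp_nat_mul]; congr 1; push_cast; ring
  have hsd : DifferentiableOn ℂ s Ω := (hld.div_const 2).cexp
  have hs1 : ∀ z ∈ Ω, ‖s z‖ < 1 := fun z hz => by
    have h1 := bla_norm ha (hf1 z hz)
    rw [← hs2 z hz, norm_pow] at h1
    nlinarith [norm_nonneg (s z)]
  have hsm : MapsTo s Ω (Metric.ball 0 1) := fun z hz => by simpa using hs1 z hz
  have hsinj : InjOn s Ω := fun z hz w hw h => by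
    refine hf.inj hz hw (bla_inj ha (hf1 z hz) (hf1 w hw) ?_)
    rw [← hs2 z hz, ← hs2 w hw, h]
  have hc := hs1 p hp
  set c := s p with hcdef
  have hc2 : c ^ 2 = -a := by
    rw [hcdef, hs2 p hp, hf.zero]; simp [Bla]
  refine ⟨fun z => Bla c (s z), ⟨bla_diff hc hsd hsm, fun z hz => by
    simpa using bla_norm hc (hs1 z hz), fun z hz w hw h =>
      hsinj hz hw (bla_inj hc (hs1 z hz) (hs1 w hw) h), by simp [Bla, hcdef]⟩, ?_⟩
  have hnc : ‖-c‖ < 1 := by simpa using hc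
  have key : f q = Bla c (s q) * Bla (-c) (s q) := by
    have d0 := bla_den ha (hf1 q hq)
    have d1 := bla_den hc (hs1 q hq)
    have d2 := bla_den hnc (hs1 q hq)
    have e := hs2 q hq
    rw [Bla, eq_div_iff d0] at e
    have hca : conj c ^ 2 = - conj a := by rw [← map_pow, hc2, map_neg]
    have ha2 : 1 - conj a * a ≠ 0 := bla_den ha ha
    simp only [Bla]
    rw [div_mul_div_comm, eq_div_iff (mul_ne_zero d1 d2)]
    simp only [map_neg]
    have : f q * ((1 - conj c * s q) * (1 - -conj c * s q)) = f q * (1 - (conj c)^2 * (s q) ^ 2) := by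
      ring
    rw [this, hca]
    have : (s q - c) * (s q - -c) = (s q) ^ 2 - c ^ 2 := by ring
    rw [this, hc2]
    linear_combination (-1 : ℂ) * e
  have hF0 : Bla c (s q) ≠ 0 := by
    refine div_ne_zero (sub_ne_zero.2 fun h => hpq (hsinj hq hp h)) (bla_den hc (hs1 q hq))
  rw [key, norm_mul]
  have := bla_norm hnc (hs1 q hq)
  have := norm_pos_iff.2 hF0
  nlinarith

theorem hurwitz_inj {Ω : Set ℂ} (hΩ : IsOpen Ω) (hcon : IsPreconnected Ω) {U : Filter ℕ} [U.NeBot]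
    {f : ℕ → ℂ → ℂ} {F : ℂ → ℂ} (hfd : ∀ n, DifferentiableOn ℂ (f n) Ω) (hfi : ∀ n, InjOn (f n) Ω)
    (hlim : TendstoLocallyUniformlyOn f F U Ω) {p q : ℂ} (hp : p ∈ Ω) (hq : q ∈ Ω)
    (hpq : F p ≠ F q) : InjOn F Ω := by
  have hFd : DifferentiableOn ℂ F Ω :=
    hlim.differentiableOn (Eventually.of_forall hfd) hΩ
  have hFa := hFd.analyticOnNhd hΩ
  intro a ha b hb hab
  by_contra hne
  have hiso : ∀ᶠ z in 𝓝[≠] b, F z ≠ F a := by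
    by_contra hc
    have hc' : ∃ᶠ z in 𝓝[≠] b, F z = (fun _ => F a) z := by
      rw [Filter.not_eventually] at hc
      exact hc.mono fun z hz => not_not.1 hz
    have h1 := hFa.eqOn_of_preconnected_of_frequently_eq analyticOnNhd_const hcon hb hc'
    exact hpq ((h1 hp).trans (h1 hq).symm)
  rw [eventually_nhdsWithin_iff] at hiso
  have hev : ∀ᶠ z in 𝓝 b, (z ≠ b → F z ≠ F a) ∧ z ∈ Ω ∧ z ≠ a :=
    hiso.and (Filter.Eventually.and (hΩ.mem_nhds hb) (isOpen_ne.mem_nhds (Ne.symm hne)))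
  obtain ⟨r, hr, hrb⟩ := Metric.nhds_basis_closedBall.mem_iff.1 hev
  have hcb : Metric.closedBall b r ⊆ Ω := fun z hz => (hrb hz).2.1
  have hsc : IsCompact (Metric.sphere b r) := isCompact_sphere b r
  have hsne : (Metric.sphere b r).Nonempty := NormedSpace.sphere_nonempty.2 hr.le
  obtain ⟨z0, hz0, hmin⟩ := hsc.exists_isMinOn hsne (f := fun z => ‖F z - F a‖)
    ((hFd.continuousOn.mono (Metric.sphere_subset_closedBall.trans hcb)).sub continuousOn_const).norm
  set m := ‖F z0 - F a‖ with hm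
  have hm0 : 0 < m := by
    rw [hm, norm_pos_iff, sub_ne_zero]
    refine (hrb (Metric.sphere_subset_closedBall hz0)).1 ?_
    rintro rfl
    simp at hz0; linarith
  have hK : TendstoUniformlyOn f F U (Metric.closedBall b r ∪ {a}) :=
    (tendstoLocallyUniformlyOn_iff_forall_isCompact hΩ).1 hlim _
      (union_subset hcb (singleton_subset_iff.2 ha))
      ((isCompact_closedBall b r).union isCompact_singleton)
  rw [Metric.tendstoUniformlyOn_iff] at hK
  obtain ⟨n, hn⟩ := (hK (m / 4) (by positivity)).exists
  have hna := hn a (Or.inr rfl)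
  have hnz : ∀ z ∈ Metric.closedBall b r, ‖(F z - F a) - (f n z - f n a)‖ < m / 2 := by
    intro z hz
    have h1 := hn z (Or.inl hz)
    rw [dist_eq_norm] at h1 hna
    have : (F z - F a) - (f n z - f n a) = (F z - f n z) - (F a - f n a) := by ring
    rw [this]
    have := norm_sub_le (F z - f n z) (F a - f n a)
    linarith
  have hg0 : ∀ z ∈ Metric.closedBall b r, f n z - f n a ≠ 0 := fun z hz h =>
    (hrb hz).2.2 (hfi n (hcb hz) ha (sub_eq_zero.1 h))
  have hmax := Complex.norm_le_of_forall_mem_frontier_norm_le (f := fun z => (f n z - f n a)⁻¹)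
    (U := Metric.ball b r) Metric.isBounded_ball (C := 2 / m) (by
      refine DifferentiableOn.diffContOnCl ?_
      rw [closure_ball b hr.ne']
      exact (((hfd n).mono hcb).sub_const _).inv hg0) (by
      intro z hz
      rw [frontier_ball b hr.ne'] at hz
      have h1 := hnz z (Metric.sphere_subset_closedBall hz)
      have h2 : m ≤ ‖F z - F a‖ := hmin hz
      have h3 := norm_sub_norm_le (F z - F a) (f n z - f n a)
      have h4 : m / 2 ≤ ‖f n z - f n a‖ := by linarith
      rw [norm_inv, inv_le_comm₀ (by linarith) (by positivity), inv_div]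
      exact h4) (subset_closure (Metric.mem_ball_self hr))
  have hbb := hnz b (Metric.mem_closedBall_self hr.le)
  rw [← hab, sub_self, zero_sub, norm_neg] at hbb
  have h0 := norm_pos_iff.2 (hg0 b (Metric.mem_closedBall_self hr.le))
  rw [norm_inv, inv_le_comm₀ h0 (by positivity), inv_div] at hmax
  linarith

theorem exists_extremal {Ω : Set ℂ} (hΩ : IsOpen Ω) (hcon : IsPreconnected Ω)
    (hb : Bornology.IsBounded Ω) {p q : ℂ} (hp : p ∈ Ω) (hq : q ∈ Ω) (hpq : q ≠ p) :
    ∃ F, RFam Ω p F ∧ ∀ f, RFam Ω p f → ‖f q‖ ≤ ‖F q‖ := by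
  let S : Set ℝ := {x | ∃ f, RFam Ω p f ∧ x = ‖f q‖}
  have hbdd : BddAbove S := ⟨1, by
    rintro x ⟨f, hf, rfl⟩
    have := hf.maps hq
    simp at this; exact this.le⟩
  obtain ⟨R, hR⟩ := hb.exists_norm_le
  let R' := 2 * |R| + 1
  have hR' : 0 < R' := by positivity
  have hR0 : ((R' : ℝ) : ℂ) ≠ 0 := by exact_mod_cast hR'.ne'
  have h0 : RFam Ω p (fun z => (z - p) / R') := by
    refine ⟨by fun_prop, fun z hz => ?_, fun z hz w hw h => ?_, by simp⟩
    · rw [mem_ball_zero_iff, norm_div, Complex.norm_real, Real.norm_of_nonneg hR'.le,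
        div_lt_one hR']
      have := norm_sub_le z p
      have := hR z hz
      have := hR p hp
      have := le_abs_self R
      simp only [R']; linarith
    · rw [div_left_inj' hR0] at h
      exact sub_left_injective h
  have hSne : S.Nonempty := ⟨_, _, h0, rfl⟩
  have hMpos : 0 < sSup S := by
    refine lt_of_lt_of_le ?_ (le_csSup hbdd ⟨_, h0, rfl⟩)
    exact norm_pos_iff.2 (div_ne_zero (sub_ne_zero.2 hpq) hR0)
  obtain ⟨x, -, hx, hxS⟩ := exists_seq_tendsto_sSup hSne hbdd
  choose f hf hfx using hxS
  let U : Ultrafilter ℕ := hyperfilter ℕ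
  have hUle : (U : Filter ℕ) ≤ atTop := Nat.hyperfilter_le_atTop
  have hlim : ∀ z, ∃ w : ℂ, z ∈ Ω → Tendsto (fun n => f n z) U (𝓝 w) := by
    intro z
    by_cases hz : z ∈ Ω
    · obtain ⟨w, _, hw⟩ := (isCompact_closedBall (0:ℂ) 1).ultrafilter_le_nhds
        (U.map fun n => f n z) (by
          rw [Filter.le_principal_iff]
          refine Filter.mem_map.2 (Filter.univ_mem' fun n => ?_)
          exact Metric.ball_subset_closedBall ((hf n).maps hz))
      exact ⟨w, fun _ => hw⟩
    · exact ⟨0, fun h => absurd h hz⟩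
  choose F hF using hlim
  have hloc : TendstoLocallyUniformlyOn f F U Ω := by
    rw [Metric.tendstoLocallyUniformlyOn_iff]
    intro ε hε x hx
    obtain ⟨r, hr, hrΩ⟩ := Metric.isOpen_iff.1 hΩ x hx
    have heq : ∀ n, ∀ y ∈ Metric.ball x r, dist (f n y) (f n x) ≤ 2 / r * dist y x := by
      intro n y hy
      refine Complex.dist_le_div_mul_dist_of_mapsTo_ball ((hf n).diff.mono hrΩ) ?_ hy
      intro w hw
      have h1 := (hf n).maps (hrΩ hw)
      have h2 := (hf n).maps hx
      rw [mem_ball_zero_iff] at h1 h2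
      rw [Metric.mem_closedBall, dist_eq_norm]
      have := norm_sub_le (f n w) (f n x)
      linarith
    let δ := min r (ε * r / 8)
    have hδ : 0 < δ := lt_min hr (by positivity)
    have hsm : ∀ n, ∀ y ∈ Metric.ball x δ, dist (f n y) (f n x) ≤ ε / 4 := by
      intro n y hy
      rw [Metric.mem_ball] at hy
      have h1 := heq n y (by rw [Metric.mem_ball]; exact hy.trans_le (min_le_left _ _))
      have h2 : dist y x ≤ ε * r / 8 := hy.le.trans (min_le_right _ _)
      calc _ ≤ 2 / r * dist y x := h1
        _ ≤ 2 / r * (ε * r / 8) := by gcongr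
        _ = ε / 4 := by field_simp; norm_num
    refine ⟨Metric.ball x δ ∩ Ω, Filter.inter_mem (mem_nhdsWithin_of_mem_nhds
      (Metric.ball_mem_nhds x hδ)) self_mem_nhdsWithin, ?_⟩
    have hev : ∀ᶠ n in (U : Filter ℕ), dist (f n x) (F x) < ε / 4 :=
      (hF x hx).eventually (Metric.ball_mem_nhds _ (by positivity))
    filter_upwards [hev] with n hn y hy
    have hFy : dist (F y) (F x) ≤ ε / 4 :=
      le_of_tendsto ((hF y hy.2).dist (hF x hx)) (Eventually.of_forall fun k => hsm k y hy.1)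
    have h3 := hsm n y hy.1
    calc dist (F y) (f n y) ≤ dist (F y) (F x) + dist (F x) (f n x) + dist (f n x) (f n y) :=
          dist_triangle4 _ _ _ _
      _ < ε := by rw [dist_comm (F x), dist_comm (f n x) (f n y)]; linarith
  have hFp : F p = 0 := by
    refine tendsto_nhds_unique (hF p hp) ?_
    simp only [fun n => (hf n).zero]; exact tendsto_const_nhds
  have hFq : ‖F q‖ = sSup S := by
    refine tendsto_nhds_unique (hF q hq).norm ?_
    have := hx.mono_left hUle
    exact this.congr hfx
  have hFd : DifferentiableOn ℂ F Ω :=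
    hloc.differentiableOn (Eventually.of_forall fun n => (hf n).diff) hΩ
  have hne : F p ≠ F q := by
    rw [hFp]; intro h; rw [← h] at hFq; simp at hFq; linarith
  have hFinj : InjOn F Ω := hurwitz_inj hΩ hcon (fun n => (hf n).diff) (fun n => (hf n).inj) hloc
    hp hq hne
  have hle : ∀ z ∈ Ω, ‖F z‖ ≤ 1 := fun z hz =>
    le_of_tendsto (hF z hz).norm (Eventually.of_forall fun n => by
      have := (hf n).maps hz
      rw [mem_ball_zero_iff] at this; exact this.le)
  refine ⟨F, ⟨hFd, fun z hz => ?_, hFinj, hFp⟩, fun g hg => ?_⟩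
  · rw [mem_ball_zero_iff]
    refine lt_of_le_of_ne (hle z hz) fun h1 => ?_
    have := Complex.eqOn_of_isPreconnected_of_isMaxOn_norm hcon hΩ hFd hz (by
      intro w hw
      simp only [Function.comp, mem_ofPred_eq]
      rw [h1]; exact hle w hw)
    exact hne ((this hp).trans (this hq).symm)
  · rw [hFq]; exact le_csSup hbdd ⟨g, hg, rfl⟩

theorem inverse_holo {Ω : Set ℂ} (hΩ : IsOpen Ω) (hcon : IsPreconnected Ω) {φ ψ : ℂ → ℂ} {p q : ℂ}
    (hp : p ∈ Ω) (hq : q ∈ Ω) (hpq : q ≠ p)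
    (hφ : DifferentiableOn ℂ φ Ω) (hinj : InjOn φ Ω) {B : Set ℂ} (hBo : IsOpen B)
    (hψm : MapsTo ψ B Ω) (hφψ : ∀ w ∈ B, φ (ψ w) = w) (hφm : MapsTo φ Ω B)  :
    DifferentiableOn ℂ ψ B := by
  have hψφ : ∀ z ∈ Ω, ψ (φ z) = z := fun z hz => hinj (hψm (hφm hz)) hz (hφψ _ (hφm hz))
  have hopen : ∀ s ⊆ Ω, IsOpen s → IsOpen (φ '' s) := by
    rcases (hφ.analyticOnNhd hΩ).is_constant_or_isOpen hcon with ⟨w, hw⟩ | h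
    · exact absurd (hinj hq hp ((hw q hq).trans (hw p hp).symm)) hpq
    · exact h
  have hcont : ContinuousOn ψ B := by
    rw [continuousOn_open_iff hBo]
    intro t ht
    have : B ∩ ψ ⁻¹' t = φ '' (Ω ∩ t) := by
      ext w
      constructor
      · rintro ⟨h1, h2⟩
        exact ⟨ψ w, ⟨hψm h1, h2⟩, hφψ w h1⟩
      · rintro ⟨z, ⟨h1, h2⟩, rfl⟩
        exact ⟨hφm h1, by rw [mem_preimage, hψφ z h1]; exact h2⟩
    rw [this]
    exact hopen _ inter_subset_left (hΩ.inter ht)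
  have hd1 : ∀ w ∈ B, deriv φ (ψ w) ≠ 0 → DifferentiableAt ℂ ψ w := by
    intro w hw h
    have h1 : HasDerivAt φ (deriv φ (ψ w)) (ψ w) :=
      (hφ.differentiableAt (hΩ.mem_nhds (hψm hw))).hasDerivAt
    exact (h1.of_local_left_inverse (hcont.continuousAt (hBo.mem_nhds hw)) h
      (by filter_upwards [hBo.mem_nhds hw] with y hy using hφψ y hy)).differentiableAt
  intro w0 hw0
  refine DifferentiableAt.differentiableWithinAt ?_
  have hz0 := hψm hw0
  set z0 := ψ w0 with hz0d
  have hdan : AnalyticAt ℂ (deriv φ) z0 := (hφ.analyticOnNhd hΩ z0 hz0).deriv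
  have hev : ∀ᶠ z in 𝓝[≠] z0, deriv φ z ≠ 0 := by
    rcases hdan.eventually_eq_zero_or_eventually_ne_zero with h | h
    · exfalso
      obtain ⟨r, hr, hrb⟩ := Metric.mem_nhds_iff.1 (h.and (hΩ.mem_nhds hz0))
      have hconst : ∀ z ∈ Metric.ball z0 r, φ z = φ z0 := by
        intro z hz
        refine (convex_ball z0 r).is_const_of_fderivWithin_eq_zero (𝕜 := ℂ) (f := φ)
          (hφ.mono fun x hx => (hrb hx).2) (fun x hx => ?_) hz (Metric.mem_ball_self hr)
        rw [fderivWithin_of_isOpen Metric.isOpen_ball hx]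
        ext
        simpa using (hrb hx).1
      have hmem : z0 + (r / 2 : ℝ) ∈ Metric.ball z0 r := by
        rw [Metric.mem_ball, dist_eq_norm, add_sub_cancel_left, Complex.norm_real,
          Real.norm_of_nonneg (by positivity)]
        linarith
      have := hinj (hrb hmem).2 hz0 (hconst _ hmem)
      have h3 : ((r / 2 : ℝ) : ℂ) = 0 := by linear_combination this
      have h4 : r / 2 = 0 := by exact_mod_cast h3
      linarith
    · exact h
  rw [eventually_nhdsWithin_iff] at hev
  have hc0 : ContinuousAt ψ w0 := hcont.continuousAt (hBo.mem_nhds hw0)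
  have hev2 : ∀ᶠ w in 𝓝 w0, (ψ w ≠ z0 → deriv φ (ψ w) ≠ 0) ∧ w ∈ B :=
    (hc0.eventually hev).and (hBo.mem_nhds hw0)
  have hs : {w | (ψ w ≠ z0 → deriv φ (ψ w) ≠ 0) ∧ w ∈ B} ∈ 𝓝 w0 := hev2
  refine DifferentiableOn.differentiableAt
    ((Complex.differentiableOn_compl_singleton_and_continuousAt_iff hs).1 ⟨?_, hc0⟩) hs
  rintro w ⟨⟨h1, h2⟩, h3⟩
  refine (hd1 w h2 (h1 fun h => h3 ?_)).differentiableWithinAt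
  have := congrArg φ h
  rw [hφψ w h2, hz0d, hφψ w0 hw0] at this
  exact this

theorem riemann_map {Ω : Set ℂ} (hΩ : IsOpen Ω) (hcon : IsPreconnected Ω)
    (hb : Bornology.IsBounded Ω) (hL : LogDomain Ω) {p : ℂ} (hp : p ∈ Ω) :
    ∃ φ ψ : ℂ → ℂ, DifferentiableOn ℂ φ Ω ∧ DifferentiableOn ℂ ψ (Metric.ball 0 1) ∧
      MapsTo φ Ω (Metric.ball 0 1) ∧ MapsTo ψ (Metric.ball 0 1) Ω ∧ (∀ z ∈ Ω, ψ (φ z) = z) ∧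
      (∀ w ∈ Metric.ball (0:ℂ) 1, φ (ψ w) = w) ∧ φ p = 0 ∧ ψ 0 = p := by
  obtain ⟨q, hq, hpq⟩ : ∃ q ∈ Ω, q ≠ p := by
    obtain ⟨r, hr, hrΩ⟩ := Metric.isOpen_iff.1 hΩ p hp
    refine ⟨p + (r / 2 : ℝ), hrΩ ?_, ?_⟩
    · rw [Metric.mem_ball, dist_eq_norm, add_sub_cancel_left, Complex.norm_real,
        Real.norm_of_nonneg (by positivity)]
      linarith
    · intro h
      have h3 : ((r / 2 : ℝ) : ℂ) = 0 := by linear_combination h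
      have h4 : r / 2 = 0 := by exact_mod_cast h3
      linarith
  obtain ⟨φ, hφ, hmax⟩ := exists_extremal hΩ hcon hb hp hq hpq
  have hsurj : ∀ w ∈ Metric.ball (0:ℂ) 1, ∃ z ∈ Ω, φ z = w := by
    intro w hw
    by_contra hc
    push Not at hc
    obtain ⟨F, hF, hlt⟩ := koebe hΩ hL hp hq hpq hφ (by simpa using hw) hc
    exact absurd (hmax F hF) (not_le.2 hlt)
  choose! ψ hψm hψ using hsurj
  have hψφ : ∀ z ∈ Ω, ψ (φ z) = z := fun z hz =>
    hφ.inj (hψm _ (hφ.maps hz)) hz (hψ _ (hφ.maps hz))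
  refine ⟨φ, ψ, hφ.diff, inverse_holo hΩ hcon hp hq hpq hφ.diff hφ.inj Metric.isOpen_ball hψm hψ
    hφ.maps, hφ.maps, hψm, hψφ, hψ, hφ.zero, ?_⟩
  rw [← hφ.zero, hψφ p hp]

end RMT


section Wolff
open Topology

theorem det_smul_one (x : ℂ) : (x • (1 : ℂ →L[ℝ] ℂ)).det = ‖x‖ ^ 2 := by
  rw [← Complex.restrictScalars_toSpanSingleton]
  rw [← Complex.normSq_eq_norm_sq, ← Algebra.norm_complex_apply]
  have := LinearMap.det_restrictScalars (R := ℝ) (S := ℂ) (A := ℂ)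
    (f := (ContinuousLinearMap.toSpanSingleton ℂ x : ℂ →ₗ[ℂ] ℂ))
  have h2 : LinearMap.det (ContinuousLinearMap.toSpanSingleton ℂ x : ℂ →ₗ[ℂ] ℂ) = x := by
    exact ContinuousLinearMap.det_toSpanSingleton x
  rw [h2] at this
  exact this

theorem area_holo {H : Set ℂ} (hH : IsOpen H) {ψ : ℂ → ℂ} (hψ : DifferentiableOn ℂ ψ H)
    (hinj : InjOn ψ H) : ∫⁻ z in H, ‖deriv ψ z‖ₑ ^ 2 = volume (ψ '' H) := by
  rw [← lintegral_abs_det_fderiv_eq_addHaar_image volume hH.measurableSet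
    (f' := fun z => deriv ψ z • (1 : ℂ →L[ℝ] ℂ)) ?_ hinj]
  · refine setLIntegral_congr_fun hH.measurableSet fun z hz => ?_
    rw [det_smul_one, abs_of_nonneg (by positivity), ENNReal.ofReal_pow (norm_nonneg _),
      ofReal_norm]
  · intro z hz
    have h1 := (hψ.differentiableAt (hH.mem_nhds hz)).hasDerivAt
    have h2 := h1.hasFDerivAt.restrictScalars ℝ
    rw [Complex.restrictScalars_toSpanSingleton] at h2
    exact h2.hasFDerivWithinAt

/-- polar coordinates -/
def pol (ρ θ : ℝ) : ℂ := ρ * (Real.cos θ + Real.sin θ * Complex.I)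

theorem pol_norm {ρ : ℝ} (hρ : 0 ≤ ρ) (θ : ℝ) : ‖pol ρ θ‖ = ρ := by
  have := Complex.norm_polarCoord_symm (ρ, θ)
  rw [Complex.polarCoord_symm_apply] at this
  rw [pol, this, abs_of_nonneg hρ]

theorem pol_arg (ζ : ℂ) : pol ‖ζ‖ (Complex.arg ζ) = ζ := by
  rw [pol]
  push_cast
  exact Complex.norm_mul_cos_add_sin_mul_I ζ

theorem pol_cont : Continuous (fun p : ℝ × ℝ => pol p.1 p.2) := by
  unfold pol; fun_prop

theorem pol_hasDerivAt (ρ θ : ℝ) :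
    HasDerivAt (fun t => pol ρ t) (pol ρ θ * Complex.I) θ := by
  have h1 := (Real.hasDerivAt_cos θ).ofReal_comp
  have h2 := ((Real.hasDerivAt_sin θ).ofReal_comp).mul_const Complex.I
  have h3 := (h1.add h2).const_mul (ρ : ℂ)
  unfold pol
  refine h3.congr_deriv ?_
  push_cast
  linear_combination (-(ρ : ℂ) * Complex.sin θ) * Complex.I_mul_I

theorem arc_bound {H : Set ℂ} (hH : IsOpen H) {ψ : ℂ → ℂ} (hψ : DifferentiableOn ℂ ψ H)
    {ρ η : ℝ} (hρ : 0 < ρ) (hη : 0 < η)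
    (ha : ENNReal.ofReal (ρ ^ 2) * ∫⁻ θ in Ioo (-Real.pi) Real.pi,
      H.indicator (fun z => ‖deriv ψ z‖ₑ ^ 2) (pol ρ θ) ≤ ENNReal.ofReal (η ^ 2))
    {a b : ℝ} (hab : a ≤ b) (hsub : Icc a b ⊆ Ioo (-Real.pi) Real.pi)
    (harc : ∀ θ ∈ Icc a b, pol ρ θ ∈ H) : ‖ψ (pol ρ b) - ψ (pol ρ a)‖ ≤ 8 * η := by
  have hd : ∀ θ ∈ Icc a b, HasDerivAt (fun t => ψ (pol ρ t))
      (pol ρ θ * Complex.I * deriv ψ (pol ρ θ)) θ := by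
    intro θ hθ
    have h1 := (hψ.differentiableAt (hH.mem_nhds (harc θ hθ))).hasDerivAt
    have := HasDerivAt.scomp (𝕜' := ℂ) θ h1 (pol_hasDerivAt ρ θ)
    simpa [Function.comp_def] using this
  have hcd : ContDiffOn ℝ 1 (fun t => ψ (pol ρ t)) (Icc a b) := by
    have h1 : ContDiffOn ℝ 1 ψ H :=
      (hψ.contDiffOn hH (n := 1)).restrict_scalars ℝ
    refine h1.comp (ContDiff.contDiffOn ?_) harc
    unfold pol
    exact contDiff_const.mul ((Complex.ofRealCLM.contDiff.comp Real.contDiff_cos).add ((Complex.ofRealCLM.contDiff.comp Real.contDiff_sin).mul contDiff_const))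
  have key := enorm_sub_le_lintegral_deriv_of_contDiffOn_Icc hcd hab
  have hbd : ∀ θ ∈ Icc a b, ‖deriv (fun t => ψ (pol ρ t)) θ‖ₑ ≤
      ENNReal.ofReal (1 / η) * (ENNReal.ofReal (ρ ^ 2) *
        H.indicator (fun z => ‖deriv ψ z‖ₑ ^ 2) (pol ρ θ)) + ENNReal.ofReal η := by
    intro θ hθ
    rw [(hd θ hθ).deriv, indicator_of_mem (harc θ hθ)]
    rw [← ofReal_norm, ← ofReal_norm, ← ENNReal.ofReal_pow (norm_nonneg _),
      ← ENNReal.ofReal_mul (by positivity), ← ENNReal.ofReal_mul (by positivity),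
      ← ENNReal.ofReal_add (by positivity) (by positivity)]
    refine ENNReal.ofReal_le_ofReal ?_
    rw [norm_mul, norm_mul, pol_norm hρ.le, Complex.norm_I, mul_one]
    set x := ‖deriv ψ (pol ρ θ)‖
    have : 1 / η * (ρ ^ 2 * x ^ 2) + η - ρ * x = ((ρ * x - η) ^ 2 + ρ * x * η) / η := by
      field_simp; ring
    have h2 : 0 ≤ ((ρ * x - η) ^ 2 + ρ * x * η) / η := by positivity
    linarith
  have hm : Measurable (fun θ => H.indicator (fun z => ‖deriv ψ z‖ₑ ^ 2) (pol ρ θ)) := by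
    have h1 : Measurable (H.indicator fun z => ‖deriv ψ z‖ₑ ^ 2) :=
      ((measurable_deriv ψ).enorm.pow_const 2).indicator hH.measurableSet
    have h2 : Measurable (fun θ => pol ρ θ) := by unfold pol; fun_prop
    exact h1.comp h2
  have hfin : ‖ψ (pol ρ b) - ψ (pol ρ a)‖ₑ ≤ ENNReal.ofReal (8 * η) := by
    calc _ ≤ ∫⁻ θ in Icc a b, ‖deriv (fun t => ψ (pol ρ t)) θ‖ₑ := key
      _ ≤ ∫⁻ θ in Icc a b, (ENNReal.ofReal (1 / η) * (ENNReal.ofReal (ρ ^ 2) *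
        H.indicator (fun z => ‖deriv ψ z‖ₑ ^ 2) (pol ρ θ)) + ENNReal.ofReal η) :=
          setLIntegral_mono' measurableSet_Icc hbd
      _ ≤ ∫⁻ θ in Ioo (-Real.pi) Real.pi, (ENNReal.ofReal (1 / η) * (ENNReal.ofReal (ρ ^ 2) *
        H.indicator (fun z => ‖deriv ψ z‖ₑ ^ 2) (pol ρ θ)) + ENNReal.ofReal η) :=
          lintegral_mono_set hsub
      _ = ENNReal.ofReal (1 / η) * (ENNReal.ofReal (ρ ^ 2) *
          ∫⁻ θ in Ioo (-Real.pi) Real.pi, H.indicator (fun z => ‖deriv ψ z‖ₑ ^ 2) (pol ρ θ)) +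
          ENNReal.ofReal η * ENNReal.ofReal (2 * Real.pi) := by
          rw [lintegral_add_right _ measurable_const, lintegral_const_mul _ (hm.const_mul _),
            lintegral_const_mul _ hm, setLIntegral_const, Real.volume_Ioo]
          congr 3; ring
      _ ≤ ENNReal.ofReal (1 / η) * ENNReal.ofReal (η ^ 2) +
          ENNReal.ofReal η * ENNReal.ofReal (2 * Real.pi) := by gcongr
      _ ≤ ENNReal.ofReal (8 * η) := by
          rw [← ENNReal.ofReal_mul (by positivity), ← ENNReal.ofReal_mul (by positivity),
            ← ENNReal.ofReal_add (by positivity) (by positivity)]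
          refine ENNReal.ofReal_le_ofReal ?_
          have : 1 / η * η ^ 2 = η := by field_simp
          rw [this]
          nlinarith [Real.pi_lt_d2]
  rw [← ofReal_norm] at hfin
  exact (ENNReal.ofReal_le_ofReal_iff (by positivity)).1 hfin

theorem wolff {H : Set ℂ} (hH : IsOpen H) (hslit : H ⊆ Complex.slitPlane) {ψ : ℂ → ℂ}
    (hψ : DifferentiableOn ℂ ψ H) (hinj : InjOn ψ H) {R : ℝ} (hR : 0 < R)
    (hfin : volume (ψ '' (H ∩ Metric.ball 0 R)) ≠ ⊤)
    (harc : ∀ ρ > 0, OrdConnected {θ | θ ∈ Ioo (-Real.pi) Real.pi ∧ pol ρ θ ∈ H})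
    {ε ρ0 : ℝ} (hε : 0 < ε) (hρ0 : 0 < ρ0) :
    ∃ ρ ∈ Ioo 0 ρ0, ∀ ζ ∈ H, ∀ ω ∈ H, ‖ζ‖ = ρ → ‖ω‖ = ρ → ‖ψ ζ - ψ ω‖ ≤ ε := by
  set H' := H ∩ Metric.ball 0 R with hH'
  have hH'o : IsOpen H' := hH.inter Metric.isOpen_ball
  set k := H'.indicator (fun z => ‖deriv ψ z‖ₑ ^ 2) with hk
  have hkm : Measurable k :=
    ((measurable_deriv ψ).enorm.pow_const 2).indicator hH'o.measurableSet
  have hkfin : ∫⁻ z, k z ≠ ⊤ := by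
    rw [hk, lintegral_indicator hH'o.measurableSet,
      area_holo hH'o (hψ.mono inter_subset_left) (hinj.mono inter_subset_left)]
    exact hfin
  have hpm : Measurable fun p : ℝ × ℝ => ENNReal.ofReal p.1 • k (Complex.polarCoord.symm p) := by
    simp only [smul_eq_mul, Complex.polarCoord_symm_apply]
    have h2 : Measurable (fun p : ℝ × ℝ => (p.1 : ℂ) * (Real.cos p.2 + Real.sin p.2 * Complex.I)) := by
      fun_prop
    exact (measurable_fst.ennreal_ofReal).mul (hkm.comp h2)
  rw [← Complex.lintegral_comp_polarCoord_symm, polarCoord_target, Measure.volume_eq_prod,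
    ← Measure.prod_restrict, lintegral_prod _ hpm.aemeasurable] at hkfin
  simp only [Complex.polarCoord_symm_apply, smul_eq_mul] at hkfin
  change ∫⁻ ρ in Ioi 0, ∫⁻ θ in Ioo (-Real.pi) Real.pi, ENNReal.ofReal ρ * k (pol ρ θ) ≠ ⊤ at hkfin
  have hm : ∀ ρ, Measurable (fun θ => k (pol ρ θ)) := fun ρ => by
    have h2 : Measurable (fun θ => pol ρ θ) := by unfold pol; fun_prop
    exact hkm.comp h2
  simp only [lintegral_const_mul _ (hm _)] at hkfin
  set η := ε / 8 with hη
  have hη0 : 0 < η := by positivity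
  set ρ1 := min ρ0 R with hρ1
  have hρ10 : 0 < ρ1 := lt_min hρ0 hR
  by_cases hex : ∃ ρ ∈ Ioo 0 ρ1, ENNReal.ofReal (ρ ^ 2) * ∫⁻ θ in Ioo (-Real.pi) Real.pi,
      k (pol ρ θ) ≤ ENNReal.ofReal (η ^ 2)
  · obtain ⟨ρ, ⟨h1, h2⟩, h3⟩ := hex
    have hρR : ρ < R := h2.trans_le (min_le_right _ _)
    refine ⟨ρ, ⟨h1, h2.trans_le (min_le_left _ _)⟩, ?_⟩
    have main : ∀ ζ ∈ H, ∀ ω ∈ H, ‖ζ‖ = ρ → ‖ω‖ = ρ → ζ.arg ≤ ω.arg → ‖ψ ω - ψ ζ‖ ≤ ε := by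
      intro ζ hζ ω hω e1 e2 hle
      have hI : ∀ ζ ∈ H, ζ.arg ∈ Ioo (-Real.pi) Real.pi := fun ζ hζ =>
        ⟨Complex.neg_pi_lt_arg ζ, lt_of_le_of_ne (Complex.arg_le_pi ζ)
          (Complex.mem_slitPlane_iff_arg.1 (hslit hζ)).1⟩
      have p1 : pol ρ ζ.arg = ζ := by rw [← e1]; exact pol_arg ζ
      have p2 : pol ρ ω.arg = ω := by rw [← e2]; exact pol_arg ω
      have hoc := (harc ρ h1).out (x := ζ.arg) ⟨hI ζ hζ, by rw [p1]; exact hζ⟩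
        (y := ω.arg) ⟨hI ω hω, by rw [p2]; exact hω⟩
      have := arc_bound hH'o (hψ.mono inter_subset_left) h1 hη0 h3 hle
        (fun θ hθ => (hoc hθ).1) (fun θ hθ => ⟨(hoc hθ).2, by
          rw [mem_ball_zero_iff, pol_norm h1.le]; exact hρR⟩)
      rw [p1, p2] at this
      rw [hη] at this
      linarith
    intro ζ hζ ω hω e1 e2
    rcases le_total ζ.arg ω.arg with h | h
    · rw [norm_sub_rev]; exact main ζ hζ ω hω e1 e2 h
    · exact main ω hω ζ hζ e2 e1 h
  · exfalso
    push Not at hex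
    have hle : ∫⁻ ρ in Ioo 0 ρ1, ENNReal.ofReal (η ^ 2 * ρ⁻¹) ≤
        ∫⁻ ρ in Ioi 0, ENNReal.ofReal ρ * ∫⁻ θ in Ioo (-Real.pi) Real.pi, k (pol ρ θ) := by
      refine le_trans ?_ (lintegral_mono_set (Ioo_subset_Ioi_self : Ioo 0 ρ1 ⊆ Ioi 0))
      refine setLIntegral_mono' measurableSet_Ioo fun ρ hρ => ?_
      have h1 := (hex ρ hρ).le
      have h2 : ENNReal.ofReal (ρ ^ 2) = ENNReal.ofReal ρ * ENNReal.ofReal ρ := by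
        rw [← ENNReal.ofReal_mul hρ.1.le]; congr 1; ring
      rw [ENNReal.ofReal_mul (by positivity), ENNReal.ofReal_inv_of_pos hρ.1]
      rw [← div_eq_mul_inv]
      refine ENNReal.div_le_of_le_mul ?_
      rw [h2] at h1
      calc _ ≤ _ := h1
        _ = _ := by ring
    have hfin2 : ∫⁻ ρ in Ioo 0 ρ1, ENNReal.ofReal (η ^ 2 * ρ⁻¹) ≠ ⊤ :=
      ne_top_of_le_ne_top hkfin hle
    have hintg : IntegrableOn (fun ρ => η ^ 2 * ρ⁻¹) (Ioo 0 ρ1) := by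
      refine (lintegral_ofReal_ne_top_iff_integrable ?_ ?_).1 hfin2
      · fun_prop
      · filter_upwards [ae_restrict_mem measurableSet_Ioo] with ρ hρ
        have := hρ.1
        simp only [Pi.zero_apply]
        positivity
    have hint2 : IntegrableOn (fun ρ : ℝ => ρ⁻¹) (Ioo 0 ρ1) := by
      have := hintg.const_mul (η ^ 2)⁻¹
      refine this.congr (Eventually.of_forall fun ρ => ?_)
      simp only
      rw [← mul_assoc, inv_mul_cancel₀ (by positivity), one_mul]
    have hint3 : IntervalIntegrable (fun ρ : ℝ => ρ⁻¹) volume 0 ρ1 :=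
      (intervalIntegrable_iff_integrableOn_Ioo_of_le hρ10.le).2 hint2
    rw [intervalIntegrable_inv_iff] at hint3
    rcases hint3 with h | h
    · exact hρ10.ne h
    · exact h left_mem_uIcc

end Wolff


section NoEscape
open Topology

theorem no_escape {H : Set ℂ} (hH : IsOpen H) (hconv : Convex ℝ H) (h1H : (1 : ℂ) ∈ H)
    (hpos : ∀ z ∈ H, 0 < z.re)
    (hstar : ∀ z ∈ H, ∀ t : ℝ, 0 < t → t ≤ 1 → (t : ℂ) * z ∈ H)
    (harc : ∀ ρ > 0, OrdConnected {θ | θ ∈ Ioo (-Real.pi) Real.pi ∧ pol ρ θ ∈ H})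
    {ψ : ℂ → ℂ} (hψ : DifferentiableOn ℂ ψ H) (hinj : InjOn ψ H)
    (hopen : ∀ S ⊆ H, IsOpen S → IsOpen (ψ '' S))
    {R : ℝ} (hR : 0 < R) (hR1 : R ≤ 1)
    (hfin : volume (ψ '' (H ∩ Metric.ball 0 R)) ≠ ⊤)
    {G G' : ℂ → ℂ} (hG : ContinuousOn G H) (hG' : ContinuousOn G' H)
    (mG : MapsTo G H H) (mG' : MapsTo G' H H) (hGG' : ∀ z ∈ H, G (G' z) = z)
    (hG'G : ∀ z ∈ H, G' (G z) = z)
    (harea : ∀ ρ ∈ Ioo 0 R, volume (ψ '' (G '' (H ∩ Metric.ball 0 ρ))) =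
      volume (ψ '' (H ∩ Metric.ball 0 ρ)))
    {δ : ℝ} (hδ : 0 < δ) (hdisp : ∀ z ∈ H ∩ Metric.ball 0 R, 2 * δ ≤ ‖ψ (G z) - ψ z‖) :
    ∃ ρ > 0, ∀ z ∈ H ∩ Metric.ball 0 ρ, G z ∉ Metric.ball 0 ρ := by
  have h0H : ∀ z ∈ H, 0 < ‖z‖ := fun z hz => by
    rw [norm_pos_iff]; rintro rfl; simpa using hpos 0 hz
  set m := volume.withDensity (fun z => ‖deriv ψ z‖ₑ ^ 2) with hm
  have mval : ∀ S ⊆ H, IsOpen S → m S = volume (ψ '' S) := fun S hS ho => by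
    rw [hm, withDensity_apply _ ho.measurableSet, area_holo ho (hψ.mono hS) (hinj.mono hS)]
  have mpos : ∀ S ⊆ H, IsOpen S → S.Nonempty → 0 < m S := fun S hS ho hne => by
    rw [mval S hS ho]
    exact (hopen S hS ho).measure_pos volume (hne.image ψ)
  have hNo : ∀ ρ, IsOpen (H ∩ Metric.ball 0 ρ) := fun ρ => hH.inter Metric.isOpen_ball
  have mfin : m (H ∩ Metric.ball 0 R) ≠ ⊤ := by rw [mval _ inter_subset_left (hNo R)]; exact hfin
  have hsmall : ∃ ρ0 ∈ Ioo 0 R, m (H ∩ Metric.ball 0 ρ0) < m (H \ Metric.closedBall 0 (R / 2)) := by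
    have hout : 0 < m (H \ Metric.closedBall 0 (R / 2)) := by
      refine mpos _ sdiff_subset (hH.sdiff Metric.isClosed_closedBall) ⟨1, h1H, ?_⟩
      simp; linarith
    have hanti : Antitone fun n : ℕ => H ∩ Metric.ball (0 : ℂ) (R / (n + 2)) := by
      intro a b hab
      refine inter_subset_inter_right _ (Metric.ball_subset_ball ?_)
      gcongr
    have ht := tendsto_measure_iInter_atTop (μ := m) (s := fun n : ℕ => H ∩ Metric.ball (0 : ℂ) (R / (n + 2)))
      (fun n => (hNo _).measurableSet.nullMeasurableSet) hanti
      ⟨0, ne_top_of_le_ne_top mfin (measure_mono (inter_subset_inter_right _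
        (Metric.ball_subset_ball (by simp only [CharP.cast_eq_zero, zero_add]; linarith))))⟩
    have hem : ⋂ n : ℕ, H ∩ Metric.ball (0 : ℂ) (R / (n + 2)) = ∅ := by
      rw [eq_empty_iff_forall_notMem]
      intro z hz
      rw [mem_iInter] at hz
      have hz0 := h0H z (hz 0).1
      obtain ⟨n, hn⟩ := exists_nat_gt (R / ‖z‖)
      have := (hz n).2
      rw [mem_ball_zero_iff, lt_div_iff₀ (by positivity)] at this
      rw [div_lt_iff₀ hz0] at hn
      nlinarith
    rw [hem, measure_empty] at ht
    obtain ⟨n, hn⟩ := (ht.eventually (gt_mem_nhds hout)).exists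
    refine ⟨_, ⟨by positivity, ?_⟩, hn⟩
    rw [div_lt_iff₀ (by positivity)]
    have : (0 : ℝ) ≤ n := by positivity
    nlinarith
  obtain ⟨ρ0, hρ0, hρ0m⟩ := hsmall
  obtain ⟨ρ, hρ, hw⟩ := wolff hH (fun z hz => Or.inl (hpos z hz)) hψ hinj hR hfin harc hδ
    (lt_min hρ0.1 (half_pos hR))
  have hρ00 : 0 < ρ := hρ.1
  have hρ1 : ρ < ρ0 := hρ.2.trans_le (min_le_left _ _)
  have hρ2 : ρ < R / 2 := hρ.2.trans_le (min_le_right _ _)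
  refine ⟨ρ, hρ00, ?_⟩
  set N := H ∩ Metric.ball 0 ρ with hN
  set N' := H \ Metric.closedBall 0 ρ with hN'
  set C := H ∩ Metric.sphere 0 ρ with hC
  set M := H \ Metric.ball 0 ρ with hM
  have N'o : IsOpen N' := hH.sdiff Metric.isClosed_closedBall
  have No : IsOpen N := hNo ρ
  have tri : ∀ z ∈ H, z ∈ N ∨ z ∈ C ∨ z ∈ N' := by
    intro z hz
    rcases lt_trichotomy ‖z‖ ρ with h | h | h
    · exact Or.inl ⟨hz, by simpa using h⟩
    · exact Or.inr (Or.inl ⟨hz, by simpa using h⟩)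
    · exact Or.inr (Or.inr ⟨hz, by simpa using h⟩)
  have GC : ∀ c ∈ C, G c ∉ C := by
    intro c hc hGc
    have h1 := hdisp c ⟨hc.1, by have := hc.2; simp only [mem_sphere_zero_iff_norm] at this; simp [this]; linarith⟩
    have h2 := hw (G c) hGc.1 c hc.1 (by simpa using hGc.2) (by simpa using hc.2)
    linarith
  have Cconn : IsPreconnected C := by
    have hP : IsPreconnected {θ | θ ∈ Ioo (-Real.pi) Real.pi ∧ pol ρ θ ∈ H} :=
      (harc ρ hρ00).isPreconnected
    have hc : Continuous (fun θ => pol ρ θ) := by unfold pol; fun_prop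
    have := hP.image _ hc.continuousOn
    convert this using 1
    ext z
    constructor
    · rintro ⟨hz, hz2⟩
      have e : ‖z‖ = ρ := by simpa using hz2
      have p1 : pol ρ z.arg = z := by rw [← e]; exact pol_arg z
      refine ⟨z.arg, ⟨⟨Complex.neg_pi_lt_arg z, lt_of_le_of_ne (Complex.arg_le_pi z)
          (Complex.mem_slitPlane_iff_arg.1 (Or.inl (hpos z hz))).1⟩, ?_⟩, p1⟩
      rw [p1]; exact hz
    · rintro ⟨θ, ⟨_, h2⟩, rfl⟩
      exact ⟨h2, by simpa using pol_norm hρ00.le θ⟩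
  have hrad : ∀ z ∈ M, ((ρ / ‖z‖ : ℝ) : ℂ) * z ∈ C := by
    intro z hz
    have hz0 := h0H z hz.1
    have hzr : ρ ≤ ‖z‖ := by simpa using hz.2
    refine ⟨hstar z hz.1 _ (by positivity) ((div_le_one hz0).2 hzr), ?_⟩
    rw [mem_sphere_zero_iff_norm, norm_mul, Complex.norm_real, Real.norm_of_nonneg (by positivity)]
    field_simp
  have CM : C ⊆ M := fun z hz => ⟨hz.1, by have := hz.2; simp only [mem_sphere_zero_iff_norm] at this; simp [this]⟩
  have h1M : (1 : ℂ) ∈ M := ⟨h1H, by simp; linarith⟩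
  obtain ⟨c0, hc0⟩ : C.Nonempty := ⟨_, hrad 1 h1M⟩
  have Mconn : IsPreconnected M := by
    refine isPreconnected_of_forall c0 fun z hz => ?_
    refine ⟨C ∪ (fun t : ℝ => (t : ℂ) * z) '' Icc (ρ / ‖z‖) 1, ?_, Or.inl hc0, Or.inr ⟨1, ?_, by simp⟩, ?_⟩
    · refine union_subset CM ?_
      rintro _ ⟨t, ht, rfl⟩
      have hz0 := h0H z hz.1
      have ht0 : 0 < t := lt_of_lt_of_le (by positivity) ht.1
      refine ⟨hstar z hz.1 t ht0 ht.2, ?_⟩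
      have := ht.1
      rw [div_le_iff₀ hz0] at this
      rw [mem_ball_zero_iff, norm_mul, Complex.norm_real, Real.norm_of_nonneg ht0.le]
      linarith
    · have hz0 := h0H z hz.1
      exact ⟨(div_le_one hz0).2 (by simpa using hz.2), le_rfl⟩
    · have hz0 := h0H z hz.1
      refine IsPreconnected.union (((ρ / ‖z‖ : ℝ) : ℂ) * z) (hrad z hz)
        ⟨ρ / ‖z‖, ⟨le_rfl, (div_le_one hz0).2 (by simpa using hz.2)⟩, rfl⟩ Cconn ?_
      exact isPreconnected_Icc.image _ (by fun_prop)
  have Nconn : IsPreconnected N := (hconv.inter (convex_ball 0 ρ)).isPreconnected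
  have imo : ∀ S ⊆ H, IsOpen S → IsOpen (G '' S) := by
    intro S hS ho
    have : G '' S = H ∩ G' ⁻¹' S := by
      ext w; constructor
      · rintro ⟨z, hz, rfl⟩
        exact ⟨mG (hS hz), by rw [mem_preimage, hG'G z (hS hz)]; exact hz⟩
      · rintro ⟨hw, hw2⟩
        exact ⟨G' w, hw2, hGG' w hw⟩
    rw [this]; exact hG'.isOpen_inter_preimage hH ho
  have imH : ∀ S ⊆ H, G '' S ⊆ H := fun S hS => (mG.mono hS Subset.rfl).image_subset
  have NH : N ⊆ H := inter_subset_left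
  have N'H : N' ⊆ H := sdiff_subset
  have CH : C ⊆ H := inter_subset_left
  have gtri : ∀ z ∈ H, z ∈ G '' N ∨ z ∈ G '' C ∨ z ∈ G '' N' := by
    intro z hz
    have e := hGG' z hz
    rcases tri _ (mG' hz) with h | h | h
    · exact Or.inl ⟨_, h, e⟩
    · exact Or.inr (Or.inl ⟨_, h, e⟩)
    · exact Or.inr (Or.inr ⟨_, h, e⟩)
  have ginj : InjOn G H := fun a ha b hb hab => by rw [← hG'G a ha, ← hG'G b hb, hab]
  have NN' : Disjoint N N' := by
    rw [disjoint_left]; rintro z ⟨_, h⟩ ⟨_, h2⟩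
    exact h2 (Metric.ball_subset_closedBall h)
  have gdisj : Disjoint (G '' N) (G '' N') := by
    rw [disjoint_left]
    rintro _ ⟨a, ha, rfl⟩ ⟨b, hb, hab⟩
    have := ginj (N'H hb) (NH ha) hab
    subst this
    exact disjoint_left.1 NN' ha hb
  have gNo := imo N NH No
  have gN'o := imo N' N'H N'o
  have mN : m (G '' N) = m N := by
    rw [mval _ (imH N NH) gNo, mval _ NH No]
    exact harea ρ ⟨hρ00, by linarith⟩
  have mNfin : m N ≠ ⊤ := ne_top_of_le_ne_top mfin (measure_mono (inter_subset_inter_right _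
        (Metric.ball_subset_ball (by linarith))))
  have Cin : ∀ c ∈ C, ∀ U : Set ℂ, IsOpen U → c ∈ U → (U ∩ N).Nonempty ∧ (U ∩ N').Nonempty := by
    intro c hc U hU hcU
    have e : ‖c‖ = ρ := by simpa using hc.2
    have hU2 : U ∩ H ∈ 𝓝 c := (hU.inter hH).mem_nhds ⟨hcU, hc.1⟩
    have hcont : ContinuousAt (fun t : ℝ => (t : ℂ) * c) 1 := by fun_prop
    have hpre : (fun t : ℝ => (t : ℂ) * c) ⁻¹' (U ∩ H) ∈ 𝓝 (1 : ℝ) :=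
      hcont.preimage_mem_nhds (by simpa using hU2)
    obtain ⟨ε, hε, hb⟩ := Metric.mem_nhds_iff.1 hpre
    set e' := min (ε / 2) (1 / 2) with he'
    have he0 : 0 < e' := lt_min (by positivity) (by norm_num)
    have he1 : e' < ε := (min_le_left _ _).trans_lt (by linarith)
    have he2 : e' ≤ 1 / 2 := min_le_right _ _
    constructor
    · have hk : (1 - e') ∈ Metric.ball (1 : ℝ) ε := by
        rw [Metric.mem_ball, Real.dist_eq]; rw [abs_lt]; constructor <;> linarith
      have := hb hk
      refine ⟨_, this.1, this.2, ?_⟩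
      rw [mem_ball_zero_iff, norm_mul, Complex.norm_real, Real.norm_of_nonneg (by linarith), e]
      nlinarith
    · have hk : (1 + e') ∈ Metric.ball (1 : ℝ) ε := by
        rw [Metric.mem_ball, Real.dist_eq]; rw [abs_lt]; constructor <;> linarith
      have := hb hk
      refine ⟨_, this.1, this.2, ?_⟩
      rw [mem_closedBall_zero_iff, norm_mul, Complex.norm_real, Real.norm_of_nonneg (by linarith), e]
      nlinarith
  have GCconn : IsPreconnected (G '' C) := Cconn.image _ (hG.mono CH)
  have GCsub : G '' C ⊆ N ∪ N' := by
    rintro _ ⟨c, hc, rfl⟩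
    rcases tri _ (mG hc.1) with h | h | h
    · exact Or.inl h
    · exact absurd h (GC c hc)
    · exact Or.inr h
  rcases GCconn.subset_or_subset No N'o NN' GCsub with hcase | hcase
  · exfalso
    have hMs : M ⊆ G '' N ∪ G '' N' := by
      intro z hz
      rcases gtri z hz.1 with h | h | h
      · exact Or.inl h
      · exact absurd (hcase h).2 hz.2
      · exact Or.inr h
    rcases Mconn.subset_or_subset gNo gN'o gdisj hMs with h | h
    · have h1 : m (H \ Metric.closedBall 0 (R / 2)) ≤ m N := by
        rw [← mN]
        refine measure_mono (subset_trans ?_ h)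
        intro z hz
        refine ⟨hz.1, fun hz2 => hz.2 ?_⟩
        rw [mem_ball_zero_iff] at hz2
        rw [mem_closedBall_zero_iff]; linarith
      have h2 : m N ≤ m (H ∩ Metric.ball 0 ρ0) := measure_mono (inter_subset_inter_right _
        (Metric.ball_subset_ball (by linarith)))
      exact absurd (h1.trans h2) (not_le.2 hρ0m)
    · -- G(N) ⊂ N strictly
      have hsub : G '' N ⊆ N := by
        intro z hz
        by_contra hzN
        have hzM : z ∈ M := ⟨imH N NH hz, fun hb => hzN ⟨imH N NH hz, hb⟩⟩
        exact disjoint_left.1 gdisj hz (h hzM)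
      have hne : (N ∩ G '' N').Nonempty := by
        have ho := hG.isOpen_inter_preimage hH No
        obtain ⟨c', hc', hc'2⟩ := (Cin c0 hc0 _ ho ⟨hc0.1, hcase ⟨c0, hc0, rfl⟩⟩).2
        exact ⟨G c', hc'.2, c', hc'2, rfl⟩
      have hp := mpos (N ∩ G '' N') (inter_subset_left.trans NH) (No.inter gN'o) hne
      have hle : m (G '' N) + m (N ∩ G '' N') ≤ m N := by
        rw [← measure_union (gdisj.mono_right inter_subset_right) (No.inter gN'o).measurableSet]
        exact measure_mono (union_subset hsub inter_subset_left)
      rw [mN] at hle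
      exact absurd hle (not_le.2 (ENNReal.lt_add_right mNfin hp.ne'))
  · have hNs : N ⊆ G '' N ∪ G '' N' := by
      intro z hz
      rcases gtri z hz.1 with h | h | h
      · exact Or.inl h
      · exact absurd (hcase h) (disjoint_left.1 NN' hz)
      · exact Or.inr h
    rcases Nconn.subset_or_subset gNo gN'o gdisj hNs with h | h
    · exfalso
      have hc0N : c0 ∈ G '' N := by
        rcases gtri c0 hc0.1 with h2 | h2 | h2
        · exact h2
        · obtain ⟨c, hc, e⟩ := h2
          exact absurd hc0 (e ▸ GC c hc)
        · exfalso
          obtain ⟨z, hz1, hz2⟩ := (Cin c0 hc0 _ gN'o h2).1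
          exact disjoint_left.1 gdisj (h hz2) hz1
      have hne : (G '' N ∩ N').Nonempty := (Cin c0 hc0 _ gNo hc0N).2
      have hp := mpos (G '' N ∩ N') (inter_subset_right.trans N'H) (gNo.inter N'o) hne
      have hle : m N + m (G '' N ∩ N') ≤ m (G '' N) := by
        rw [← measure_union (NN'.mono_right inter_subset_right) (gNo.inter N'o).measurableSet]
        exact measure_mono (union_subset h inter_subset_left)
      rw [mN] at hle
      exact absurd hle (not_le.2 (ENNReal.lt_add_right mNfin hp.ne'))
    · intro z hz hGz
      have h1 : G z ∈ G '' N := ⟨z, hz, rfl⟩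
      have h2 : G z ∈ G '' N' := h ⟨mG hz.1, hGz⟩
      exact disjoint_left.1 gdisj h1 h2

end NoEscape


section Index
open Topology

theorem arc_cos (c : ℝ) : OrdConnected {θ | θ ∈ Ioo (-Real.pi) Real.pi ∧ c < Real.cos θ} := by
  refine ⟨?_⟩
  rintro x ⟨hx, hx2⟩ y ⟨hy, hy2⟩ z hz
  refine ⟨⟨hx.1.trans_le hz.1, hz.2.trans_lt hy.2⟩, ?_⟩
  have hz2 : |z| ≤ max |x| |y| := abs_le_max_abs_abs hz.1 hz.2
  have key : ∀ w : ℝ, w ∈ Ioo (-Real.pi) Real.pi → |z| ≤ |w| → c < Real.cos w → c < Real.cos z := by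
    intro w hw hle hc
    rw [← Real.cos_abs z]
    rw [← Real.cos_abs w] at hc
    refine hc.trans_le (Real.cos_le_cos_of_nonneg_of_le_pi (abs_nonneg _) ?_ hle)
    exact (abs_lt.2 ⟨hw.1, hw.2⟩).le
  rcases le_max_iff.1 hz2 with h | h
  · exact key x hx h hx2
  · exact key y hy h hy2

theorem no_escape_affine {Ω : Set ℂ} (hΩ : IsOpen Ω) (hconv : Convex ℝ Ω) {a b : ℂ} (hb : ‖b‖ = 1)
    (h1H : a + b * 1 ∈ Ω)
    (hpos : ∀ z, a + b * z ∈ Ω → 0 < z.re)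
    (hstar : ∀ z, a + b * z ∈ Ω → ∀ t : ℝ, 0 < t → t ≤ 1 → a + b * (t * z) ∈ Ω)
    (harc : ∀ ρ > 0, OrdConnected {θ | θ ∈ Ioo (-Real.pi) Real.pi ∧ a + b * pol ρ θ ∈ Ω})
    {ψ : ℂ → ℂ} (hψ : DifferentiableOn ℂ ψ Ω) (hinj : InjOn ψ Ω)
    {R : ℝ} (hR : 0 < R) (hR1 : R ≤ 1)
    (hfin : volume (ψ '' (Ω ∩ Metric.ball a R)) ≠ ⊤)
    {G G' : ℂ → ℂ} (hG : ContinuousOn G Ω) (hG' : ContinuousOn G' Ω)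
    (mG : MapsTo G Ω Ω) (mG' : MapsTo G' Ω Ω) (hGG' : ∀ z ∈ Ω, G (G' z) = z)
    (hG'G : ∀ z ∈ Ω, G' (G z) = z)
    (harea : ∀ ρ ∈ Ioo 0 R, volume (ψ '' (G '' (Ω ∩ Metric.ball a ρ))) =
      volume (ψ '' (Ω ∩ Metric.ball a ρ)))
    {δ : ℝ} (hδ : 0 < δ) (hdisp : ∀ z ∈ Ω ∩ Metric.ball a R, 2 * δ ≤ ‖ψ (G z) - ψ z‖) :
    ∃ ρ > 0, ∀ z ∈ Ω ∩ Metric.ball a ρ, G z ∉ Metric.ball a ρ := by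
  have hb0 : b ≠ 0 := by rintro rfl; simp at hb
  set c : ℂ → ℂ := fun z => a + b * z with hc
  set d : ℂ → ℂ := fun w => (w - a) / b with hd
  have cd : ∀ w, c (d w) = w := fun w => by simp only [hc, hd]; field_simp; ring
  have dc : ∀ w, d (c w) = w := fun w => by simp only [hc, hd]; field_simp; ring
  have cc : Continuous c := by fun_prop
  have dcont : Continuous d := by fun_prop
  set H := c ⁻¹' Ω with hH
  have hcb : ∀ ρ z, c z ∈ Metric.ball a ρ ↔ z ∈ Metric.ball 0 ρ := by
    intro ρ z; simp [hc, Metric.mem_ball, dist_eq_norm, hb]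
  have him : ∀ ρ, c '' (H ∩ Metric.ball 0 ρ) = Ω ∩ Metric.ball a ρ := by
    intro ρ; ext w; constructor
    · rintro ⟨z, ⟨h1, h2⟩, rfl⟩; exact ⟨h1, (hcb ρ z).2 h2⟩
    · rintro ⟨h1, h2⟩
      refine ⟨d w, ⟨?_, ?_⟩, cd w⟩
      · rw [hH, mem_preimage, cd]; exact h1
      · rw [← hcb, cd]; exact h2
  have hψc : DifferentiableOn ℂ (ψ ∘ c) H := hψ.comp (by fun_prop) (fun z hz => hz)
  have hic : InjOn (ψ ∘ c) H := fun x hx y hy hxy => by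
    have := hinj hx hy hxy
    rw [← dc x, ← dc y, this]
  have hHo : IsOpen H := hΩ.preimage cc
  have hHconv : Convex ℝ H := by
    have h1 : c = fun z => a + (LinearMap.mulLeft ℝ b) z := by ext; simp [hc]
    have : H = (LinearMap.mulLeft ℝ b) ⁻¹' ((fun z => a + z) ⁻¹' Ω) := by
      ext z; simp [hH, hc]
    rw [this]
    exact (hconv.translate_preimage_right a).linear_preimage _
  have hcomp : ∀ S, (ψ ∘ c) '' ((d ∘ G ∘ c) '' S) = ψ '' (G '' (c '' S)) := by
    intro S
    simp only [image_image, Function.comp_apply, cd]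
  obtain ⟨ρ, hρ, h⟩ := no_escape (H := H) (ψ := ψ ∘ c) (R := R) (G := d ∘ G ∘ c) (G' := d ∘ G' ∘ c)
    hHo hHconv h1H hpos hstar harc hψc hic
    (by
      rcases (hψc.analyticOnNhd hHo).is_constant_or_isOpen hHconv.isPreconnected with ⟨w, hw⟩ | h
      · exfalso
        have e := (hw 1 h1H).trans (hw ((1 / 2 : ℝ) * 1) (hstar 1 h1H (1 / 2) (by norm_num) (by norm_num))).symm
        have := hic h1H (hstar 1 h1H (1 / 2) (by norm_num) (by norm_num)) e
        norm_num at this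
      · exact h) hR hR1 (by rw [image_comp, him]; exact hfin)
    (dcont.comp_continuousOn (hG.comp cc.continuousOn fun z hz => hz))
    (dcont.comp_continuousOn (hG'.comp cc.continuousOn fun z hz => hz))
    (fun z hz => by
      rw [hH, mem_preimage]; simp only [Function.comp_apply, cd]; exact mG hz)
    (fun z hz => by
      rw [hH, mem_preimage]; simp only [Function.comp_apply, cd]; exact mG' hz)
    (fun z hz => by simp only [Function.comp_apply, cd]; rw [hGG' _ hz, dc])
    (fun z hz => by simp only [Function.comp_apply, cd]; rw [hG'G _ hz, dc])
    (fun ρ hρ => by rw [hcomp, image_comp, him]; exact harea ρ hρ) hδ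
    (fun z hz => by
      simp only [Function.comp_apply, cd]
      exact hdisp _ ⟨hz.1, (hcb R z).2 hz.2⟩)
  refine ⟨ρ, hρ, fun w hw hGw => ?_⟩
  refine h (d w) ⟨?_, ?_⟩ ?_
  · rw [hH, mem_preimage, cd]; exact hw.1
  · rw [← hcb, cd]; exact hw.2
  · rw [← hcb]; simp only [Function.comp_apply, cd]; exact hGw

theorem q_log {Ω : Set ℂ} (hΩ : IsOpen Ω) (hconv : Convex ℝ Ω) {ψ : ℂ → ℂ}
    (hψ : DifferentiableOn ℂ ψ Ω) (hinj : InjOn ψ Ω) (hd : ∀ z ∈ Ω, deriv ψ z ≠ 0) :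
    ∃ L : ℂ × ℂ → ℂ, ContinuousOn L (Ω ×ˢ Ω) ∧ (∀ z ∈ Ω, ∀ w ∈ Ω,
      ψ z - ψ w = Complex.exp (L (z, w)) * (z - w)) ∧
      ∀ z ∈ Ω, Complex.exp (L (z, z)) = deriv ψ z := by
  set q : ℂ × ℂ → ℂ := fun p => dslope ψ p.2 p.1 with hq
  have hmul : ∀ z w, ψ z - ψ w = q (z, w) * (z - w) := by
    intro z w
    have := sub_smul_dslope ψ w z
    rw [← this, smul_eq_mul, mul_comm]
  have hne : ∀ p ∈ Ω ×ˢ Ω, q p ≠ 0 := by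
    rintro ⟨z, w⟩ ⟨hz, hw⟩ h0
    by_cases hzw : z = w
    · subst hzw
      simp only [hq, dslope_same] at h0
      exact hd z hz h0
    · have := hmul z w
      rw [h0, zero_mul, sub_eq_zero] at this
      exact hzw (hinj hz hw this)
  have hcont : ContinuousOn q (Ω ×ˢ Ω) := by
    rintro ⟨z, w⟩ ⟨hz, hw⟩
    refine ContinuousAt.continuousWithinAt ?_
    have cz := (hψ.differentiableAt (hΩ.mem_nhds hz)).continuousAt
    have cw := (hψ.differentiableAt (hΩ.mem_nhds hw)).continuousAt
    by_cases hzw : z = w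
    · subst hzw
      have han := hψ.analyticOnNhd hΩ z hz
      have hs : HasStrictDerivAt ψ (deriv ψ z) z := han.hasStrictDerivAt
      have hdc : ContinuousAt (deriv ψ) z := han.deriv.continuousAt
      have hlo := hs.hasStrictFDerivAt.isLittleO
      rw [Metric.continuousAt_iff']
      intro ε hε
      have h1 := hlo.def (half_pos hε)
      have h2 : ∀ᶠ p : ℂ × ℂ in 𝓝 (z, z), dist (deriv ψ p.1) (deriv ψ z) < ε :=
        (hdc.comp_of_eq continuousAt_fst rfl).eventually (Metric.ball_mem_nhds _ hε)
      filter_upwards [h1, h2] with p hp1 hp2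
      obtain ⟨x, y⟩ := p
      have e0 : q (z, z) = deriv ψ z := by simp [hq]
      rw [e0]
      by_cases hxy : x = y
      · subst hxy
        have e1 : q (x, x) = deriv ψ x := by simp [hq]
        rw [e1]; exact hp2
      · have h3 : ψ x - ψ y - (x - y) • deriv ψ z = (q (x, y) - deriv ψ z) * (x - y) := by
          rw [hmul, smul_eq_mul]; ring
        simp only [ContinuousLinearMap.toSpanSingleton_apply] at hp1
        rw [h3, norm_mul] at hp1
        have hpos : 0 < ‖x - y‖ := norm_pos_iff.2 (sub_ne_zero.2 hxy)
        have := le_of_mul_le_mul_right hp1 hpos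
        rw [dist_eq_norm]; linarith
    · have hev : ∀ᶠ p : ℂ × ℂ in 𝓝 (z, w), q p = (ψ p.1 - ψ p.2) / (p.1 - p.2) := by
        have : ∀ᶠ p : ℂ × ℂ in 𝓝 (z, w), p.1 - p.2 ≠ 0 :=
          (continuousAt_fst.sub continuousAt_snd).eventually_ne (sub_ne_zero.2 hzw)
        filter_upwards [this] with p hp
        rw [hmul p.1 p.2]; field_simp
      refine ContinuousAt.congr ?_ (hev.mono fun _ h => h.symm)
      refine ContinuousAt.div ?_ (by fun_prop) (sub_ne_zero.2 hzw)
      exact (cz.comp_of_eq continuousAt_fst rfl).sub (cw.comp_of_eq continuousAt_snd rfl)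
  obtain ⟨L, hL, hL2⟩ := hasLog_of_convex (hconv.prod hconv) (hΩ.prod hΩ) hcont hne
  refine ⟨L, hL, fun z hz w hw => ?_, fun z hz => ?_⟩
  · rw [hmul, hL2 (z, w) ⟨hz, hw⟩]
  · rw [hL2 (z, z) ⟨hz, hz⟩]; simp [hq]

end Index


section Index2
open Topology

theorem not_slit {z : ℂ} (h : z ∉ Complex.slitPlane) : z.re ≤ 0 ∧ z.im = 0 := by
  rw [Complex.mem_slitPlane_iff] at h
  push Not at h
  exact h

theorem disc_index {ψ : ℂ → ℂ} (hψ : DifferentiableOn ℂ ψ (Metric.ball 0 1))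
    (hinj : InjOn ψ (Metric.ball 0 1)) (hd : ∀ z ∈ Metric.ball (0 : ℂ) 1, deriv ψ z ≠ 0)
    (hfin : volume (ψ '' Metric.ball 0 1) ≠ ⊤)
    {G G' : ℂ → ℂ} (hG : ContinuousOn G (Metric.ball 0 1)) (hG' : ContinuousOn G' (Metric.ball 0 1))
    (mG : MapsTo G (Metric.ball 0 1) (Metric.ball 0 1))
    (mG' : MapsTo G' (Metric.ball 0 1) (Metric.ball 0 1))
    (hGG' : ∀ z ∈ Metric.ball (0 : ℂ) 1, G (G' z) = z)
    (hG'G : ∀ z ∈ Metric.ball (0 : ℂ) 1, G' (G z) = z)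
    (harea : ∀ S ⊆ Metric.ball (0 : ℂ) 1, IsOpen S → volume (ψ '' (G '' S)) = volume (ψ '' S))
    {r1 δ : ℝ} (hr1 : r1 < 1) (hδ : 0 < δ)
    (hdisp : ∀ z : ℂ, r1 < ‖z‖ → ‖z‖ < 1 → 2 * δ ≤ ‖ψ (G z) - ψ z‖) :
    ∃ r2 < 1, ∀ r, r2 < r → 0 < r → r < 1 →
      HasLog (fun z => (ψ (G z) - ψ z) / z) (Metric.sphere 0 r) := by
  set R := min (1 - r1) 1 with hR
  have hR0 : 0 < R := lt_min (by linarith) one_pos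
  have hne : ∀ a : ℂ, ‖a‖ = 1 → ∃ ρ > 0, ∀ z ∈ Metric.ball (0 : ℂ) 1 ∩ Metric.ball a ρ,
      G z ∉ Metric.ball a ρ := by
    intro a ha
    have hmem : ∀ z, a + -a * z ∈ Metric.ball (0 : ℂ) 1 ↔ ‖z‖ ^ 2 < 2 * z.re := by
      intro z
      rw [mem_ball_zero_iff, show a + -a * z = a * (1 - z) by ring, norm_mul, ha, one_mul]
      rw [← sq_lt_one_iff₀ (norm_nonneg _), ← Complex.normSq_eq_norm_sq, ← Complex.normSq_eq_norm_sq,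
        Complex.normSq_apply, Complex.normSq_apply]
      simp only [Complex.sub_re, Complex.one_re, Complex.sub_im, Complex.one_im]
      constructor <;> intro h <;> nlinarith
    refine no_escape_affine (a := a) (b := -a) (R := R) (δ := δ) Metric.isOpen_ball (convex_ball 0 1)
      (by rw [norm_neg, ha]) (by simp) ?_ ?_ ?_ hψ hinj hR0 (min_le_right _ _) ?_ hG hG' mG mG' hGG' hG'G
      (fun ρ _ => harea _ inter_subset_left (Metric.isOpen_ball.inter Metric.isOpen_ball)) hδ ?_
    · intro z hz
      rw [hmem] at hz
      nlinarith [sq_nonneg ‖z‖]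
    · intro z hz t ht ht1
      rw [hmem] at hz ⊢
      rw [norm_mul, Complex.norm_real, Real.norm_of_nonneg ht.le, Complex.re_ofReal_mul]
      have h1 : (t * ‖z‖) ^ 2 = t * (t * ‖z‖ ^ 2) := by ring
      have h2 : t * ‖z‖ ^ 2 ≤ ‖z‖ ^ 2 := by nlinarith [sq_nonneg ‖z‖]
      rw [h1]; nlinarith
    · intro ρ hρ
      have := arc_cos (ρ / 2)
      convert this using 4 with θ
      rw [hmem, pol_norm hρ.le, pol, Complex.re_ofReal_mul]
      simp only [Complex.add_re, Complex.ofReal_re, Complex.re_ofReal_mul, Complex.I_re, mul_zero, add_zero]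
      constructor <;> intro h <;> nlinarith
    · exact ne_top_of_le_ne_top hfin (measure_mono (image_mono inter_subset_left))
    · rintro z ⟨hz1, hz2⟩
      rw [mem_ball_zero_iff] at hz1
      refine hdisp z ?_ hz1
      rw [Metric.mem_ball, dist_eq_norm] at hz2
      have h1 : ‖z - a‖ < 1 - r1 := hz2.trans_le (min_le_left _ _)
      have h2 := norm_sub_norm_le a z
      rw [norm_sub_rev, ha] at h2
      linarith
  choose! ρ hρ hρ2 using hne
  obtain ⟨ε, hε, hleb⟩ := lebesgue_number_lemma_of_metric (s := Metric.sphere (0 : ℂ) 1)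
    (c := fun a : Metric.sphere (0 : ℂ) 1 => Metric.ball (a : ℂ) (ρ a)) (isCompact_sphere 0 1)
    (fun _ => Metric.isOpen_ball) (fun a ha => mem_iUnion.2 ⟨⟨a, ha⟩, Metric.mem_ball_self
      (hρ a (by simpa using ha))⟩)
  have hesc : ∀ z : ℂ, 1 - ε < ‖z‖ → 0 < ‖z‖ → ‖z‖ < 1 → ∀ t : ℝ, 1 ≤ t → G z ≠ t * z := by
    intro z h1 h0 h2 t ht hGz
    have hn : ‖((‖z‖⁻¹ : ℝ) : ℂ) * z‖ = 1 := by
      rw [norm_mul, Complex.norm_real, Real.norm_of_nonneg (by positivity)]; field_simp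
    obtain ⟨⟨a, ha⟩, hsub⟩ := hleb (((‖z‖⁻¹ : ℝ) : ℂ) * z) (by simpa using hn)
    have hdist : ∀ s : ℝ, 1 ≤ s → ‖(s : ℂ) * z‖ < 1 →
        (s : ℂ) * z ∈ Metric.ball (((‖z‖⁻¹ : ℝ) : ℂ) * z) ε := by
      intro s hs hs1
      rw [norm_mul, Complex.norm_real, Real.norm_of_nonneg (by linarith)] at hs1
      rw [Metric.mem_ball, dist_eq_norm, ← sub_mul, ← Complex.ofReal_sub, norm_mul, Complex.norm_real,
        Real.norm_eq_abs]
      have : s < ‖z‖⁻¹ := by rw [lt_inv_comm₀ (by linarith) h0]; rw [← one_div, lt_div_iff₀ (by linarith)]; linarith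
      rw [abs_of_neg (by linarith)]
      have : ‖z‖⁻¹ * ‖z‖ = 1 := by field_simp
      nlinarith
    have hz1 : z ∈ Metric.ball (0 : ℂ) 1 := by simpa using h2
    have k1 := hsub (hdist 1 le_rfl (by simpa using h2))
    have k2 := hsub (hdist t ht (by rw [← hGz]; simpa using mG hz1))
    rw [← hGz] at k2
    rw [Complex.ofReal_one, one_mul] at k1
    exact hρ2 a (by simpa using ha) z ⟨hz1, k1⟩ k2
  obtain ⟨L, hL, hL2, -⟩ := q_log Metric.isOpen_ball (convex_ball 0 1) hψ hinj hd
  refine ⟨1 - ε, by linarith, fun r hr hr0 hr1 => ?_⟩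
  have hsb : ∀ z ∈ Metric.sphere (0 : ℂ) r, z ∈ Metric.ball (0 : ℂ) 1 := by
    intro z hz
    rw [mem_sphere_zero_iff_norm] at hz
    rw [mem_ball_zero_iff]; linarith
  have hz0 : ∀ z ∈ Metric.sphere (0 : ℂ) r, z ≠ 0 := by
    intro z hz
    rw [mem_sphere_zero_iff_norm] at hz
    rw [← norm_pos_iff]; linarith
  have hGr := hG.mono hsb
  have g1 : HasLog (fun z => 1 - G z / z) (Metric.sphere 0 r) := by
    refine hasLog_of_slitPlane (continuousOn_const.sub (hGr.div continuousOn_id hz0)) ?_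
    intro z hz
    by_contra hcon
    obtain ⟨h1, h2⟩ := not_slit hcon
    simp only [Complex.sub_re, Complex.one_re, Complex.sub_im, Complex.one_im] at h1 h2
    have e : G z / z = ((G z / z).re : ℂ) := by
      apply Complex.ext <;> simp; linarith
    rw [div_eq_iff (hz0 z hz)] at e
    rw [mem_sphere_zero_iff_norm] at hz
    exact hesc z (by linarith) (by linarith) (by linarith) _ (by linarith) e
  have g2 : HasLog (fun z => Complex.exp (L (G z, z))) (Metric.sphere 0 r) := by
    refine ⟨fun z => L (G z, z), ?_, fun z _ => rfl⟩
    exact hL.comp (hGr.prodMk continuousOn_id) fun z hz => ⟨mG (hsb z hz), hsb z hz⟩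
  refine ((g2.mul g1).mul (hasLog_const (-1) (by norm_num) _)).congr fun z hz => ?_
  have := hz0 z hz
  rw [hL2 _ (mG (hsb z hz)) _ (hsb z hz)]
  field_simp
  ring

theorem half_index {ψ : ℂ → ℂ} (hψ : DifferentiableOn ℂ ψ {z | 0 < z.im})
    (hinj : InjOn ψ {z | 0 < z.im}) (hd : ∀ z : ℂ, 0 < z.im → deriv ψ z ≠ 0)
    (hper : ∀ z : ℂ, 0 < z.im → ψ (z + 1) = ψ z + 1)
    {R : ℝ} (hR0 : 0 < R) (hR1 : R ≤ 1)
    (hfin : ∀ t : ℝ, volume (ψ '' ({z | 0 < z.im} ∩ Metric.ball (t : ℂ) R)) ≠ ⊤)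
    {G G' : ℂ → ℂ} (hG : ContinuousOn G {z | 0 < z.im}) (hG' : ContinuousOn G' {z | 0 < z.im})
    (mG : MapsTo G {z | 0 < z.im} {z | 0 < z.im})
    (mG' : MapsTo G' {z | 0 < z.im} {z | 0 < z.im})
    (hGG' : ∀ z : ℂ, 0 < z.im → G (G' z) = z)
    (hG'G : ∀ z : ℂ, 0 < z.im → G' (G z) = z)
    (hGper : ∀ z : ℂ, 0 < z.im → G (z + 1) = G z + 1)
    (harea : ∀ t : ℝ, ∀ ρ ∈ Ioo 0 R, volume (ψ '' (G '' ({z | 0 < z.im} ∩ Metric.ball (t : ℂ) ρ))) =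
      volume (ψ '' ({z | 0 < z.im} ∩ Metric.ball (t : ℂ) ρ)))
    {δ : ℝ} (hδ : 0 < δ)
    (hdisp : ∀ z : ℂ, 0 < z.im → z.im < R → 2 * δ ≤ ‖ψ (G z) - ψ z‖) :
    ∃ η2 > 0, ∀ η, 0 < η → η < η2 → ∃ l : ℂ → ℂ, ContinuousOn l {z | z.im = η} ∧
      (∀ z : ℂ, z.im = η → Complex.exp (l z) = ψ (G z) - ψ z) ∧
      ∀ z : ℂ, z.im = η → l (z + 1) = l z := by
  set Ω : Set ℂ := {z | 0 < z.im} with hΩ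
  have hΩo : IsOpen Ω := isOpen_lt continuous_const Complex.continuous_im
  have hΩc : Convex ℝ Ω := convex_halfSpace_im_gt 0
  have hne : ∀ t : ℝ, ∃ ρ > 0, ∀ z ∈ Ω ∩ Metric.ball (t : ℂ) ρ, G z ∉ Metric.ball (t : ℂ) ρ := by
    intro t
    have hmem : ∀ z, t + Complex.I * z ∈ Ω ↔ 0 < z.re := by
      intro z; simp [hΩ]
    refine no_escape_affine (a := t) (b := Complex.I) (R := R) (δ := δ) hΩo hΩc Complex.norm_I
      (by simp [hΩ]) ?_ ?_ ?_ hψ hinj hR0 hR1 (hfin t) hG hG' mG mG' hGG' hG'G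
      (harea t) hδ ?_
    · intro z hz
      exact (hmem z).1 hz
    · intro z hz s hs hs1
      rw [hmem] at hz ⊢
      rw [Complex.re_ofReal_mul]; positivity
    · intro ρ hρ
      have := arc_cos 0
      convert this using 4 with θ
      rw [hmem, pol, Complex.re_ofReal_mul]
      simp only [Complex.add_re, Complex.ofReal_re, Complex.re_ofReal_mul, Complex.I_re, mul_zero, add_zero]
      constructor <;> intro h <;> [exact (pos_iff_pos_of_mul_pos h).1 hρ; positivity]
    · rintro z ⟨hz1, hz2⟩
      refine hdisp z hz1 ?_
      rw [Metric.mem_ball, dist_eq_norm] at hz2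
      have := Complex.abs_im_le_norm (z - t)
      simp only [Complex.sub_im, Complex.ofReal_im, sub_zero] at this
      exact (le_abs_self _).trans_lt (this.trans_lt hz2)
  choose ρ hρ hρ2 using hne
  obtain ⟨ε, hε, hleb⟩ := lebesgue_number_lemma_of_metric
    (s := (fun t : ℝ => (t : ℂ)) '' Icc (0 : ℝ) 1)
    (c := fun t : ℝ => Metric.ball (t : ℂ) (ρ t)) (isCompact_Icc.image Complex.continuous_ofReal)
    (fun _ => Metric.isOpen_ball) (by
      rintro _ ⟨a, ha, rfl⟩
      exact mem_iUnion.2 ⟨a, Metric.mem_ball_self (hρ a)⟩)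
  have hesc1 : ∀ z : ℂ, 0 < z.im → z.im < ε → z.re ∈ Icc (0 : ℝ) 1 → ∀ s : ℝ, 0 ≤ s →
      G z ≠ z - Complex.I * s := by
    intro z h1 h2 h3 s hs hGz
    obtain ⟨t, ht⟩ := hleb z.re ⟨z.re, h3, rfl⟩
    have hd2 : ∀ w : ℂ, w.re = z.re → 0 < w.im → w.im ≤ z.im → w ∈ Metric.ball (z.re : ℂ) ε := by
      intro w hw hw1 hw2
      rw [Metric.mem_ball, dist_eq_norm]
      have : w - (z.re : ℂ) = Complex.I * (w.im : ℂ) := by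
        apply Complex.ext <;> simp [hw]
      rw [this, norm_mul, Complex.norm_I, one_mul, Complex.norm_real, Real.norm_of_nonneg hw1.le]
      linarith
    have k1 := ht (hd2 z rfl h1 le_rfl)
    have hGm : 0 < (G z).im := mG h1
    have k2 := ht (hd2 (G z) (by rw [hGz]; simp) hGm (by rw [hGz]; simp; exact hs))
    exact hρ2 t z ⟨h1, k1⟩ k2
  have hGn : ∀ n : ℤ, ∀ z : ℂ, 0 < z.im → G (z + n) = G z + n := by
    have hnat : ∀ n : ℕ, ∀ z : ℂ, 0 < z.im → G (z + n) = G z + n := by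
      intro n
      induction n with
      | zero => intro z _; simp
      | succ k ih =>
        intro z hz
        have := hGper (z + k) (by simpa using hz)
        push_cast
        rw [← add_assoc, this, ih z hz, add_assoc]
    intro n z hz
    obtain ⟨k, rfl | rfl⟩ := n.eq_nat_or_neg
    · exact_mod_cast hnat k z hz
    · have := hnat k (z + ((-k : ℤ) : ℂ)) (by simpa using hz)
      push_cast at this ⊢
      rw [neg_add_cancel_right] at this
      rw [this]; ring
  have hesc : ∀ z : ℂ, 0 < z.im → z.im < ε → ∀ s : ℝ, 0 ≤ s → G z ≠ z - Complex.I * s := by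
    intro z h1 h2 s hs hGz
    set n := ⌊z.re⌋ with hn
    refine hesc1 (z + ((-n : ℤ) : ℂ)) (by simpa using h1) (by simpa using h2) ?_ s hs ?_
    · have e1 := Int.floor_le z.re
      have e2 := Int.lt_floor_add_one z.re
      simp only [Complex.add_re, Complex.intCast_re]
      push_cast
      constructor <;> linarith
    · rw [hGn _ _ h1, hGz]; ring
  obtain ⟨L, hL, hL2, hL3⟩ := q_log hΩo hΩc hψ hinj hd
  have sh : ∀ z ∈ Ω, z + 1 ∈ Ω := fun z hz => by
    rw [hΩ, mem_ofPred_eq] at hz ⊢; simpa using hz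
  have hLper : ∀ z ∈ Ω, ∀ w ∈ Ω, L (z + 1, w + 1) = L (z, w) := by
    have hp : IsPreconnected (Ω ×ˢ Ω) := hΩc.isPreconnected.prod hΩc.isPreconnected
    have hsh : ContinuousOn (fun p : ℂ × ℂ => L (p.1 + 1, p.2 + 1)) (Ω ×ˢ Ω) :=
      hL.comp (by fun_prop) fun p hp => ⟨sh _ hp.1, sh _ hp.2⟩
    obtain ⟨n, hn⟩ := log_unique hp hsh hL (by
      rintro ⟨z, w⟩ ⟨hz, hw⟩
      by_cases hzw : z = w
      · subst hzw
        simp only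
        rw [hL3 _ (sh z hz), hL3 z hz]
        have h1 : (fun x => ψ (x + 1)) =ᶠ[𝓝 z] fun x => ψ x + 1 := by
          filter_upwards [hΩo.mem_nhds hz] with x hx
          exact hper x hx
        have h2 := h1.deriv_eq
        rw [deriv_comp_add_const, deriv_add_const] at h2
        exact h2
      · have h1 := hL2 _ (sh z hz) _ (sh w hw)
        rw [hper z hz, hper w hw, add_sub_add_right_eq_sub, add_sub_add_right_eq_sub, hL2 z hz w hw] at h1
        exact (mul_right_cancel₀ (sub_ne_zero.2 hzw) h1).symm)
    have hc1 : ContinuousOn (fun z : ℂ => L (z + 1, z)) Ω :=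
      hL.comp (by fun_prop) fun p hp => ⟨sh _ hp, hp⟩
    obtain ⟨m, hm⟩ := log_unique hΩc.isPreconnected hc1 (continuousOn_const (c := (0 : ℂ))) (by
      intro z hz
      have h1 := hL2 _ (sh z hz) _ hz
      rw [hper z hz] at h1
      simp only [add_sub_cancel_left, mul_one] at h1
      rw [Complex.exp_zero]; exact h1.symm)
    have hI : Complex.I ∈ Ω := by simp [hΩ]
    have e1 := hm _ hI
    have e2 := hm _ (sh _ hI)
    have e3 := hn (Complex.I + 1, Complex.I) ⟨sh _ hI, hI⟩
    simp only at e1 e2 e3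
    rw [e2, e1] at e3
    have e4 : (n : ℂ) * (2 * Real.pi * Complex.I) = 0 := by linear_combination -e3
    intro z hz w hw
    have := hn (z, w) ⟨hz, hw⟩
    simp only at this
    rw [this, e4, add_zero]
  refine ⟨ε, hε, fun η hη hη2 => ?_⟩
  have hsub : {z : ℂ | z.im = η} ⊆ Ω := fun z hz => by
    rw [mem_ofPred_eq] at hz
    rw [hΩ, mem_ofPred_eq, hz]; exact hη
  have hslit : ∀ z : ℂ, z.im = η → (G z - z) / Complex.I ∈ Complex.slitPlane := by
    intro z hz
    by_contra hcon
    obtain ⟨h1, h2⟩ := not_slit hcon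
    set q := (G z - z) / Complex.I with hq
    have e : q = ((q.re : ℝ) : ℂ) := by apply Complex.ext <;> simp [h2]
    have e2 : G z - z = Complex.I * q := by rw [hq]; field_simp
    refine hesc z (by linarith) (by linarith) (-q.re) (by linarith) ?_
    push_cast
    rw [← e]
    linear_combination e2
  have hGr := hG.mono hsub
  refine ⟨fun z => L (G z, z) + Complex.log ((G z - z) / Complex.I) + Complex.log Complex.I, ?_, ?_, ?_⟩
  · refine ContinuousOn.add (ContinuousOn.add ?_ ?_) continuousOn_const
    · exact hL.comp (hGr.prodMk continuousOn_id) fun z hz => ⟨mG (hsub hz), hsub hz⟩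
    · refine ContinuousOn.clog ((hGr.sub continuousOn_id).div_const _) fun z hz => hslit z hz
  · intro z hz
    rw [Complex.exp_add, Complex.exp_add, Complex.exp_log (Complex.slitPlane_ne_zero (hslit z hz)),
      Complex.exp_log Complex.I_ne_zero, hL2 _ (mG (hsub hz)) _ (hsub hz)]
    field_simp
  · intro z hz
    beta_reduce
    rw [hGper z (hsub hz), hLper _ (mG (hsub hz)) _ (hsub hz), add_sub_add_right_eq_sub]

end Index2


section EEsec
open Topology

/-- the universal covering of the punctured plane -/
def EE (z : ℂ) : ℂ := Complex.exp (2 * Real.pi * Complex.I * z)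

/-- a discontinuous section of `EE` -/
def lg (u : ℂ) : ℂ := Complex.log u / (2 * Real.pi * Complex.I)

theorem EE_lg {u : ℂ} (hu : u ≠ 0) : EE (lg u) = u := by
  rw [EE, lg, mul_div_cancel₀ _ Complex.two_pi_I_ne_zero, Complex.exp_log hu]

theorem EE_ne (z : ℂ) : EE z ≠ 0 := Complex.exp_ne_zero _

theorem EE_cont : Continuous EE := by unfold EE; fun_prop

theorem EE_diff : Differentiable ℂ EE := by unfold EE; fun_prop

theorem EE_eq {z w : ℂ} : EE z = EE w ↔ ∃ n : ℤ, z = w + n := by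
  rw [EE, EE, Complex.exp_eq_exp_iff_exists_int]
  refine exists_congr fun n => ?_
  constructor
  · intro h
    apply mul_left_cancel₀ Complex.two_pi_I_ne_zero
    rw [h]; ring
  · rintro rfl; ring

theorem EE_add (z w : ℂ) : EE (z + w) = EE z * EE w := by
  rw [EE, EE, EE, ← Complex.exp_add]; congr 1; ring

theorem EE_int (n : ℤ) : EE n = 1 := by
  rw [EE, mul_comm]; exact Complex.exp_int_mul_two_pi_mul_I n

theorem EE_add_int (z : ℂ) (n : ℤ) : EE (z + n) = EE z := by rw [EE_add, EE_int, mul_one]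

theorem EE_add_one (z : ℂ) : EE (z + 1) = EE z := by
  have := EE_add_int z 1
  simpa using this

theorem EE_neg (z : ℂ) : EE (-z) = (EE z)⁻¹ := by
  rw [EE, EE, ← Complex.exp_neg]; congr 1; ring

theorem EE_half : EE (1 / 2) = -1 := by
  rw [EE, ← Complex.exp_pi_mul_I]; congr 1; ring

theorem EE_norm (z : ℂ) : ‖EE z‖ = Real.exp (-(2 * Real.pi * z.im)) := by
  rw [EE, Complex.norm_exp]; congr 1; simp

theorem EE_norm_lt_one {z : ℂ} : ‖EE z‖ < 1 ↔ 0 < z.im := by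
  rw [EE_norm, Real.exp_lt_one_iff]
  have := Real.pi_pos
  constructor <;> intro h <;> nlinarith

theorem EE_hasDeriv (z : ℂ) : HasDerivAt EE (EE z * (2 * Real.pi * Complex.I)) z := by
  have h := ((hasDerivAt_id z).const_mul (2 * Real.pi * Complex.I : ℂ)).cexp
  have e : EE = fun x => Complex.exp (2 * Real.pi * Complex.I * x) := rfl
  rw [e]
  refine h.congr_deriv ?_
  simp

theorem EE_deriv (z : ℂ) : deriv EE z = EE z * (2 * Real.pi * Complex.I) := (EE_hasDeriv z).deriv

theorem EE_deriv_ne (z : ℂ) : deriv EE z ≠ 0 := by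
  rw [EE_deriv]; exact mul_ne_zero (EE_ne z) Complex.two_pi_I_ne_zero

theorem per_int {h : ℂ → ℂ} {P : Set ℂ} (hP : ∀ z, z ∈ P ↔ z + 1 ∈ P) {c : ℂ}
    (hper : ∀ z ∈ P, h (z + 1) = h z + c) :
    ∀ n : ℤ, ∀ z ∈ P, z + n ∈ P ∧ h (z + n) = h z + n * c := by
  have hnat : ∀ n : ℕ, ∀ z : ℂ, z ∈ P → z + n ∈ P ∧ h (z + n) = h z + n * c := by
    intro n
    induction n with
    | zero => intro z hz; simpa using hz
    | succ k ih =>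
      intro z hz
      obtain ⟨h1, h2⟩ := ih z hz
      push_cast
      rw [← add_assoc]
      refine ⟨(hP _).1 h1, ?_⟩
      rw [hper _ h1, h2]; ring
  have hnat' : ∀ n : ℕ, ∀ z : ℂ, z + n ∈ P → z ∈ P := by
    intro n
    induction n with
    | zero => intro z hz; simpa using hz
    | succ k ih =>
      intro z hz
      push_cast at hz
      rw [← add_assoc] at hz
      exact ih z ((hP _).2 hz)
  intro n z hz
  obtain ⟨k, rfl | rfl⟩ := n.eq_nat_or_neg
  · exact_mod_cast hnat k z hz
  · have e : z + ((-k : ℤ) : ℂ) + k = z := by push_cast; ring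
    have h1 : z + ((-k : ℤ) : ℂ) ∈ P := hnat' k _ (by rw [e]; exact hz)
    refine ⟨h1, ?_⟩
    have := (hnat k _ h1).2
    rw [e] at this
    rw [this]; push_cast; ring

theorem descend {h : ℂ → ℂ} {S : Set ℂ} (hS : ∀ u ∈ S, u ≠ 0) (hc : ContinuousOn h (EE ⁻¹' S))
    (hper : ∀ z, EE z ∈ S → h (z + 1) = h z) :
    ContinuousOn (fun u => h (lg u)) S ∧ ∀ z, EE z ∈ S → h (lg (EE z)) = h z := by
  have hP : ∀ z, z ∈ EE ⁻¹' S ↔ z + 1 ∈ EE ⁻¹' S := fun z => by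
    rw [mem_preimage, mem_preimage, EE_add_one]
  have hval : ∀ z w, EE z ∈ S → EE z = EE w → h z = h w := by
    intro z w hz hzw
    obtain ⟨n, hn⟩ := EE_eq.1 hzw.symm
    have := (per_int hP (h := h) (c := 0) (fun z hz => by rw [add_zero]; exact hper z hz) n z hz).2
    rw [← hn] at this
    rw [this]; simp
  refine ⟨?_, fun z hz => hval _ _ (by rwa [EE_lg (EE_ne z)]) (EE_lg (EE_ne z))⟩
  intro u0 hu0
  have key : ∀ b : ℂ → ℂ, ContinuousAt b u0 → (∀ u ∈ S, EE (b u) = u) →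
      ContinuousWithinAt (fun u => h (lg u)) S u0 := by
    intro b hb hbu
    have h1 : ContinuousWithinAt (fun u => h (b u)) S u0 := by
      refine ContinuousWithinAt.comp (t := EE ⁻¹' S) (hc (b u0) (by rw [mem_preimage, hbu _ hu0]; exact hu0))
        hb.continuousWithinAt fun u hu => by rw [mem_preimage, hbu _ hu]; exact hu
    refine h1.congr (fun u hu => ?_) ?_
    · exact hval _ _ (by rwa [EE_lg (hS u hu)]) (by rw [EE_lg (hS u hu), hbu u hu])
    · exact hval _ _ (by rwa [EE_lg (hS _ hu0)]) (by rw [EE_lg (hS _ hu0), hbu _ hu0])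
  by_cases hsl : u0 ∈ Complex.slitPlane
  · refine key lg ?_ fun u hu => EE_lg (hS u hu)
    exact (continuousAt_clog hsl).div_const _
  · have hsl2 : -u0 ∈ Complex.slitPlane := by
      obtain ⟨h1, h2⟩ := not_slit hsl
      left
      have : u0.re ≠ 0 := fun h => hS u0 hu0 (Complex.ext h h2)
      have := lt_of_le_of_ne h1 this
      simpa using this
    refine key (fun u => lg (-u) + 1 / 2) ?_ fun u hu => ?_
    · have : ContinuousAt (fun u : ℂ => Complex.log (-u)) u0 :=
        ContinuousAt.clog (by fun_prop) hsl2
      exact (this.div_const _).add continuousAt_const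
    · rw [EE_add, EE_half, EE_lg (neg_ne_zero.2 (hS u hu))]; ring

theorem vol_fin {S : Set ℂ} (hS : IsOpen S) (hinj : InjOn EE S) {c C : ℝ} (hc : 0 < c)
    (h1 : ∀ z ∈ S, c ≤ ‖EE z‖) (h2 : ∀ z ∈ S, ‖EE z‖ ≤ C) : volume S ≠ ⊤ := by
  have ha := area_holo hS EE_diff.differentiableOn hinj
  have hle : volume (EE '' S) ≠ ⊤ := by
    refine ne_top_of_le_ne_top (measure_closedBall_lt_top (x := (0 : ℂ)) (r := C)).ne (measure_mono ?_)
    rintro _ ⟨z, hz, rfl⟩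
    simpa using h2 z hz
  have hlow : ENNReal.ofReal (c ^ 2) * volume S ≤ volume (EE '' S) := by
    rw [← ha, ← setLIntegral_const]
    refine setLIntegral_mono' hS.measurableSet fun z hz => ?_
    rw [← ofReal_norm, ← ENNReal.ofReal_pow (norm_nonneg _)]
    refine ENNReal.ofReal_le_ofReal ?_
    refine pow_le_pow_left₀ hc.le ?_ 2
    rw [EE_deriv, norm_mul]
    have : ‖(2 * Real.pi * Complex.I : ℂ)‖ = 2 * Real.pi := by
      simp [abs_of_pos Real.pi_pos]
    rw [this]
    have := h1 z hz
    nlinarith [Real.pi_gt_three]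
  intro htop
  rw [htop, ENNReal.mul_top (by simpa using hc.ne')] at hlow
  exact hle (top_le_iff.1 hlow)

theorem open_image {Ω : Set ℂ} (hΩ : IsOpen Ω) (hcon : IsPreconnected Ω) {ψ : ℂ → ℂ}
    (hψ : DifferentiableOn ℂ ψ Ω) (hinj : InjOn ψ Ω) : ∀ S ⊆ Ω, IsOpen S → IsOpen (ψ '' S) := by
  rcases (hψ.analyticOnNhd hΩ).is_constant_or_isOpen hcon with ⟨w, hw⟩ | h
  · intro S hS ho
    rcases S.eq_empty_or_nonempty with rfl | ⟨x, hx⟩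
    · simp
    exfalso
    have : S ⊆ {x} := fun y hy => hinj (hS hy) (hS hx) ((hw y (hS hy)).trans (hw x (hS hx)).symm)
    have h2 : S = {x} := subset_antisymm this (singleton_subset_iff.2 hx)
    rw [h2] at ho
    exact not_isOpen_singleton x ho
  · exact h

theorem conj_map {Ω : Set ℂ} (hΩ : IsOpen Ω) (hcon : IsPreconnected Ω) {ψ : ℂ → ℂ}
    (hψ : DifferentiableOn ℂ ψ Ω) (hinj : InjOn ψ Ω) {g g' : ℂ → ℂ} (hg : Continuous g)
    (hg' : Continuous g') (hgg' : ∀ z, g (g' z) = z) (hg'g : ∀ z, g' (g z) = z)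
    (h1 : ∀ z ∈ Ω, g (ψ z) ∈ ψ '' Ω) (h2 : ∀ z ∈ Ω, g' (ψ z) ∈ ψ '' Ω) :
    ∃ G G' : ℂ → ℂ, ContinuousOn G Ω ∧ ContinuousOn G' Ω ∧ MapsTo G Ω Ω ∧ MapsTo G' Ω Ω ∧
      (∀ z ∈ Ω, G (G' z) = z) ∧ (∀ z ∈ Ω, G' (G z) = z) ∧ (∀ z ∈ Ω, ψ (G z) = g (ψ z)) := by
  have hop := open_image hΩ hcon hψ hinj
  choose! G hGm hG using h1
  choose! G' hG'm hG' using h2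
  have hcont : ∀ (k K : ℂ → ℂ), Continuous k → (∀ z ∈ Ω, K z ∈ Ω) → (∀ z ∈ Ω, ψ (K z) = k (ψ z)) →
      ContinuousOn K Ω := by
    intro k K hk hK hKψ
    rw [continuousOn_open_iff hΩ]
    intro t ht
    have : Ω ∩ K ⁻¹' t = Ω ∩ (fun z => k (ψ z)) ⁻¹' (ψ '' (t ∩ Ω)) := by
      ext z; constructor
      · rintro ⟨hz, hz2⟩
        exact ⟨hz, K z, ⟨hz2, hK z hz⟩, hKψ z hz⟩
      · rintro ⟨hz, w, ⟨hw1, hw2⟩, hw3⟩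
        refine ⟨hz, ?_⟩
        have := hinj hw2 (hK z hz) (hw3.trans (hKψ z hz).symm)
        rw [mem_preimage, ← this]; exact hw1
    rw [this]
    exact (hk.comp_continuousOn hψ.continuousOn).isOpen_inter_preimage hΩ
      (hop _ inter_subset_right (ht.inter hΩ))
  refine ⟨G, G', hcont g G hg hGm hG, hcont g' G' hg' hG'm hG', hGm, hG'm, ?_, ?_, hG⟩
  · intro z hz
    refine hinj (hGm _ (hG'm z hz)) hz ?_
    rw [hG _ (hG'm z hz), hG' z hz, hgg']
  · intro z hz
    refine hinj (hG'm _ (hGm z hz)) hz ?_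
    rw [hG' _ (hGm z hz), hG z hz, hg'g]

theorem closure_component {X : Set ℂ} (hX : IsClosed X) (a : ℂ) :
    closure (connectedComponentIn Xᶜ a) ⊆ connectedComponentIn Xᶜ a ∪ X := by
  intro x hx
  by_contra hcon
  rw [mem_union, not_or] at hcon
  have hxX : x ∈ Xᶜ := hcon.2
  have ho : IsOpen (connectedComponentIn Xᶜ x) := hX.isOpen_compl.connectedComponentIn
  obtain ⟨y, hy1, hy2⟩ := mem_closure_iff.1 hx _ ho (mem_connectedComponentIn hxX)
  have e1 := connectedComponentIn_eq hy1
  have e2 := connectedComponentIn_eq hy2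
  exact hcon.1 (by rw [e2, ← e1]; exact mem_connectedComponentIn hxX)

/-- points far out in the disc are mapped near `X` where the displacement is bounded below -/
theorem disp_bound {X : Set ℂ} (hX : IsCompact X) {a : ℂ} {V φ ψ : ℂ → ℂ}
    (hb : Bornology.IsBounded (connectedComponentIn Xᶜ a))
    (hV : ContinuousOn V {0}ᶜ) (hX0 : (0 : ℂ) ∉ X) (hVX : ∀ u ∈ X, V u ≠ 0)
    (hφ : ContinuousOn φ (connectedComponentIn Xᶜ a))
    (hφm : MapsTo φ (connectedComponentIn Xᶜ a) (Metric.ball 0 1))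
    (hψm : MapsTo ψ (Metric.ball 0 1) (connectedComponentIn Xᶜ a))
    (hφψ : ∀ w ∈ Metric.ball (0 : ℂ) 1, φ (ψ w) = w)
    {c r' : ℝ} (hc : 0 < c) (hr' : r' < 1) (h0 : ∀ z : ℂ, ‖z‖ < 1 → ‖ψ z‖ < c → ‖z‖ < r') :
    ∃ r1 < 1, ∃ δ > 0, ∀ z : ℂ, r1 < ‖z‖ → ‖z‖ < 1 → 2 * δ ≤ ‖V (ψ z)‖ := by
  have hX1 : X ⊆ {0}ᶜ := fun u hu h => hX0 (by rw [mem_singleton_iff] at h; rwa [← h])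
  obtain ⟨δ, hδ, hδX⟩ : ∃ δ > 0, ∀ u ∈ X, 2 * δ < ‖V u‖ := by
    rcases X.eq_empty_or_nonempty with rfl | hne
    · exact ⟨1, one_pos, by simp⟩
    obtain ⟨u, hu, hmin⟩ := hX.exists_isMinOn hne (hV.mono hX1).norm
    have hpos : 0 < ‖V u‖ := norm_pos_iff.2 (hVX u hu)
    refine ⟨‖V u‖ / 4, by positivity, fun v hv => ?_⟩
    have : ‖V u‖ ≤ ‖V v‖ := hmin hv
    linarith
  set D := connectedComponentIn Xᶜ a with hD
  set P := closure D ∩ {u | c ≤ ‖u‖} with hP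
  have hPc : IsCompact P := hb.isCompact_closure.inter_right (isClosed_le continuous_const continuous_norm)
  have hP1 : P ⊆ {0}ᶜ := by
    rintro u ⟨_, hu⟩ h
    rw [mem_singleton_iff] at h
    subst h
    simp only [mem_ofPred_eq, norm_zero] at hu
    linarith
  set Q := P ∩ (fun u => ‖V u‖) ⁻¹' Iic (2 * δ) with hQ
  have hQc : IsCompact Q := by
    refine hPc.of_isClosed_subset ?_ inter_subset_left
    exact (hV.mono hP1).norm.preimage_isClosed_of_isClosed hPc.isClosed isClosed_Iic
  have hQD : Q ⊆ D := by
    rintro u ⟨⟨hu1, _⟩, hu2⟩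
    rcases closure_component hX.isClosed a hu1 with h | h
    · exact h
    · have h3 := hδX u h
      rw [mem_preimage, mem_Iic] at hu2
      linarith
  have him : IsCompact (φ '' Q) := hQc.image_of_continuousOn (hφ.mono hQD)
  obtain ⟨r0, hr0, hr0Q⟩ : ∃ r0 < 1, ∀ w ∈ φ '' Q, ‖w‖ ≤ r0 := by
    rcases (φ '' Q).eq_empty_or_nonempty with he | hne
    · exact ⟨0, one_pos, by simp [he]⟩
    obtain ⟨w, hw, hmax⟩ := him.exists_isMaxOn hne continuous_norm.continuousOn
    refine ⟨‖w‖, ?_, fun v hv => hmax hv⟩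
    obtain ⟨u, hu, rfl⟩ := hw
    simpa using hφm (hQD hu)
  refine ⟨max r0 r', max_lt hr0 hr', δ, hδ, fun z hz hz1 => ?_⟩
  by_contra hcon
  push Not at hcon
  have hzb : z ∈ Metric.ball (0 : ℂ) 1 := by simpa using hz1
  have : ψ z ∈ Q := by
    refine ⟨⟨subset_closure (hψm hzb), ?_⟩, hcon.le⟩
    by_contra hlt
    rw [mem_ofPred_eq, not_le] at hlt
    exact absurd (h0 z hz1 hlt) (not_lt.2 ((le_max_right _ _).trans hz.le))
  have h2 := hr0Q _ ⟨_, this, rfl⟩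
  rw [hφψ z hzb] at h2
  exact absurd h2 (not_le.2 ((le_max_left _ _).trans_lt hz))

theorem deriv_ne_of_left_inv {ψ φ : ℂ → ℂ} {z : ℂ} (hψ : DifferentiableAt ℂ ψ z)
    (hφ : DifferentiableAt ℂ φ (ψ z)) {k : ℂ → ℂ} (hk : deriv k z ≠ 0) (h : ∀ᶠ w in 𝓝 z, φ (ψ w) = k w) :
    deriv ψ z ≠ 0 := by
  intro h0
  have h1 := (hφ.hasDerivAt.comp z hψ.hasDerivAt).deriv
  rw [h0, mul_zero] at h1
  have h2 : (φ ∘ ψ) =ᶠ[𝓝 z] k := h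
  rw [h2.deriv_eq] at h1
  exact hk h1

theorem factor {ψ : ℂ → ℂ} (hψ : DifferentiableOn ℂ ψ (Metric.ball 0 1))
    (hinj : InjOn ψ (Metric.ball 0 1)) (hd : deriv ψ 0 ≠ 0) :
    ∃ l : ℂ → ℂ, DifferentiableOn ℂ l (Metric.ball 0 1) ∧
      ∀ z ∈ Metric.ball (0 : ℂ) 1, ψ z - ψ 0 = z * Complex.exp (l z) := by
  have h0 : (0 : ℂ) ∈ Metric.ball (0 : ℂ) 1 := by simp
  have hds : DifferentiableOn ℂ (dslope ψ 0) (Metric.ball 0 1) :=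
    (Complex.differentiableOn_dslope (Metric.isOpen_ball.mem_nhds h0)).2 hψ
  have hmul : ∀ z, ψ z - ψ 0 = z * dslope ψ 0 z := fun z => by
    have := sub_smul_dslope ψ 0 z
    rw [← this, smul_eq_mul, sub_zero]
  have hne : ∀ z ∈ Metric.ball (0 : ℂ) 1, dslope ψ 0 z ≠ 0 := by
    intro z hz h
    by_cases hz0 : z = 0
    · subst hz0; rw [dslope_same] at h; exact hd h
    · have := hmul z
      rw [h, mul_zero, sub_eq_zero] at this
      exact hz0 (hinj hz h0 this)
  obtain ⟨l, hl, hl2⟩ := hasLog_of_convex (convex_ball (0 : ℂ) 1) Metric.isOpen_ball hds.continuousOn hne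
  refine ⟨l, log_differentiable Metric.isOpen_ball hds hl hl2, fun z hz => ?_⟩
  rw [hl2 z hz, hmul z]

end EEsec


section Finals
open Topology

/-- the displacement on the punctured plane -/
def VV (g : ℂ → ℂ) (u : ℂ) : ℂ := g (lg u) - lg u

/-- the dynamical data in the covering plane -/
structure GSys (g g' : ℂ → ℂ) (X : Set ℂ) : Prop where
  cg : Continuous g
  cg' : Continuous g'
  gg' : ∀ z, g (g' z) = z
  g'g : ∀ z, g' (g z) = z
  per : ∀ z, g (z + 1) = g z + 1
  area : ∀ S, IsOpen S → InjOn EE S → volume (g '' S) = volume S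
  Xc : IsCompact X
  Xconn : IsConnected X
  X0 : (0 : ℂ) ∉ X
  inv : ∀ z, EE z ∈ X → EE (g z) ∈ X
  inv' : ∀ z, EE z ∈ X → EE (g' z) ∈ X
  fix : ∀ z, EE z ∈ X → g z ≠ z

/-- a Riemann map -/
structure Riem (D : Set ℂ) (φ ψ : ℂ → ℂ) : Prop where
  dφ : DifferentiableOn ℂ φ D
  dψ : DifferentiableOn ℂ ψ (Metric.ball 0 1)
  mφ : MapsTo φ D (Metric.ball 0 1)
  mψ : MapsTo ψ (Metric.ball 0 1) D
  ψφ : ∀ z ∈ D, ψ (φ z) = z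
  φψ : ∀ w ∈ Metric.ball (0 : ℂ) 1, φ (ψ w) = w

theorem Riem.inj {D : Set ℂ} {φ ψ : ℂ → ℂ} (h : Riem D φ ψ) : InjOn ψ (Metric.ball 0 1) :=
  fun x hx y hy hxy => by rw [← h.φψ x hx, ← h.φψ y hy, hxy]

theorem Riem.deriv_ne {D : Set ℂ} {φ ψ : ℂ → ℂ} (h : Riem D φ ψ) (hD : IsOpen D) {z : ℂ}
    (hz : z ∈ Metric.ball (0 : ℂ) 1) : deriv ψ z ≠ 0 := by
  refine deriv_ne_of_left_inv (k := id) (h.dψ.differentiableAt (Metric.isOpen_ball.mem_nhds hz))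
    (h.dφ.differentiableAt (hD.mem_nhds (h.mψ hz))) (by simp) ?_
  filter_upwards [Metric.isOpen_ball.mem_nhds hz] with w hw using h.φψ w hw

variable {g g' : ℂ → ℂ} {X : Set ℂ}

theorem GSys.per' (h : GSys g g' X) (z : ℂ) : g' (z + 1) = g' z + 1 := by
  have := h.per (g' z)
  rw [h.gg'] at this
  rw [← this, h.g'g]

theorem GSys.perInt (h : GSys g g' X) (z : ℂ) (n : ℤ) : g (z + n) = g z + n := by
  have := (per_int (P := univ) (c := 1) (fun z => by simp) (fun z _ => h.per z) n z trivial).2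
  simpa using this

theorem GSys.perInt' (h : GSys g g' X) (z : ℂ) (n : ℤ) : g' (z + n) = g' z + n := by
  have := (per_int (P := univ) (c := 1) (fun z => by simp) (fun z _ => h.per' z) n z trivial).2
  simpa using this

theorem GSys.VV_spec (h : GSys g g' X) : ContinuousOn (VV g) {0}ᶜ ∧ ∀ z, VV g (EE z) = g z - z := by
  have := descend (h := fun z => g z - z) (S := {0}ᶜ) (fun u hu => hu)
    ((h.cg.sub continuous_id).continuousOn) (fun z _ => by rw [h.per]; ring)
  exact ⟨this.1, fun z => this.2 z (EE_ne z)⟩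

theorem GSys.VV_ne (h : GSys g g' X) : ∀ u ∈ X, VV g u ≠ 0 := by
  intro u hu
  have hu0 : u ≠ 0 := fun h0 => h.X0 (h0 ▸ hu)
  have e := EE_lg hu0
  rw [VV, sub_ne_zero]
  exact h.fix _ (by rw [e]; exact hu)

theorem GSys.riem (h : GSys g g' X) {a p : ℂ} (hb : Bornology.IsBounded (connectedComponentIn Xᶜ a))
    (hp : p ∈ connectedComponentIn Xᶜ a) :
    ∃ φ ψ, Riem (connectedComponentIn Xᶜ a) φ ψ ∧ ψ 0 = p := by
  obtain ⟨φ, ψ, h1, h2, h3, h4, h5, h6, _, h8⟩ := riemann_map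
    (h.Xc.isClosed.isOpen_compl.connectedComponentIn) isPreconnected_connectedComponentIn hb
    (logDomain_component h.Xc h.Xconn a hb) hp
  exact ⟨φ, ψ, ⟨h1, h2, h3, h4, h5, h6⟩, h8⟩

theorem half_final (h : GSys g g' X) (hb : Bornology.IsBounded (connectedComponentIn Xᶜ 0))
    (hU : ∀ z, EE z ∈ connectedComponentIn Xᶜ 0 → EE (g z) ∈ connectedComponentIn Xᶜ 0)
    (hU' : ∀ z, EE z ∈ connectedComponentIn Xᶜ 0 → EE (g' z) ∈ connectedComponentIn Xᶜ 0) :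
    ∃ φ ψ, Riem (connectedComponentIn Xᶜ 0) φ ψ ∧ ψ 0 = 0 ∧ ∃ r2 < 1,
      (∀ r, r2 < r → 0 < r → r < 1 → HasLog (fun z => VV g (ψ z)) (Metric.sphere 0 r)) ∧
      ∀ z : ℂ, r2 < ‖z‖ → ‖z‖ < 1 → VV g (ψ z) ≠ 0 := by
  obtain ⟨hVc, hVE⟩ := h.VV_spec
  set U := connectedComponentIn Xᶜ 0 with hUdef
  have hUo : IsOpen U := h.Xc.isClosed.isOpen_compl.connectedComponentIn
  obtain ⟨φ, ψ, hR, hψ0⟩ := h.riem hb (mem_connectedComponentIn (F := Xᶜ) h.X0)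
  have h0b : (0 : ℂ) ∈ Metric.ball (0 : ℂ) 1 := by simp
  refine ⟨φ, ψ, hR, hψ0, ?_⟩
  obtain ⟨l, hl, hl2⟩ := factor hR.dψ hR.inj (hR.deriv_ne hUo h0b)
  rw [hψ0] at hl2
  obtain ⟨c, hc, hc2⟩ : ∃ c > 0, ∀ z : ℂ, ‖z‖ < 1 → ‖ψ z‖ < c → ‖z‖ < 1 / 2 := by
    have hsub : Metric.ball (0 : ℂ) (1 / 2) ⊆ Metric.ball 0 1 := Metric.ball_subset_ball (by norm_num)
    have ho := open_image Metric.isOpen_ball (convex_ball (0 : ℂ) 1).isPreconnected hR.dψ hR.inj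
      _ hsub Metric.isOpen_ball
    obtain ⟨c, hc, hcs⟩ := Metric.isOpen_iff.1 ho 0 ⟨0, by simp, hψ0⟩
    refine ⟨c, hc, fun z hz hz2 => ?_⟩
    obtain ⟨y, hy, hyz⟩ := hcs (show ψ z ∈ Metric.ball 0 c by simpa using hz2)
    have := hR.inj (hsub hy) (by simpa using hz) hyz
    rw [← this]; simpa using hy
  obtain ⟨r1, hr1, δ, hδ, hdisp⟩ := disp_bound h.Xc hb hVc h.X0 h.VV_ne hR.dφ.continuousOn hR.mφ hR.mψ
    hR.φψ hc (by norm_num : (1 / 2 : ℝ) < 1) hc2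
  set r3 := max r1 (1 / 2) with hr3
  have hr31 : r3 < 1 := max_lt hr1 (by norm_num)
  set R := min (1 / 2) ((1 - r3) / (2 * Real.pi)) with hRdef
  have hpi := Real.pi_pos
  have hR0 : 0 < R := lt_min (by norm_num) (div_pos (by linarith) (by positivity))
  have hRhalf : R ≤ 1 / 2 := min_le_left _ _
  have hEb : ∀ w : ℂ, w.im < R → r3 < ‖EE w‖ := by
    intro w hw
    rw [EE_norm]
    have h1 := Real.add_one_le_exp (-(2 * Real.pi * w.im))
    have h2 : R ≤ (1 - r3) / (2 * Real.pi) := min_le_right _ _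
    rw [le_div_iff₀ (by positivity)] at h2
    nlinarith
  set Ω : Set ℂ := {z | 0 < z.im} with hΩ
  have hΩo : IsOpen Ω := isOpen_lt continuous_const Complex.continuous_im
  have hΩc : Convex ℝ Ω := convex_halfSpace_im_gt 0
  have hEm : ∀ w ∈ Ω, EE w ∈ Metric.ball (0 : ℂ) 1 := fun w hw => by
    rw [mem_ball_zero_iff]; exact EE_norm_lt_one.2 hw
  set Ψ : ℂ → ℂ := fun w => w + l (EE w) / (2 * Real.pi * Complex.I) with hΨ
  have hEΨ : ∀ w ∈ Ω, EE (Ψ w) = ψ (EE w) := by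
    intro w hw
    have := hl2 _ (hEm w hw)
    rw [sub_zero] at this
    rw [this, hΨ, EE_add]
    congr 1
    rw [EE, mul_div_cancel₀ _ Complex.two_pi_I_ne_zero]
  have hΨd : DifferentiableOn ℂ Ψ Ω :=
    differentiableOn_id.add ((hl.comp EE_diff.differentiableOn hEm).div_const _)
  have hΨper : ∀ z : ℂ, 0 < z.im → Ψ (z + 1) = Ψ z + 1 := by
    intro z _; simp only [hΨ, EE_add_one]; ring
  have hΨperI : ∀ n : ℤ, ∀ z : ℂ, Ψ (z + n) = Ψ z + n := by
    intro n z; simp only [hΨ, EE_add_int]; ring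
  have hΨinj : InjOn Ψ Ω := by
    intro z hz w hw hzw
    have h1 : ψ (EE z) = ψ (EE w) := by rw [← hEΨ z hz, ← hEΨ w hw, hzw]
    obtain ⟨n, hn⟩ := EE_eq.1 (hR.inj (hEm z hz) (hEm w hw) h1)
    rw [hn, hΨperI] at hzw
    rw [hn]
    have : (n : ℂ) = 0 := by linear_combination hzw
    rw [this, add_zero]
  have hΨder : ∀ z : ℂ, 0 < z.im → deriv Ψ z ≠ 0 := by
    intro z hz
    refine deriv_ne_of_left_inv (k := EE) (φ := fun w => φ (EE w)) (hΨd.differentiableAt (hΩo.mem_nhds hz)) ?_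
      (EE_deriv_ne z) ?_
    · refine DifferentiableAt.comp _ (hR.dφ.differentiableAt (hUo.mem_nhds ?_)) EE_diff.differentiableAt
      rw [hEΨ z hz]; exact hR.mψ (hEm z hz)
    · filter_upwards [hΩo.mem_nhds hz] with w hw
      rw [hEΨ w hw, hR.φψ _ (hEm w hw)]
  have hΨsurj : ∀ z, EE z ∈ U → z ∈ Ψ '' Ω := by
    intro z hz
    have h1 := hR.ψφ _ hz
    have hne : φ (EE z) ≠ 0 := by
      intro h0; rw [h0, hψ0] at h1; exact EE_ne z h1.symm
    have h2 := EE_lg hne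
    set w := lg (φ (EE z)) with hw
    have hwΩ : w ∈ Ω := by
      have := hR.mφ hz
      rw [← h2, mem_ball_zero_iff] at this
      exact EE_norm_lt_one.1 this
    have h3 : EE z = EE (Ψ w) := by rw [hEΨ w hwΩ, h2, h1]
    obtain ⟨n, hn⟩ := EE_eq.1 h3
    refine ⟨w + n, ?_, ?_⟩
    · rw [hΩ, mem_ofPred_eq] at hwΩ ⊢; simpa using hwΩ
    · rw [hΨperI, hn]
  have hEU : ∀ w ∈ Ω, EE (Ψ w) ∈ U := fun w hw => by rw [hEΨ w hw]; exact hR.mψ (hEm w hw)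
  obtain ⟨G, G', cG, cG', mG, mG', hGG', hG'G, hGΨ⟩ := conj_map hΩo hΩc.isPreconnected hΨd hΨinj h.cg h.cg'
    h.gg' h.g'g (fun z hz => hΨsurj _ (hU _ (hEU z hz))) (fun z hz => hΨsurj _ (hU' _ (hEU z hz)))
  have hop := open_image hΩo hΩc.isPreconnected hΨd hΨinj
  have hEinj : ∀ t : ℝ, ∀ ρ ≤ R, InjOn EE (Ψ '' (Ω ∩ Metric.ball (t : ℂ) ρ)) := by
    rintro t ρ hρ _ ⟨z, ⟨hz1, hz2⟩, rfl⟩ _ ⟨w, ⟨hw1, hw2⟩, rfl⟩ hzw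
    rw [hEΨ z hz1, hEΨ w hw1] at hzw
    obtain ⟨n, hn⟩ := EE_eq.1 (hR.inj (hEm z hz1) (hEm w hw1) hzw)
    have h1 : ‖(n : ℂ)‖ < 1 := by
      have : (n : ℂ) = (z - t) - (w - t) := by rw [hn]; ring
      rw [this]
      rw [Metric.mem_ball, dist_eq_norm] at hz2 hw2
      exact (norm_sub_le _ _).trans_lt (by linarith)
    rw [Complex.norm_intCast] at h1
    have h2 : n = 0 := by
      have : |n| < 1 := by exact_mod_cast h1
      exact Int.abs_lt_one_iff.1 this
    rw [hn, h2]; simp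
  have himR : ∀ t : ℝ, ∀ z ∈ Metric.ball (t : ℂ) R, z.im < R := by
    intro t z hz
    rw [Metric.mem_ball, dist_eq_norm] at hz
    have := Complex.abs_im_le_norm (z - t)
    simp only [Complex.sub_im, Complex.ofReal_im, sub_zero] at this
    exact (le_abs_self _).trans_lt (this.trans_lt hz)
  have hΩb : ∀ (t ρ : ℝ), IsOpen (Ω ∩ Metric.ball (t : ℂ) ρ) := fun t ρ => hΩo.inter Metric.isOpen_ball
  have hVG : ∀ z ∈ Ω, Ψ (G z) - Ψ z = VV g (ψ (EE z)) := by
    intro z hz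
    rw [hGΨ z hz, ← hEΨ z hz, hVE]
  obtain ⟨C, hC⟩ := hb.exists_norm_le
  obtain ⟨η2, hη2, hlog⟩ := half_index (R := R) hΨd hΨinj hΨder hΨper hR0 (by linarith)
    (fun t => by
      refine vol_fin (c := c) (C := C) (hop _ inter_subset_left (hΩb t R)) (hEinj t R le_rfl) hc ?_ ?_
      · rintro _ ⟨z, hz, rfl⟩
        by_contra hcon
        rw [not_le, hEΨ z hz.1] at hcon
        have h1 := hc2 _ (by simpa using hEm z hz.1) hcon
        have h2 := hEb z (himR t z hz.2)
        have h3 : 1 / 2 ≤ r3 := le_max_right _ _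
        linarith
      · rintro _ ⟨z, hz, rfl⟩
        exact hC _ (hEU z hz.1))
    cG cG' mG mG' hGG' hG'G
    (fun z hz => by
      have hz1 : z + 1 ∈ Ω := by rw [hΩ, mem_ofPred_eq]; simpa using hz
      have hGz : G z + 1 ∈ Ω := by
        have : 0 < (G z).im := mG hz
        rw [hΩ, mem_ofPred_eq]; simpa using this
      refine hΨinj (mG hz1) hGz ?_
      rw [hGΨ _ hz1, hΨper z hz, hΨper _ (mG hz), hGΨ z hz, h.per])
    (fun t ρ hρ => by
      have e : Ψ '' (G '' (Ω ∩ Metric.ball (t : ℂ) ρ)) = g '' (Ψ '' (Ω ∩ Metric.ball (t : ℂ) ρ)) := by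
        rw [image_image, image_image]
        exact image_congr fun z hz => hGΨ z hz.1
      rw [e]
      exact h.area _ (hop _ inter_subset_left (hΩb t ρ)) (hEinj t ρ hρ.2.le)) hδ
    (fun z hz hz2 => by
      rw [hVG z hz]
      exact hdisp _ ((le_max_left _ _).trans_lt (hEb z hz2)) (by simpa using hEm z hz))
  refine ⟨max (Real.exp (-(2 * Real.pi * η2))) r1, max_lt (Real.exp_lt_one_iff.2 (by
    have := mul_pos hpi hη2; nlinarith)) hr1, ?_, ?_⟩
  · intro r hr hr0 hr1'
    set η := -Real.log r / (2 * Real.pi) with hη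
    have hη0 : 0 < η := div_pos (by have := Real.log_neg hr0 hr1'; linarith) (by positivity)
    have hre : Real.exp (-(2 * Real.pi * η)) = r := by
      have : -(2 * Real.pi * η) = Real.log r := by rw [hη]; field_simp; try ring
      rw [this, Real.exp_log hr0]
    have hηlt : η < η2 := by
      have h1 := (le_max_left _ _).trans_lt hr
      rw [← hre, Real.exp_lt_exp] at h1
      nlinarith
    obtain ⟨l', hl'c, hl'e, hl'p⟩ := hlog η hη0 hηlt
    have hiff : ∀ z, EE z ∈ Metric.sphere (0 : ℂ) r ↔ z.im = η := by
      intro z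
      rw [mem_sphere_zero_iff_norm, EE_norm, ← hre, Real.exp_eq_exp]
      constructor
      · intro h1
        have h2 : 2 * Real.pi * z.im = 2 * Real.pi * η := by linarith
        exact mul_left_cancel₀ (by positivity) h2
      · intro h1; rw [h1]
    have hpre : EE ⁻¹' Metric.sphere (0 : ℂ) r = {z | z.im = η} := by
      ext z; exact hiff z
    have hs0 : ∀ u ∈ Metric.sphere (0 : ℂ) r, u ≠ 0 := by
      rintro u hu rfl
      simp at hu
      exact hr0.ne hu
    obtain ⟨d1, d2⟩ := descend (h := l') hs0 (by rw [hpre]; exact hl'c) (fun z hz => hl'p z ((hiff z).1 hz))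
    refine ⟨_, d1, fun u hu => ?_⟩
    have hu2 := EE_lg (hs0 u hu)
    have him : (lg u).im = η := (hiff _).1 (by rw [hu2]; exact hu)
    have hmem : lg u ∈ Ω := by rw [hΩ, mem_ofPred_eq, him]; exact hη0
    beta_reduce
    rw [hl'e _ him, hVG _ hmem, hu2]
  · intro z hz hz1 h0
    have := hdisp z ((le_max_right _ _).trans_lt hz) hz1
    rw [h0, norm_zero] at this
    linarith

end Finals


section DiscFinal
open Topology

variable {g g' : ℂ → ℂ} {X : Set ℂ}

theorem GSys.invc (h : GSys g g' X) (z : ℂ) (hz : EE z ∉ X) : EE (g z) ∉ X := fun hc => by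
  have := h.inv' _ hc
  rw [h.g'g] at this
  exact hz this

theorem GSys.invc' (h : GSys g g' X) (z : ℂ) (hz : EE z ∉ X) : EE (g' z) ∉ X := fun hc => by
  have := h.inv _ hc
  rw [h.gg'] at this
  exact hz this

theorem sec_inv {k s : ℂ → ℂ} (hk : Continuous k) (hkX : ∀ z, EE z ∉ X → EE (k z) ∉ X) {a p : ℂ}
    (hs : ContinuousOn s (connectedComponentIn Xᶜ a))
    (hsE : ∀ u ∈ connectedComponentIn Xᶜ a, EE (s u) = u)
    (hp : p ∈ connectedComponentIn Xᶜ a) (hkp : k (s p) ∈ s '' connectedComponentIn Xᶜ a) :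
    ∀ u ∈ connectedComponentIn Xᶜ a, k (s u) ∈ s '' connectedComponentIn Xᶜ a := by
  set D := connectedComponentIn Xᶜ a with hD
  have hDc : IsPreconnected D := isPreconnected_connectedComponentIn
  have hc1 : ContinuousOn (fun u => k (s u)) D := hk.comp_continuousOn hs
  have hc2 : ContinuousOn (fun u => EE (k (s u))) D := EE_cont.comp_continuousOn hc1
  have hDX : D ⊆ Xᶜ := connectedComponentIn_subset _ _
  have hpD : EE (k (s p)) ∈ D := by
    obtain ⟨q, hq, hqe⟩ := hkp
    rw [← hqe, hsE q hq]; exact hq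
  have hm : ∀ u ∈ D, EE (k (s u)) ∈ D := by
    have h1 : (fun u => EE (k (s u))) '' D ⊆ Xᶜ := by
      rintro _ ⟨u, hu, rfl⟩
      refine hkX _ ?_
      rw [hsE u hu]; exact hDX hu
    have h2 := (hDc.image _ hc2).subset_connectedComponentIn (mem_image_of_mem _ hp) h1
    have h3 := connectedComponentIn_eq hpD
    intro u hu
    rw [hD, h3]
    exact h2 (mem_image_of_mem _ hu)
  obtain ⟨m, hm2⟩ := int_valued_const (f := fun u => k (s u) - s (EE (k (s u)))) hDc
    (hc1.sub (hs.comp hc2 hm)) (by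
      intro u hu
      obtain ⟨n, hn⟩ := EE_eq.1 (hsE _ (hm u hu)).symm
      exact ⟨n, by beta_reduce; linear_combination hn⟩)
  have hm0 : (m : ℂ) = 0 := by
    obtain ⟨q, hq, hqe⟩ := hkp
    have := hm2 p hp
    beta_reduce at this
    rw [← this, ← hqe, hsE q hq, sub_self]
  intro u hu
  refine ⟨_, hm u hu, ?_⟩
  have := hm2 u hu
  beta_reduce at this
  rw [hm0] at this
  linear_combination -this

theorem disc_final (h : GSys g g' X) {a : ℂ} (hb : Bornology.IsBounded (connectedComponentIn Xᶜ a))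
    (h0 : (0 : ℂ) ∉ connectedComponentIn Xᶜ a) {s : ℂ → ℂ}
    (hs : ContinuousOn s (connectedComponentIn Xᶜ a))
    (hsE : ∀ u ∈ connectedComponentIn Xᶜ a, EE (s u) = u) {p : ℂ}
    (hp : p ∈ connectedComponentIn Xᶜ a) (hgp : g (s p) ∈ s '' connectedComponentIn Xᶜ a) :
    ∃ φ ψ, Riem (connectedComponentIn Xᶜ a) φ ψ ∧ ∃ r2 < 1,
      (∀ r, r2 < r → 0 < r → r < 1 →
        HasLog (fun z => VV g (ψ z) / (ψ z - ψ 0)) (Metric.sphere 0 r)) ∧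
      ∀ z : ℂ, r2 < ‖z‖ → ‖z‖ < 1 → VV g (ψ z) ≠ 0 := by
  obtain ⟨hVc, hVE⟩ := h.VV_spec
  set D := connectedComponentIn Xᶜ a with hD
  have hDo : IsOpen D := h.Xc.isClosed.isOpen_compl.connectedComponentIn
  have hg1 := sec_inv h.cg h.invc hs hsE hp hgp
  have hg2 : ∀ u ∈ D, g' (s u) ∈ s '' D := by
    obtain ⟨q, hq, hqe⟩ := hgp
    refine sec_inv h.cg' h.invc' hs hsE hq ⟨p, hp, ?_⟩
    rw [hqe, h.g'g]
  have hsd : DifferentiableOn ℂ s D := by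
    have h1 := log_differentiable (l := fun u => 2 * Real.pi * Complex.I * s u) hDo differentiableOn_id
      (continuousOn_const.mul hs) hsE
    refine (h1.div_const (2 * Real.pi * Complex.I)).congr fun u hu => ?_
    rw [mul_div_cancel_left₀ _ Complex.two_pi_I_ne_zero]
  obtain ⟨φ, ψ, hR, hψ0⟩ := h.riem hb hp
  have h0b : (0 : ℂ) ∈ Metric.ball (0 : ℂ) 1 := by simp
  refine ⟨φ, ψ, hR, ?_⟩
  obtain ⟨l, hl, hl2⟩ := factor hR.dψ hR.inj (hR.deriv_ne hDo h0b)
  obtain ⟨c, hc, hcs⟩ := Metric.isOpen_iff.1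
    (h.Xc.isClosed.isOpen_compl.connectedComponentIn (x := (0 : ℂ))) 0 (mem_connectedComponentIn h.X0)
  have hcD : ∀ u ∈ D, c ≤ ‖u‖ := by
    intro u hu
    by_contra hcon
    rw [not_le] at hcon
    have h1 := hcs (show u ∈ Metric.ball 0 c by simpa using hcon)
    have e1 := connectedComponentIn_eq h1
    have e2 := connectedComponentIn_eq hu
    apply h0
    rw [hD, e2, ← e1]
    exact mem_connectedComponentIn h.X0
  obtain ⟨r1, hr1, δ, hδ, hdisp⟩ := disp_bound h.Xc hb hVc h.X0 h.VV_ne hR.dφ.continuousOn hR.mφ hR.mψ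
    hR.φψ hc (by norm_num : (1 / 2 : ℝ) < 1) (fun z hz hz2 =>
      absurd hz2 (not_lt.2 (hcD _ (hR.mψ (by simpa using hz)))))
  set Ψ : ℂ → ℂ := fun z => s (ψ z) with hΨ
  have hΨd : DifferentiableOn ℂ Ψ (Metric.ball 0 1) := hsd.comp hR.dψ hR.mψ
  have hEΨ : ∀ z ∈ Metric.ball (0 : ℂ) 1, EE (Ψ z) = ψ z := fun z hz => hsE _ (hR.mψ hz)
  have hΨinj : InjOn Ψ (Metric.ball 0 1) := fun x hx y hy hxy =>
    hR.inj hx hy (by rw [← hEΨ x hx, ← hEΨ y hy, hxy])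
  have hΨder : ∀ z ∈ Metric.ball (0 : ℂ) 1, deriv Ψ z ≠ 0 := by
    intro z hz
    refine deriv_ne_of_left_inv (k := id) (φ := fun w => φ (EE w))
      (hΨd.differentiableAt (Metric.isOpen_ball.mem_nhds hz)) ?_ (by simp) ?_
    · refine DifferentiableAt.comp _ (hR.dφ.differentiableAt (hDo.mem_nhds ?_)) EE_diff.differentiableAt
      rw [hEΨ z hz]; exact hR.mψ hz
    · filter_upwards [Metric.isOpen_ball.mem_nhds hz] with w hw
      rw [hEΨ w hw, hR.φψ _ hw]; rfl
  have hsurj : ∀ z ∈ s '' D, z ∈ Ψ '' Metric.ball 0 1 := by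
    rintro _ ⟨u, hu, rfl⟩
    exact ⟨φ u, hR.mφ hu, by rw [hΨ]; beta_reduce; rw [hR.ψφ u hu]⟩
  obtain ⟨G, G', cG, cG', mG, mG', hGG', hG'G, hGΨ⟩ := conj_map Metric.isOpen_ball
    (convex_ball (0 : ℂ) 1).isPreconnected hΨd hΨinj h.cg h.cg'
    h.gg' h.g'g (fun z hz => hsurj _ (hg1 _ (hR.mψ hz))) (fun z hz => hsurj _ (hg2 _ (hR.mψ hz)))
  have hop := open_image Metric.isOpen_ball (convex_ball (0 : ℂ) 1).isPreconnected hΨd hΨinj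
  have hEinj : InjOn EE (Ψ '' Metric.ball 0 1) := by
    rintro _ ⟨z, hz, rfl⟩ _ ⟨w, hw, rfl⟩ hzw
    rw [hEΨ z hz, hEΨ w hw] at hzw
    rw [hR.inj hz hw hzw]
  obtain ⟨C, hC⟩ := hb.exists_norm_le
  have hVG : ∀ z ∈ Metric.ball (0 : ℂ) 1, Ψ (G z) - Ψ z = VV g (ψ z) := by
    intro z hz
    rw [hGΨ z hz, ← hEΨ z hz, hVE]
  obtain ⟨r2, hr2, hlog⟩ := disc_index hΨd hΨinj hΨder
    (by
      refine vol_fin (c := c) (C := C) (hop _ subset_rfl Metric.isOpen_ball) hEinj hc ?_ ?_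
      · rintro _ ⟨z, hz, rfl⟩
        rw [hEΨ z hz]; exact hcD _ (hR.mψ hz)
      · rintro _ ⟨z, hz, rfl⟩
        rw [hEΨ z hz]; exact hC _ (hR.mψ hz))
    cG cG' mG mG' hGG' hG'G
    (fun S hS hSo => by
      have e : Ψ '' (G '' S) = g '' (Ψ '' S) := by
        rw [image_image, image_image]
        exact image_congr fun z hz => hGΨ z (hS hz)
      rw [e]
      exact h.area _ (hop _ hS hSo) (hEinj.mono (image_mono hS))) hr1 hδ
    (fun z hz hz1 => by
      rw [hVG z (by simpa using hz1)]
      exact hdisp z hz hz1)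
  refine ⟨max r2 r1, max_lt hr2 hr1, ?_, ?_⟩
  · intro r hr hr0 hr1'
    have hsb : Metric.sphere (0 : ℂ) r ⊆ Metric.ball 0 1 := fun z hz => by
      rw [mem_sphere_zero_iff_norm] at hz
      rw [mem_ball_zero_iff, hz]; exact hr1'
    have h1 := hlog r ((le_max_left _ _).trans_lt hr) hr0 hr1'
    have h2 : HasLog (fun z => Complex.exp (l z)) (Metric.sphere 0 r) :=
      ⟨l, hl.continuousOn.mono hsb, fun _ _ => rfl⟩
    refine (h1.div h2).congr fun z hz => ?_
    beta_reduce
    rw [hVG z (hsb hz), hl2 z (hsb hz), div_div]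
  · intro z hz hz1 h0
    have := hdisp z ((le_max_right _ _).trans_lt hz) hz1
    rw [h0, norm_zero] at this
    linarith

end DiscFinal


section CoreTop
open Topology

theorem fill_finset {ι : Type*} [DecidableEq ι] (J : Finset ι) {B O : ι → Set ℂ} {R : Set ℂ} (hR : IsClosed R)
    (hB : ∀ j ∈ J, IsClosed (B j)) (hO : ∀ j ∈ J, IsOpen (O j)) (hOB : ∀ j ∈ J, O j ⊆ B j)
    (hdis : ∀ i ∈ J, ∀ j ∈ J, i ≠ j → Disjoint (B i) (B j)) (hBR : ∀ j ∈ J, B j ⊆ R) :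
    ∀ f : ℂ → ℂ, ContinuousOn f (R \ ⋃ j ∈ J, O j) → (∀ z ∈ R \ ⋃ j ∈ J, O j, f z ≠ 0) →
    (∀ j ∈ J, HasLog f (B j \ O j)) →
    ∃ W : ℂ → ℂ, ContinuousOn W R ∧ (∀ z ∈ R, W z ≠ 0) ∧ ∀ z ∈ R \ ⋃ j ∈ J, O j, W z = f z := by
  induction J using Finset.induction_on with
  | empty =>
    intro f hf h0 _
    refine ⟨f, by simpa using hf, by simpa using h0, fun _ _ => rfl⟩
  | insert a J ha ih =>
    intro f hf h0 hl
    set A := R \ ⋃ j ∈ insert a J, O j with hA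
    have hAc : IsClosed A := by
      rw [hA, diff_eq]
      exact hR.inter (isOpen_biUnion fun j hj => hO j hj).isClosed_compl
    have hsub : ∀ j ∈ insert a J, B j \ O j ⊆ A := by
      intro j hj z hz
      refine ⟨hBR j hj hz.1, fun hc => ?_⟩
      obtain ⟨i, hi, hzi⟩ := mem_iUnion₂.1 hc
      by_cases hij : i = j
      · rw [hij] at hzi; exact hz.2 hzi
      · exact (hdis i hi j hj hij).le_bot ⟨hOB i hi hzi, hz.1⟩
    have haM : a ∈ insert a J := Finset.mem_insert_self a J
    have hAB : A ∩ B a ⊆ B a \ O a := fun z hz =>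
      ⟨hz.2, fun h => hz.1.2 (mem_iUnion₂.2 ⟨a, haM, h⟩)⟩
    obtain ⟨f', hf', h0', he⟩ := fill_lemma hAc (hB a haM) hf h0 ((hl a haM).mono hAB)
    have hs2 : R \ ⋃ j ∈ J, O j ⊆ A ∪ B a := by
      intro z hz
      by_cases hza : z ∈ O a
      · exact Or.inr (hOB a haM hza)
      · refine Or.inl ⟨hz.1, fun hc => ?_⟩
        obtain ⟨i, hi, hzi⟩ := mem_iUnion₂.1 hc
        rcases Finset.mem_insert.1 hi with rfl | hi
        · exact hza hzi
        · exact hz.2 (mem_iUnion₂.2 ⟨i, hi, hzi⟩)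
    have hins : ∀ {j}, j ∈ J → j ∈ insert a J := fun hj => Finset.mem_insert_of_mem hj
    obtain ⟨W, hW, hW0, hWe⟩ := ih (fun j hj => hB j (hins hj)) (fun j hj => hO j (hins hj))
      (fun j hj => hOB j (hins hj)) (fun i hi j hj => hdis i (hins hi) j (hins hj))
      (fun j hj => hBR j (hins hj)) f' (hf'.mono hs2) (fun z hz => h0' z (hs2 hz))
      (fun j hj => (hl j (hins hj)).congr fun z hz => (he z (hsub j (hins hj) hz)).symm)
    refine ⟨W, hW, hW0, fun z hz => ?_⟩
    rw [hWe z, he z hz]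
    refine ⟨hz.1, fun hc => hz.2 ?_⟩
    obtain ⟨i, hi, hzi⟩ := mem_iUnion₂.1 hc
    exact mem_iUnion₂.2 ⟨i, hins hi, hzi⟩

theorem core_top {ι : Type*} [DecidableEq ι] (J : Finset ι) {V : ℂ → ℂ} {B O : ι → Set ℂ} {q : ι → ℂ}
    {B2 O2 : Bool → Set ℂ} (hV : ContinuousOn V {0}ᶜ)
    (hB : ∀ j ∈ J, IsClosed (B j)) (hO : ∀ j ∈ J, IsOpen (O j)) (hOB : ∀ j ∈ J, O j ⊆ B j)
    (hdis : ∀ i ∈ J, ∀ j ∈ J, i ≠ j → Disjoint (B i) (B j))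
    (hB2 : ∀ j, IsClosed (B2 j)) (hO2 : ∀ j, IsOpen (O2 j)) (hOB2 : ∀ j, O2 j ⊆ B2 j)
    (hdis2 : Disjoint (B2 true) (B2 false)) (hdis3 : ∀ i, ∀ j ∈ J, Disjoint (B2 i) (B j))
    (h0 : 0 ∈ O2 true) (hq : ∀ j ∈ J, q j ∈ O j)
    (hne : ∀ u, (∀ i, u ∉ O2 i) → (∀ j ∈ J, u ∉ O j) → V u ≠ 0)
    (hl2 : ∀ i, HasLog V (B2 i \ O2 i))
    (hl : ∀ j ∈ J, HasLog (fun u => V u / (u - q j)) (B j \ O j))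
    (hlq : ∀ i ∈ J, ∀ j ∈ J, i ≠ j → HasLog (fun u => u - q i) (B j)) :
    HasLog (fun u => ∏ j ∈ J, (u - q j)) (B2 false \ O2 false) := by
  classical
  set R : Set ℂ := (⋃ j ∈ J, O j)ᶜ with hR
  have hRc : IsClosed R := (isOpen_biUnion fun j hj => hO j hj).isClosed_compl
  have hRm : ∀ z, z ∈ R ↔ ∀ j ∈ J, z ∉ O j := by intro z; simp [hR]
  have hdiff : ∀ z, z ∈ R \ ⋃ i ∈ (Finset.univ : Finset Bool), O2 i ↔
      (∀ j ∈ J, z ∉ O j) ∧ ∀ i, z ∉ O2 i := by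
    intro z
    rw [mem_diff, hRm]; simp
  obtain ⟨V', hV'c, hV'0, hV'e⟩ := fill_finset (Finset.univ : Finset Bool) (B := B2) (O := O2) hRc
    (fun j _ => hB2 j) (fun j _ => hO2 j) (fun j _ => hOB2 j)
    (by
      intro i _ j _ hij
      cases i <;> cases j
      · exact absurd rfl hij
      · exact hdis2.symm
      · exact hdis2
      · exact absurd rfl hij)
    (by
      intro i _ z hz
      rw [hRm]
      intro j hj hzj
      exact (hdis3 i j hj).le_bot ⟨hz, hOB j hj hzj⟩) V
    (hV.mono fun z hz => by
      rw [mem_compl_singleton_iff]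
      rintro rfl
      exact ((hdiff 0).1 hz).2 true h0)
    (fun z hz => hne z ((hdiff z).1 hz).2 ((hdiff z).1 hz).1)
    (fun i _ => hl2 i)
  have hqne : ∀ z ∈ R, ∀ j ∈ J, z - q j ≠ 0 := by
    intro z hz j hj h
    rw [sub_eq_zero] at h
    exact (hRm z).1 hz j hj (h ▸ hq j hj)
  have hprod : ∀ z ∈ R, ∏ j ∈ J, (z - q j) ≠ 0 := fun z hz => Finset.prod_ne_zero_iff.2 (hqne z hz)
  have hRe : univ \ ⋃ j ∈ J, O j = R := by rw [hR, compl_eq_univ_diff]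
  have hBO : ∀ j ∈ J, ∀ z ∈ B j \ O j, z ∈ R := by
    intro j hj z hz
    rw [hRm]
    intro i hi hzi
    by_cases hij : i = j
    · rw [hij] at hzi; exact hz.2 hzi
    · exact (hdis i hi j hj hij).le_bot ⟨hOB i hi hzi, hz.1⟩
  have hB2m : ∀ i, ∀ z ∈ B2 i \ O2 i, (∀ j ∈ J, z ∉ O j) ∧ ∀ k, z ∉ O2 k := by
    intro i z hz
    refine ⟨fun j hj hzj => (hdis3 i j hj).le_bot ⟨hz.1, hOB j hj hzj⟩, fun k hk => ?_⟩
    have hkB := hOB2 k hk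
    cases i <;> cases k
    · exact hz.2 hk
    · exact hdis2.le_bot ⟨hkB, hz.1⟩
    · exact hdis2.le_bot ⟨hz.1, hkB⟩
    · exact hz.2 hk
  obtain ⟨W, hWc, hW0, hWe⟩ := fill_finset J (B := B) (O := O) isClosed_univ hB hO hOB hdis
    (fun _ _ => subset_univ _) (fun u => V' u / ∏ j ∈ J, (u - q j))
    (by
      rw [hRe]
      exact hV'c.div (by fun_prop) hprod)
    (by
      rw [hRe]
      exact fun z hz => div_ne_zero (hV'0 z hz) (hprod z hz))
    (by
      intro j hj
      have h1 := HasLog.prod (J.erase j) (f := fun i u => u - q i) (S := B j \ O j) (fun i hi =>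
        (hlq i (Finset.mem_of_mem_erase hi) j hj (Finset.ne_of_mem_erase hi)).mono diff_subset)
      refine ((hl j hj).div h1).congr fun z hz => ?_
      have e : V' z = V z := by
        refine hV'e z ((hdiff z).2 ⟨(hRm z).1 (hBO j hj z hz), fun i hi => ?_⟩)
        exact (hdis3 i j hj).le_bot ⟨hOB2 i hi, hz.1⟩
      rw [e, ← Finset.mul_prod_erase J _ hj, div_div])
  have hWl : HasLog W univ := hasLog_of_convex convex_univ isOpen_univ hWc hW0
  refine ((hl2 false).div (hWl.mono (subset_univ _))).congr fun z hz => ?_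
  have hz2 := hB2m false z hz
  have hzR := (hRm z).2 hz2.1
  have e1 := hWe z (by rw [hRe]; exact hzR)
  have e2 := hV'e z ((hdiff z).2 hz2)
  rw [e1, e2]
  have e3 := hne z hz2.2 hz2.1
  have e4 := hprod z hzR
  field_simp

theorem hasLog_pow_sphere {n : ℕ} {r : ℝ} (hr : 0 < r)
    (h : HasLog (fun z : ℂ => z ^ n) (Metric.sphere 0 r)) : n = 0 := by
  have hk : Continuous (fun t : ℝ => (r : ℂ) * Complex.exp (t * Complex.I)) := by fun_prop
  have hm : MapsTo (fun t : ℝ => (r : ℂ) * Complex.exp (t * Complex.I)) univ (Metric.sphere 0 r) := by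
    intro t _
    rw [mem_sphere_zero_iff_norm, norm_mul, Complex.norm_exp_ofReal_mul_I, mul_one, Complex.norm_real,
      Real.norm_eq_abs, abs_of_pos hr]
  obtain ⟨l, hl, hle⟩ := h
  have hrc : (r : ℂ) ≠ 0 := by exact_mod_cast hr.ne'
  obtain ⟨m, hm2⟩ := log_unique (l := fun t : ℝ => l ((r : ℂ) * Complex.exp (t * Complex.I)))
    (l' := fun t : ℝ => n * (Complex.log r + t * Complex.I)) isPreconnected_univ
    (hl.comp hk.continuousOn hm) (by fun_prop) (by
      intro t ht
      beta_reduce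
      rw [hle _ (hm ht), Complex.exp_nat_mul, Complex.exp_add, Complex.exp_log hrc])
  have e0 := hm2 0 trivial
  have e1 := hm2 (2 * Real.pi) trivial
  have e2 : Complex.exp ((2 * Real.pi : ℝ) * Complex.I) = Complex.exp ((0 : ℝ) * Complex.I) := by
    push_cast
    rw [Complex.exp_two_pi_mul_I, zero_mul, Complex.exp_zero]
  beta_reduce at e0 e1
  rw [e2, e0] at e1
  have e3 : (n : ℂ) * (2 * Real.pi * Complex.I) = 0 := by
    push_cast at e1
    linear_combination -e1
  rcases mul_eq_zero.1 e3 with h | h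
  · exact_mod_cast h
  · exact absurd h Complex.two_pi_I_ne_zero

/-- a disc inside a Riemann domain -/
theorem Riem.disc {D : Set ℂ} {φ ψ : ℂ → ℂ} (hR : Riem D φ ψ) {r : ℝ} (hr1 : r < 1) :
    IsCompact (ψ '' Metric.closedBall 0 r) ∧ IsOpen (ψ '' Metric.ball 0 r) ∧
    ψ '' Metric.ball 0 r ⊆ ψ '' Metric.closedBall 0 r ∧ ψ '' Metric.closedBall 0 r ⊆ D ∧
    (∀ u ∈ ψ '' Metric.closedBall 0 r \ ψ '' Metric.ball 0 r, ‖φ u‖ = r) ∧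
    (∀ u ∈ D, u ∉ ψ '' Metric.ball 0 r → r ≤ ‖φ u‖) := by
  have hcb : Metric.closedBall (0 : ℂ) r ⊆ Metric.ball 0 1 := Metric.closedBall_subset_ball hr1
  have hbb : Metric.ball (0 : ℂ) r ⊆ Metric.ball 0 1 := Metric.ball_subset_ball hr1.le
  have hlast : ∀ u ∈ D, u ∉ ψ '' Metric.ball 0 r → r ≤ ‖φ u‖ := by
    intro u hu hn
    by_contra hc
    rw [not_le] at hc
    exact hn ⟨φ u, by simpa using hc, hR.ψφ u hu⟩
  refine ⟨(isCompact_closedBall _ _).image_of_continuousOn (hR.dψ.continuousOn.mono hcb),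
    open_image Metric.isOpen_ball (convex_ball (0 : ℂ) 1).isPreconnected hR.dψ hR.inj _ hbb
      Metric.isOpen_ball, image_mono Metric.ball_subset_closedBall, ?_, ?_, hlast⟩
  · rintro _ ⟨z, hz, rfl⟩
    exact hR.mψ (hcb hz)
  · rintro _ ⟨⟨z, hz, rfl⟩, hn⟩
    refine le_antisymm ?_ (hlast _ (hR.mψ (hcb hz)) hn)
    rw [hR.φψ z (hcb hz)]
    simpa using hz

theorem Riem.hasLog {D : Set ℂ} {φ ψ : ℂ → ℂ} (hR : Riem D φ ψ) {r : ℝ} (hr1 : r < 1) {F : ℂ → ℂ}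
    (h : HasLog (fun z => F (ψ z)) (Metric.sphere 0 r)) :
    HasLog F (ψ '' Metric.closedBall 0 r \ ψ '' Metric.ball 0 r) := by
  obtain ⟨_, _, _, d4, d5, _⟩ := hR.disc hr1
  have h1 := h.comp (k := φ) (T := ψ '' Metric.closedBall 0 r \ ψ '' Metric.ball 0 r)
    (hR.dφ.continuousOn.mono fun u hu => d4 hu.1) (fun u hu => by
      rw [mem_sphere_zero_iff_norm]; exact d5 u hu)
  refine h1.congr fun u hu => ?_
  rw [hR.ψφ u (d4 hu.1)]

end CoreTop


section GlobalThm
open Topology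

variable {g g' : ℂ → ℂ} {X : Set ℂ}

theorem GSys.neg (h : GSys g g' X) :
    GSys (fun z => -g (-z)) (fun z => -g' (-z)) (Inv.inv ⁻¹' X) := by
  have hX : Inv.inv ⁻¹' X = Inv.inv '' X := by
    ext u
    constructor
    · intro hu; exact ⟨u⁻¹, hu, inv_inv u⟩
    · rintro ⟨v, hv, rfl⟩; rw [mem_preimage, inv_inv]; exact hv
  have hci : ContinuousOn (Inv.inv : ℂ → ℂ) X :=
    continuousOn_inv₀.mono fun u hu => by
      rw [mem_compl_singleton_iff]; rintro rfl; exact h.X0 hu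
  have hper := h.perInt
  refine ⟨by have := h.cg; fun_prop, by have := h.cg'; fun_prop, fun z => by simp [h.gg'],
    fun z => by simp [h.g'g], fun z => ?_, fun S hS hinj => ?_, ?_, ?_, ?_, ?_, ?_, ?_⟩
  · have := hper (-z) (-1)
    push_cast at this
    rw [neg_add, this]; ring
  · have e : (fun z => -g (-z)) '' S = -(g '' (-S)) := by
      rw [← image_neg_eq_neg, ← image_neg_eq_neg, image_image, image_image]
    rw [e, Measure.measure_neg, h.area, Measure.measure_neg]
    · exact hS.neg
    · intro z hz w hw hzw
      have := hinj hz hw (by rw [EE_neg, EE_neg, hzw])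
      exact neg_injective this
  · rw [hX]; exact h.Xc.image_of_continuousOn hci
  · rw [hX]; exact h.Xconn.image _ hci
  · rw [mem_preimage, inv_zero]; exact h.X0
  · intro z hz
    rw [mem_preimage, ← EE_neg] at hz
    have := h.inv _ hz
    rw [mem_preimage, ← EE_neg, neg_neg]; exact this
  · intro z hz
    rw [mem_preimage, ← EE_neg] at hz
    have := h.inv' _ hz
    rw [mem_preimage, ← EE_neg, neg_neg]; exact this
  · intro z hz hf
    rw [mem_preimage, ← EE_neg] at hz
    exact h.fix _ hz (by rw [← neg_neg (g (-z)), hf])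

theorem GSys.VV_inv (h : GSys g g' X) {u : ℂ} (hu : u ≠ 0) :
    VV (fun z => -g (-z)) u⁻¹ = - VV g u := by
  have e := EE_lg hu
  have h1 := h.VV_spec.2 (lg u)
  have h2 := h.neg.VV_spec.2 (-lg u)
  rw [EE_neg, e] at h2
  rw [e] at h1
  rw [h1, h2, neg_neg]; ring

theorem GSys.exists_sec (h : GSys g g' X) {a : ℂ}
    (hb : Bornology.IsBounded (connectedComponentIn Xᶜ a)) (h0 : (0 : ℂ) ∉ connectedComponentIn Xᶜ a) :
    ∃ s : ℂ → ℂ, ContinuousOn s (connectedComponentIn Xᶜ a) ∧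
      ∀ u ∈ connectedComponentIn Xᶜ a, EE (s u) = u := by
  obtain ⟨l, hl, hle⟩ := logDomain_component h.Xc h.Xconn a hb id continuousOn_id (fun z hz hz0 => by
    rw [id] at hz0; exact h0 (hz0 ▸ hz))
  refine ⟨fun u => l u / (2 * Real.pi * Complex.I), hl.div_const _, fun u hu => ?_⟩
  rw [EE, mul_div_cancel₀ _ Complex.two_pi_I_ne_zero, hle u hu]; rfl

/-- the data of a filled disc -/
theorem GSys.disc_pack (h : GSys g g' X) {a : ℂ} (hb : Bornology.IsBounded (connectedComponentIn Xᶜ a))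
    (h0 : (0 : ℂ) ∉ connectedComponentIn Xᶜ a) {s : ℂ → ℂ}
    (hs : ContinuousOn s (connectedComponentIn Xᶜ a))
    (hsE : ∀ u ∈ connectedComponentIn Xᶜ a, EE (s u) = u) {p : ℂ}
    (hp : p ∈ connectedComponentIn Xᶜ a) (hgp : g (s p) ∈ s '' connectedComponentIn Xᶜ a) :
    ∃ (B O : Set ℂ) (q : ℂ), IsClosed B ∧ IsOpen O ∧ O ⊆ B ∧ B ⊆ connectedComponentIn Xᶜ a ∧ q ∈ O ∧
      HasLog (fun u => VV g u / (u - q)) (B \ O) ∧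
      (∀ u ∈ connectedComponentIn Xᶜ a, u ∉ O → VV g u ≠ 0) ∧
      ∀ q', q' ∉ connectedComponentIn Xᶜ a → HasLog (fun u => u - q') B := by
  obtain ⟨φ, ψ, hR, r2, hr2, hl, hne⟩ := disc_final h hb h0 hs hsE hp hgp
  obtain ⟨r, hr, hr1⟩ := exists_between (max_lt hr2 one_pos)
  have hr0 := (le_max_right _ _).trans_lt hr
  have hrr := (le_max_left _ _).trans_lt hr
  obtain ⟨d1, d2, d3, d4, d5, d6⟩ := hR.disc hr1
  refine ⟨_, _, ψ 0, d1.isClosed, d2, d3, d4, ⟨0, by simpa using hr0, rfl⟩,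
    hR.hasLog hr1 (F := fun u => VV g u / (u - ψ 0)) (hl r hrr hr0 hr1), ?_, ?_⟩
  · intro u hu hn
    have := hne (φ u) (hrr.trans_le (d6 u hu hn)) (by simpa using hR.mφ hu)
    rwa [hR.ψφ u hu] at this
  · intro q' hq'
    refine (logDomain_component h.Xc h.Xconn a hb (fun u => u - q') (by fun_prop) ?_).mono d4
    intro z hz hz0
    rw [sub_eq_zero] at hz0
    exact hq' (hz0 ▸ hz)

theorem global_core (h : GSys g g' X) (hb0 : Bornology.IsBounded (connectedComponentIn Xᶜ 0))
    (hU : ∀ z, EE z ∈ connectedComponentIn Xᶜ 0 → EE (g z) ∈ connectedComponentIn Xᶜ 0)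
    (hU' : ∀ z, EE z ∈ connectedComponentIn Xᶜ 0 → EE (g' z) ∈ connectedComponentIn Xᶜ 0)
    (hb1 : Bornology.IsBounded (connectedComponentIn (Inv.inv ⁻¹' X)ᶜ 0))
    (hW : ∀ z, EE z ∈ connectedComponentIn (Inv.inv ⁻¹' X)ᶜ 0 →
      EE (-g (-z)) ∈ connectedComponentIn (Inv.inv ⁻¹' X)ᶜ 0)
    (hW' : ∀ z, EE z ∈ connectedComponentIn (Inv.inv ⁻¹' X)ᶜ 0 →
      EE (-g' (-z)) ∈ connectedComponentIn (Inv.inv ⁻¹' X)ᶜ 0)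
    (hdisj : ∀ u ∈ connectedComponentIn Xᶜ 0, u⁻¹ ∈ connectedComponentIn (Inv.inv ⁻¹' X)ᶜ 0 → u = 0)
    {p : ℂ} (hpX : p ∉ X) (hp0 : p ∉ connectedComponentIn Xᶜ 0)
    (hp1 : p⁻¹ ∉ connectedComponentIn (Inv.inv ⁻¹' X)ᶜ 0) {s : ℂ → ℂ}
    (hs : ContinuousOn s (connectedComponentIn Xᶜ p))
    (hsE : ∀ u ∈ connectedComponentIn Xᶜ p, EE (s u) = u)
    (hgp : g (s p) ∈ s '' connectedComponentIn Xᶜ p) : False := by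
  classical
  have hn := h.neg
  obtain ⟨hVc, hVE⟩ := h.VV_spec
  obtain ⟨φ0, ψ0, R0, hψ0, r0, hr0, hl0, hne0⟩ := half_final h hb0 hU hU'
  obtain ⟨φ1, ψ1, R1, hψ1, r1, hr1, hl1, hne1⟩ := half_final hn hb1 hW hW'
  set U := connectedComponentIn Xᶜ 0 with hUdef
  set Y := connectedComponentIn (Inv.inv ⁻¹' X)ᶜ 0 with hYdef
  have hUo : IsOpen U := h.Xc.isClosed.isOpen_compl.connectedComponentIn
  have hYo : IsOpen Y := hn.Xc.isClosed.isOpen_compl.connectedComponentIn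
  have h0U : (0 : ℂ) ∈ U := mem_connectedComponentIn h.X0
  have h0Y : (0 : ℂ) ∈ Y := mem_connectedComponentIn hn.X0
  set T : Set ℂ := {0}ᶜ ∩ Inv.inv ⁻¹' Y with hTdef
  have hTm : ∀ u, u ∈ T ↔ u ≠ 0 ∧ u⁻¹ ∈ Y := fun u => Iff.rfl
  have hTo : IsOpen T := continuousOn_inv₀.isOpen_inter_preimage isOpen_compl_singleton hYo
  have hUT : ∀ u ∈ U, u ∉ T := fun u hu hT => hT.1 (hdisj u hu hT.2)
  obtain ⟨c, hc, hcY⟩ := Metric.isOpen_iff.1 hYo 0 h0Y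
  have hbig : ∀ u ∉ T, ‖u‖ ≤ c⁻¹ := by
    intro u hu
    by_contra hcon
    rw [not_le] at hcon
    have hu0 : 0 < ‖u‖ := (inv_pos.2 hc).trans hcon
    refine hu ⟨norm_pos_iff.1 hu0, hcY ?_⟩
    rw [mem_ball_zero_iff, norm_inv]
    exact inv_lt_of_inv_lt₀ hc hcon
  have hcU : ∀ x ∉ U, Disjoint (connectedComponentIn Xᶜ x) U := by
    intro x hx
    rw [Set.disjoint_left]
    intro y hy hyU
    have hxX : x ∈ Xᶜ := by
      by_contra hcon
      rw [connectedComponentIn_eq_empty hcon] at hy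
      exact hy
    apply hx
    rw [hUdef, connectedComponentIn_eq hyU, ← connectedComponentIn_eq hy]
    exact mem_connectedComponentIn hxX
  have hcT : ∀ x ∉ U, x ∉ T → Disjoint (connectedComponentIn Xᶜ x) T := by
    intro x hx hxT
    rw [Set.disjoint_left]
    intro y hy hyT
    have hxX : x ∈ Xᶜ := by
      by_contra hcon
      rw [connectedComponentIn_eq_empty hcon] at hy
      exact hy
    have hn0 : ∀ w ∈ connectedComponentIn Xᶜ x, w ≠ 0 := by
      rintro w hw rfl
      exact (hcU x hx).le_bot ⟨hw, h0U⟩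
    have hpre : IsPreconnected (Inv.inv '' connectedComponentIn Xᶜ x) :=
      isPreconnected_connectedComponentIn.image _ (continuousOn_inv₀.mono fun w hw => hn0 w hw)
    have hsub := hpre.subset_connectedComponentIn (F := (Inv.inv ⁻¹' X)ᶜ) (mem_image_of_mem _ hy) (by
      rintro _ ⟨w, hw, rfl⟩
      rw [mem_compl_iff, mem_preimage, inv_inv]
      exact connectedComponentIn_subset _ _ hw)
    rw [← connectedComponentIn_eq hyT.2] at hsub
    have hxm := mem_connectedComponentIn hxX
    exact hxT ⟨hn0 x hxm, hsub (mem_image_of_mem _ hxm)⟩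
  have hcb : ∀ x ∉ U, x ∉ T → Bornology.IsBounded (connectedComponentIn Xᶜ x) := by
    intro x hx hxT
    rw [isBounded_iff_forall_norm_le]
    exact ⟨c⁻¹, fun u hu => hbig u fun hu2 => (hcT x hx hxT).le_bot ⟨hu, hu2⟩⟩
  have hc0 : ∀ x ∉ U, (0 : ℂ) ∉ connectedComponentIn Xᶜ x := fun x hx h0 => (hcU x hx).le_bot ⟨h0, h0U⟩
  set Z : Set ℂ := (U ∪ T)ᶜ ∩ VV g ⁻¹' {0} with hZ
  have hZcl : IsClosed Z := by
    refine ContinuousOn.preimage_isClosed_of_isClosed (hVc.mono ?_) (hUo.union hTo).isClosed_compl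
      isClosed_singleton
    rintro u hu rfl
    exact hu (Or.inl h0U)
  have hZc : IsCompact Z := by
    refine Metric.isCompact_of_isClosed_isBounded hZcl ?_
    rw [isBounded_iff_forall_norm_le]
    exact ⟨c⁻¹, fun u hu => hbig u fun hu2 => hu.1 (Or.inr hu2)⟩
  have hZX : ∀ u ∈ Z, u ∈ Xᶜ := fun u hu huX => h.VV_ne u huX hu.2
  obtain ⟨t, ht, htZ⟩ := hZc.elim_nhds_subcover (fun x => connectedComponentIn Xᶜ x) (fun x hx =>
    h.Xc.isClosed.isOpen_compl.connectedComponentIn.mem_nhds (mem_connectedComponentIn (hZX x hx)))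
  have hpT : p ∉ T := fun hT => hp1 hT.2
  have hpm : p ∈ connectedComponentIn Xᶜ p := mem_connectedComponentIn hpX
  set J : Finset (Set ℂ) := (insert p t).image (fun x => connectedComponentIn Xᶜ x) with hJ
  have hpack : ∀ D ∈ J, ∃ x, x ∉ U ∧ x ∉ T ∧ D = connectedComponentIn Xᶜ x ∧
    ∃ (B O : Set ℂ) (q : ℂ), IsClosed B ∧ IsOpen O ∧ O ⊆ B ∧ B ⊆ D ∧ q ∈ O ∧
      HasLog (fun u => VV g u / (u - q)) (B \ O) ∧
      (∀ u ∈ D, u ∉ O → VV g u ≠ 0) ∧ ∀ q', q' ∉ D → HasLog (fun u => u - q') B := by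
    intro D hD
    obtain ⟨x, hx, rfl⟩ := Finset.mem_image.1 hD
    rcases Finset.mem_insert.1 hx with rfl | hx
    · exact ⟨x, hp0, hpT, rfl, h.disc_pack (hcb x hp0 hpT) (hc0 x hp0) hs hsE hpm hgp⟩
    · have hxZ := ht x hx
      have hxU : x ∉ U := fun hh => hxZ.1 (Or.inl hh)
      have hxT : x ∉ T := fun hh => hxZ.1 (Or.inr hh)
      refine ⟨x, hxU, hxT, rfl, ?_⟩
      obtain ⟨s', hs', hs'E⟩ := h.exists_sec (hcb x hxU hxT) (hc0 x hxU)
      have hxm := mem_connectedComponentIn (hZX x hxZ)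
      refine h.disc_pack (hcb x hxU hxT) (hc0 x hxU) hs' hs'E hxm ⟨x, hxm, ?_⟩
      have e1 : VV g x = 0 := hxZ.2
      have e2 := hVE (s' x)
      rw [hs'E x hxm, e1] at e2
      linear_combination e2
  choose! ctr hcU1 hcT1 hDeq B O q hBc hOo hOB hBD hqO hlD hneD hlq using hpack
  have hDU : ∀ D ∈ J, Disjoint D U := fun D hD => by
    have := hcU _ (hcU1 D hD); rwa [← hDeq D hD] at this
  have hDT : ∀ D ∈ J, Disjoint D T := fun D hD => by
    have := hcT _ (hcU1 D hD) (hcT1 D hD); rwa [← hDeq D hD] at this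
  have hDD : ∀ D ∈ J, ∀ D' ∈ J, D ≠ D' → Disjoint D D' := by
    intro D hD D' hD' hne
    rw [Set.disjoint_left]
    intro y hy hy'
    apply hne
    rw [hDeq D hD] at hy
    rw [hDeq D' hD'] at hy'
    rw [hDeq D hD, hDeq D' hD', connectedComponentIn_eq hy, connectedComponentIn_eq hy']
  obtain ⟨ρ0, hρ0, hρ01⟩ := exists_between (max_lt hr0 one_pos)
  have a0 := (le_max_right _ _).trans_lt hρ0
  have b0 := (le_max_left _ _).trans_lt hρ0
  obtain ⟨ρ1, hρ1, hρ11⟩ := exists_between (max_lt hr1 one_pos)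
  have a1 := (le_max_right _ _).trans_lt hρ1
  have b1 := (le_max_left _ _).trans_lt hρ1
  obtain ⟨d1, d2, d3, d4, d5, d6⟩ := R0.disc hρ01
  obtain ⟨e1, e2, e3, e4, e5, e6⟩ := R1.disc hρ11
  set B0 := ψ0 '' Metric.closedBall 0 ρ0 with hB0
  set O0 := ψ0 '' Metric.ball 0 ρ0 with hO0
  set C1 := ψ1 '' Metric.closedBall 0 ρ1 with hC1
  set P1 := ψ1 '' Metric.ball 0 ρ1 with hP1
  set B1 : Set ℂ := {0}ᶜ ∩ Inv.inv ⁻¹' C1 with hB1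
  set O1 : Set ℂ := {0}ᶜ ∩ Inv.inv ⁻¹' P1 with hO1
  have hO1o : IsOpen O1 := continuousOn_inv₀.isOpen_inter_preimage isOpen_compl_singleton e2
  have hB1T : B1 ⊆ T := fun u hu => ⟨hu.1, e4 hu.2⟩
  have hB1c : IsClosed B1 := by
    obtain ⟨M, hM0, hM⟩ := e1.isBounded.exists_pos_norm_le
    have hlow : ∀ u ∈ B1, M⁻¹ ≤ ‖u‖ := by
      intro u hu
      have h1 := hM _ hu.2
      rw [norm_inv] at h1
      exact inv_le_of_inv_le₀ (norm_pos_iff.2 hu.1) h1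
    have heq : B1 = {u | M⁻¹ ≤ ‖u‖} ∩ Inv.inv ⁻¹' C1 := by
      ext u
      refine ⟨fun hu => ⟨hlow u hu, hu.2⟩, fun hu => ⟨?_, hu.2⟩⟩
      have h1 : M⁻¹ ≤ ‖u‖ := hu.1
      have h2 : 0 < M⁻¹ := inv_pos.2 hM0
      exact norm_pos_iff.1 (h2.trans_le h1)
    rw [heq]
    refine ContinuousOn.preimage_isClosed_of_isClosed (continuousOn_inv₀.mono ?_)
      (isClosed_le continuous_const continuous_norm) e1.isClosed
    intro u hu
    have h1 : M⁻¹ ≤ ‖u‖ := hu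
    have h2 : 0 < M⁻¹ := inv_pos.2 hM0
    exact norm_pos_iff.1 (h2.trans_le h1)
  have hlog1 : HasLog (VV g) (B1 \ O1) := by
    have h1 := R1.hasLog hρ11 (hl1 ρ1 b1 a1 hρ11)
    have h2 := h1.comp (k := Inv.inv) (T := B1 \ O1) (continuousOn_inv₀.mono fun u hu => hu.1.1)
      (fun u hu => ⟨hu.1.2, fun hc => hu.2 ⟨hu.1.1, hc⟩⟩)
    have h3 := (hasLog_const (-1) (by norm_num) (B1 \ O1)).mul h2
    refine h3.congr fun u hu => ?_
    have := h.VV_inv (u := u) hu.1.1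
    beta_reduce
    rw [this]; ring
  have hne : ∀ u, (∀ i : Bool, u ∉ (if i then O0 else O1)) → (∀ D ∈ J, u ∉ O D) → VV g u ≠ 0 := by
    intro u h1 h2
    by_cases hu : u ∈ U
    · have h3 : u ∉ O0 := by simpa using h1 true
      have := hne0 (φ0 u) (b0.trans_le (d6 u hu h3)) (by simpa using R0.mφ hu)
      rwa [R0.ψφ u hu] at this
    by_cases huT : u ∈ T
    · have h3 : u ∉ O1 := by simpa using h1 false
      have h4 : u⁻¹ ∉ P1 := fun hh => h3 ⟨huT.1, hh⟩
      have := hne1 (φ1 u⁻¹) (b1.trans_le (e6 _ huT.2 h4)) (by simpa using R1.mφ huT.2)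
      rw [R1.ψφ _ huT.2, h.VV_inv huT.1] at this
      exact fun hh => this (by rw [hh, neg_zero])
    intro hV
    have huZ : u ∈ Z := ⟨fun hh => hh.elim hu huT, hV⟩
    obtain ⟨x, hx, hux⟩ := mem_iUnion₂.1 (htZ huZ)
    have hxJ : connectedComponentIn Xᶜ x ∈ J := Finset.mem_image_of_mem _ (Finset.mem_insert_of_mem hx)
    exact hneD _ hxJ u hux (h2 _ hxJ) hV
  have hfinal := core_top J (V := VV g) (B := B) (O := O) (q := q)
    (B2 := fun i => if i then B0 else B1) (O2 := fun i => if i then O0 else O1) hVc hBc hOo hOB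
    (fun i hi j hj hij => (hDD i hi j hj hij).mono (hBD i hi) (hBD j hj))
    (by intro j; cases j <;> simp [hB1c, d1.isClosed])
    (by intro j; cases j <;> simp [hO1o, d2])
    (by
      intro j; cases j
      · simp only [Bool.false_eq_true, if_false]
        exact fun u hu => ⟨hu.1, e3 hu.2⟩
      · simpa using d3)
    (by
      simp only [if_true, Bool.false_eq_true, if_false]
      rw [Set.disjoint_left]
      exact fun u hu hu1 => hUT u (d4 hu) (hB1T hu1))
    (by
      intro i j hj
      cases i
      · simp only [Bool.false_eq_true, if_false]
        exact ((hDT j hj).mono (hBD j hj) hB1T).symm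
      · simp only [if_true]
        exact ((hDU j hj).mono (hBD j hj) d4).symm)
    (by simp only [if_true]; exact ⟨0, by simpa using a0, hψ0⟩)
    hqO hne
    (by
      intro i; cases i
      · simpa using hlog1
      · simpa using R0.hasLog hρ01 (hl0 ρ0 b0 a0 hρ01))
    hlD
    (fun i hi j hj hij => hlq j hj (q i) fun hh =>
      (hDD i hi j hj hij).le_bot ⟨hBD i hi (hOB i hi (hqO i hi)), hh⟩)
  simp only [Bool.false_eq_true, if_false] at hfinal
  have h0b : (0 : ℂ) ∈ Metric.ball (0 : ℂ) 1 := by simp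
  obtain ⟨l, hl, hl2⟩ := factor R1.dψ R1.inj (R1.deriv_ne hYo h0b)
  rw [hψ1] at hl2
  have hsb : Metric.sphere (0 : ℂ) ρ1 ⊆ Metric.ball 0 1 := fun z hz => by
    rw [mem_sphere_zero_iff_norm] at hz
    rw [mem_ball_zero_iff, hz]; exact hρ11
  have hz0 : ∀ z ∈ Metric.sphere (0 : ℂ) ρ1, z ≠ 0 := by
    rintro z hz rfl
    simp at hz
    exact a1.ne hz
  have hψz : ∀ z ∈ Metric.sphere (0 : ℂ) ρ1, ψ1 z = z * Complex.exp (l z) := fun z hz => by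
    have := hl2 z (hsb hz); rwa [sub_zero] at this
  have hψn : ∀ z ∈ Metric.sphere (0 : ℂ) ρ1, ψ1 z ≠ 0 := fun z hz => by
    rw [hψz z hz]; exact mul_ne_zero (hz0 z hz) (Complex.exp_ne_zero _)
  have k1 := hfinal.comp (k := fun z => (ψ1 z)⁻¹) (T := Metric.sphere 0 ρ1)
    ((R1.dψ.continuousOn.mono hsb).inv₀ hψn) (by
      intro z hz
      have hzn : ‖z‖ = ρ1 := by simpa using hz
      refine ⟨⟨inv_ne_zero (hψn z hz), ?_⟩, fun hc => ?_⟩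
      · rw [mem_preimage, inv_inv]; exact ⟨z, by simp [hzn], rfl⟩
      · have := hc.2
        rw [mem_preimage, inv_inv] at this
        obtain ⟨w, hw, hwz⟩ := this
        have hw1 : ‖w‖ < ρ1 := by simpa using hw
        have := R1.inj (Metric.ball_subset_ball hρ11.le hw) (hsb hz) hwz
        rw [this, hzn] at hw1
        exact lt_irrefl _ hw1)
  have k2 : ∀ D ∈ J, HasLog (fun z => (1 - q D * ψ1 z) / Complex.exp (l z)) (Metric.sphere 0 ρ1) := by
    intro D hD
    have hqD : q D ∈ D := hBD D hD (hOB D hD (hqO D hD))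
    have m1 : HasLog (fun z => 1 - q D * ψ1 z) (Metric.ball 0 1) := by
      refine hasLog_of_convex (convex_ball _ _) Metric.isOpen_ball
        (continuousOn_const.sub (continuousOn_const.mul R1.dψ.continuousOn)) ?_
      intro z hz hzero
      have hmul : q D * ψ1 z = 1 := by linear_combination -hzero
      have hq0 : q D ≠ 0 := left_ne_zero_of_mul_eq_one hmul
      have hinv : (q D)⁻¹ = ψ1 z := inv_eq_of_mul_eq_one_right hmul
      exact (hDT D hD).le_bot ⟨hqD, hq0, by rw [mem_preimage, hinv]; exact R1.mψ hz⟩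
    have m2 : HasLog (fun z => Complex.exp (l z)) (Metric.ball 0 1) := ⟨l, hl.continuousOn, fun _ _ => rfl⟩
    exact (m1.div m2).mono hsb
  have k3 := (HasLog.prod J k2).div k1
  have k4 : HasLog (fun z : ℂ => z ^ J.card) (Metric.sphere 0 ρ1) := by
    refine k3.congr fun z hz => ?_
    beta_reduce
    have hterm : ∀ D ∈ J, (1 - q D * ψ1 z) / Complex.exp (l z) / ((ψ1 z)⁻¹ - q D) = z := by
      intro D hD
      have hqD : q D ∈ D := hBD D hD (hOB D hD (hqO D hD))
      have hzb := hsb hz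
      have n1 := hψn z hz
      have n2 : (ψ1 z)⁻¹ - q D ≠ 0 := by
        intro hzero
        rw [sub_eq_zero] at hzero
        refine (hDT D hD).le_bot ⟨hqD, ?_, ?_⟩
        · rw [← hzero]; exact inv_ne_zero n1
        · rw [mem_preimage, ← hzero, inv_inv]; exact R1.mψ hzb
      have e : (1 - q D * ψ1 z) = ψ1 z * ((ψ1 z)⁻¹ - q D) := by
        rw [mul_sub, mul_inv_cancel₀ n1]; ring
      rw [e, div_right_comm, mul_div_assoc, div_self n2, mul_one, hψz z hz, mul_div_assoc,
        div_self (Complex.exp_ne_zero _), mul_one]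
    rw [← Finset.prod_div_distrib, Finset.prod_congr rfl hterm, Finset.prod_const]
  have hcard := hasLog_pow_sphere a1 k4
  rw [Finset.card_eq_zero] at hcard
  have : connectedComponentIn Xᶜ p ∈ J := Finset.mem_image_of_mem _ (Finset.mem_insert_self p t)
  rw [hcard] at this
  exact absurd this (Finset.notMem_empty _)

end GlobalThm


section Ann
open Topology

/-- the covering of the annulus by the complex plane -/
def QA (z : ℂ) : 𝔸 := ((z.re : AddCircle (1 : ℝ)), z.im)

/-- the annulus as the punctured plane -/
def eA (a : 𝔸) : ℂ := (AddCircle.toCircle a.1 : ℂ) * Complex.exp (-(2 * Real.pi * a.2 : ℝ))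

theorem eA_QA (z : ℂ) : eA (QA z) = EE z := by
  rw [eA, QA, EE]
  simp only
  rw [AddCircle.toCircle_apply_mk, Circle.coe_exp, ← Complex.exp_add]
  congr 1
  conv_rhs => rw [← Complex.re_add_im z]
  push_cast
  linear_combination -(2 * Real.pi * z.im : ℂ) * Complex.I_sq

theorem QA_cont : Continuous QA := by
  unfold QA
  exact ((AddCircle.continuous_mk' 1).comp Complex.continuous_re).prodMk Complex.continuous_im

theorem QA_surj (a : 𝔸) : ∃ z, QA z = a := by
  obtain ⟨x, y⟩ := a
  obtain ⟨t, rfl⟩ := QuotientAddGroup.mk_surjective x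
  exact ⟨⟨t, y⟩, rfl⟩

theorem QA_eq {z w : ℂ} : QA z = QA w ↔ ∃ n : ℤ, z = w + n := by
  rw [QA, QA, Prod.mk.injEq]
  constructor
  · rintro ⟨h1, h2⟩
    have h3 : ((z.re - w.re : ℝ) : AddCircle (1 : ℝ)) = 0 := by
      rw [AddCircle.coe_sub, h1, sub_self]
    obtain ⟨n, hn⟩ := (AddCircle.coe_eq_zero_iff (1 : ℝ)).1 h3
    refine ⟨n, Complex.ext ?_ ?_⟩
    · simp at hn ⊢; linarith
    · simpa using h2
  · rintro ⟨n, rfl⟩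
    refine ⟨?_, by simp⟩
    have h3 : ((n : ℝ) : AddCircle (1 : ℝ)) = 0 := (AddCircle.coe_eq_zero_iff (1 : ℝ)).2 ⟨n, by simp⟩
    simp only [Complex.add_re, Complex.intCast_re]
    rw [AddCircle.coe_add, h3, add_zero]

theorem eA_inj : Function.Injective eA := by
  intro a b h
  obtain ⟨z, rfl⟩ := QA_surj a
  obtain ⟨w, rfl⟩ := QA_surj b
  rw [eA_QA, eA_QA, EE_eq] at h
  exact QA_eq.2 h

theorem eA_ne (a : 𝔸) : eA a ≠ 0 := by
  obtain ⟨z, rfl⟩ := QA_surj a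
  rw [eA_QA]; exact EE_ne z

theorem eA_surj {u : ℂ} (hu : u ≠ 0) : ∃ a, eA a = u := ⟨QA (lg u), by rw [eA_QA, EE_lg hu]⟩

theorem eA_cont : Continuous eA := by
  unfold eA
  have h1 : Continuous (fun a : 𝔸 => (AddCircle.toCircle a.1 : ℂ)) :=
    (continuous_subtype_val : Continuous ((↑) : Circle → ℂ)).comp (AddCircle.continuous_toCircle.comp continuous_fst)
  refine h1.mul ?_
  fun_prop

theorem EE_open : IsOpenMap EE := by
  rcases (EE_diff.differentiableOn.analyticOnNhd isOpen_univ).is_constant_or_isOpen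
    isPreconnected_univ with ⟨w, hw⟩ | h
  · exfalso
    have h1 := hw 0 trivial
    have h2 := hw (1 / 2) trivial
    rw [EE_half] at h2
    have h3 := EE_int 0
    push_cast at h3
    rw [h3, ← h2] at h1
    norm_num at h1
  · exact fun S hS => h S (subset_univ _) hS

theorem eA_open : IsOpenMap eA := by
  intro S hS
  have : eA '' S = EE '' (QA ⁻¹' S) := by
    ext u
    constructor
    · rintro ⟨a, ha, rfl⟩
      obtain ⟨z, rfl⟩ := QA_surj a
      exact ⟨z, ha, (eA_QA z).symm⟩
    · rintro ⟨z, hz, rfl⟩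
      exact ⟨QA z, hz, eA_QA z⟩
  rw [this]
  exact EE_open _ (hS.preimage QA_cont)

theorem QA_open : IsOpenMap QA := by
  intro S hS
  have : QA '' S = eA ⁻¹' (EE '' S) := by
    ext a
    constructor
    · rintro ⟨z, hz, rfl⟩
      exact ⟨z, hz, (eA_QA z).symm⟩
    · rintro ⟨z, hz, h⟩
      rw [← eA_QA] at h
      exact ⟨z, hz, eA_inj h⟩
  rw [this]
  exact (EE_open _ hS).preimage eA_cont

theorem QA_neg (z : ℂ) : QA (-z) = -QA z := by
  rw [QA, QA]; ext <;> simp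

theorem eA_neg (a : 𝔸) : eA (-a) = (eA a)⁻¹ := by
  obtain ⟨z, rfl⟩ := QA_surj a
  rw [← QA_neg, eA_QA, eA_QA, EE_neg]

theorem eA_norm (a : 𝔸) : ‖eA a‖ = Real.exp (-(2 * Real.pi * a.2)) := by
  obtain ⟨z, rfl⟩ := QA_surj a
  rw [eA_QA, EE_norm]; rfl

theorem vol_QA {S : Set ℂ} (hS : MeasurableSet S) (hinj : InjOn QA S) : volume (QA '' S) = volume S := by
  have hstrip : ∀ t : ℝ, MeasurePreserving QA (volume.restrict (Complex.re ⁻¹' Ioc t (t + 1))) volume := by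
    intro t
    have h1 := (AddCircle.measurePreserving_mk (1 : ℝ) t).prod (MeasurePreserving.id (volume : Measure ℝ))
    have h2 := Complex.volume_preserving_equiv_real_prod.restrict_preimage
      (measurableSet_Ioc.prod MeasurableSet.univ : MeasurableSet (Ioc t (t + 1) ×ˢ (univ : Set ℝ)))
    have e : (volume : Measure (ℝ × ℝ)).restrict (Ioc t (t + 1) ×ˢ (univ : Set ℝ)) =
        (volume.restrict (Ioc t (t + 1))).prod volume := by
      rw [Measure.volume_eq_prod, ← Measure.prod_restrict, Measure.restrict_univ]
    rw [e] at h2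
    have h3 := h1.comp h2
    have e2 : Complex.measurableEquivRealProd ⁻¹' (Ioc t (t + 1) ×ˢ (univ : Set ℝ)) =
        Complex.re ⁻¹' Ioc t (t + 1) := by
      ext z; simp [Complex.measurableEquivRealProd]
    rw [e2] at h3
    exact h3
  set P : ℤ → Set ℂ := fun n => S ∩ Complex.re ⁻¹' Ioc (n : ℝ) (n + 1) with hP
  have hPm : ∀ n, MeasurableSet (P n) := fun n =>
    hS.inter (measurableSet_Ioc.preimage Complex.measurable_re)
  have hPdis : Pairwise (Function.onFun Disjoint P) := by
    intro i j hij
    rw [Function.onFun, Set.disjoint_left]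
    rintro z ⟨_, h1⟩ ⟨_, h2⟩
    rw [mem_preimage, mem_Ioc] at h1 h2
    apply hij
    have a1 : (i : ℝ) < j + 1 := h1.1.trans_le h2.2
    have a2 : (j : ℝ) < i + 1 := h2.1.trans_le h1.2
    have a3 : i < j + 1 := by exact_mod_cast a1
    have a4 : j < i + 1 := by exact_mod_cast a2
    omega
  have hSU : S = ⋃ n, P n := by
    ext z
    rw [mem_iUnion]
    constructor
    · intro hz
      refine ⟨⌈z.re⌉ - 1, hz, ?_⟩
      rw [mem_preimage, mem_Ioc]
      push_cast
      have := Int.ceil_lt_add_one z.re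
      have := Int.le_ceil z.re
      constructor <;> linarith
    · rintro ⟨n, hn⟩; exact hn.1
  have hPi : ∀ n, MeasurableSet (QA '' P n) := fun n =>
    (hPm n).image_of_continuousOn_injOn QA_cont.continuousOn (hinj.mono inter_subset_left)
  have hvol : ∀ n, volume (QA '' P n) = volume (P n) := by
    intro n
    rw [← (hstrip n).measure_preimage (hPi n).nullMeasurableSet,
      Measure.restrict_apply ((hPi n).preimage QA_cont.measurable)]
    congr 1
    ext z
    constructor
    · rintro ⟨⟨w, hw, hwz⟩, hz⟩
      obtain ⟨m, hm⟩ := QA_eq.1 hwz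
      have h1 := hw.2
      rw [mem_preimage, mem_Ioc] at h1 hz
      have hre : w.re = z.re + m := by rw [hm]; simp
      have a1 : (m : ℝ) < 1 := by linarith [h1.2, hz.1]
      have a2 : (-1 : ℝ) < m := by linarith [h1.1, hz.2]
      have a3 : m < 1 := by exact_mod_cast a1
      have a4 : -1 < m := by exact_mod_cast a2
      have : m = 0 := by omega
      rw [this] at hm
      simp at hm
      rw [← hm]; exact hw
    · intro hz
      exact ⟨⟨z, hz, rfl⟩, hz.2⟩
  have hQdis : Pairwise (Function.onFun Disjoint fun n => QA '' P n) := by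
    intro i j hij
    rw [Function.onFun, Set.disjoint_left]
    rintro _ ⟨z, hz, rfl⟩ ⟨w, hw, hwz⟩
    have := hinj hw.1 hz.1 hwz
    rw [this] at hw
    exact (hPdis hij).le_bot ⟨hz, hw⟩
  rw [hSU, image_iUnion, measure_iUnion hQdis hPi, measure_iUnion hPdis hPm]
  exact tsum_congr hvol

/-- a lifted system -/
structure Lft (Φ : 𝔸 ≃ₜ 𝔸) (H : ℂ ≃ₜ ℂ) (K : Set 𝔸) : Prop where
  lift : ∀ z, QA (H z) = Φ (QA z)
  per : ∀ z, H (z + 1) = H z + 1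
  vol : ∀ s, MeasurableSet s → volume (Φ '' s) = volume s
  inv : Φ '' K = K

theorem Lft.gsys {Φ : 𝔸 ≃ₜ 𝔸} {H : ℂ ≃ₜ ℂ} {K : Set 𝔸} (h : Lft Φ H K) (hK : IsCompact K)
    (hKc : IsConnected K) (hfix : ∀ a ∈ K, Φ a ≠ a) : GSys H H.symm (eA '' K) := by
  have hmem : ∀ z, EE z ∈ eA '' K ↔ QA z ∈ K := fun z => by
    rw [← eA_QA, eA_inj.mem_set_image]
  have hinv : ∀ z, QA (H z) ∈ K ↔ QA z ∈ K := fun z => by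
    rw [h.lift]
    conv_lhs => rw [← h.inv]
    exact Φ.injective.mem_set_image
  refine ⟨H.continuous, H.symm.continuous, H.apply_symm_apply, H.symm_apply_apply, h.per, ?_,
    hK.image eA_cont, hKc.image _ eA_cont.continuousOn, ?_, ?_, ?_, ?_⟩
  · intro S hS hinj
    have hQ : InjOn QA S := fun z hz w hw hzw => hinj hz hw (by rw [← eA_QA, ← eA_QA, hzw])
    have hQ2 : InjOn QA (H '' S) := by
      rintro _ ⟨z, hz, rfl⟩ _ ⟨w, hw, rfl⟩ hzw
      rw [h.lift, h.lift] at hzw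
      rw [hQ hz hw (Φ.injective hzw)]
    have e : QA '' (H '' S) = Φ '' (QA '' S) := by
      rw [image_image, image_image]; exact image_congr fun z _ => h.lift z
    rw [← vol_QA hS.measurableSet hQ, ← vol_QA (H.isOpenMap S hS).measurableSet hQ2, e,
      h.vol _ (QA_open S hS).measurableSet]
  · rintro ⟨a, _, ha⟩; exact eA_ne a ha
  · intro z hz; rw [hmem] at hz ⊢; exact (hinv z).2 hz
  · intro z hz; rw [hmem] at hz ⊢; rw [← hinv, H.apply_symm_apply]; exact hz
  · intro z hz hf
    rw [hmem] at hz
    have := h.lift z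
    rw [hf] at this
    exact hfix _ hz this.symm

theorem Lft.trans {Φ Φ' : 𝔸 ≃ₜ 𝔸} {H H' : ℂ ≃ₜ ℂ} {K : Set 𝔸} (h : Lft Φ H K) (h' : Lft Φ' H' K) :
    Lft (Φ.trans Φ') (H.trans H') K := by
  refine ⟨fun z => ?_, fun z => ?_, fun s hs => ?_, ?_⟩
  · simp [h.lift, h'.lift]
  · simp [h.per, h'.per]
  · have : (Φ.trans Φ') '' s = Φ' '' (Φ '' s) := by rw [image_image]; rfl
    rw [this, h'.vol _ ((Homeomorph.measurableEmbedding Φ).measurableSet_image.2 hs), h.vol s hs]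
  · have : (Φ.trans Φ') '' K = Φ' '' (Φ '' K) := by rw [image_image]; rfl
    rw [this, h.inv, h'.inv]

theorem Lft.iterate {Φ : 𝔸 ≃ₜ 𝔸} {H : ℂ ≃ₜ ℂ} {K : Set 𝔸} (h : Lft Φ H K) (n : ℕ) :
    ∃ (Ψ : 𝔸 ≃ₜ 𝔸) (H' : ℂ ≃ₜ ℂ), Lft Ψ H' K ∧ ∀ a, Ψ a = Φ^[n] a := by
  induction n with
  | zero =>
    exact ⟨Homeomorph.refl _, Homeomorph.refl _, ⟨by simp, by simp, by simp, by simp⟩, by simp⟩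
  | succ k ih =>
    obtain ⟨Ψ, H', h1, h2⟩ := ih
    refine ⟨Ψ.trans Φ, H'.trans H, h1.trans h, fun a => ?_⟩
    rw [Function.iterate_succ_apply', ← h2]; rfl

theorem Lft.shift {Φ : 𝔸 ≃ₜ 𝔸} {H : ℂ ≃ₜ ℂ} {K : Set 𝔸} (h : Lft Φ H K) (k : ℤ) :
    Lft Φ (H.trans (Homeomorph.addRight (k : ℂ))) K := by
  refine ⟨fun z => ?_, fun z => ?_, h.vol, h.inv⟩
  · rw [← h.lift]
    exact QA_eq.2 ⟨k, rfl⟩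
  · simp [h.per]; ring

theorem lft_of (F : 𝔸 ≃ₜ 𝔸) (f : ℝ × ℝ → ℝ × ℝ) (hf : Continuous f)
    (hlift : ∀ p, πA (f p) = F (πA p)) (hdeck : ∀ p, f (TA p) = TA (f p))
    (harea : ∀ s : Set 𝔸, MeasurableSet s → volume ((⇑F) ⁻¹' s) = volume s)
    (K : Set 𝔸) (hKinv : F '' K = K) : ∃ H, Lft F H K := by
  set k : ℂ → ℂ := fun z => Complex.equivRealProd.symm (f (z.re, z.im)) with hk
  have hkc : Continuous k := by
    have h1 : Continuous (fun z : ℂ => f (z.re, z.im)) :=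
      hf.comp (Complex.continuous_re.prodMk Complex.continuous_im)
    exact Complex.equivRealProdCLM.symm.continuous.comp h1
  have hkl : ∀ z, QA (k z) = F (QA z) := fun z => hlift (z.re, z.im)
  have hkp : ∀ z, k (z + 1) = k z + 1 := by
    intro z
    have h1 := hdeck (z.re, z.im)
    simp only [TA] at h1
    have h2 : ((z + 1).re, (z + 1).im) = (z.re + 1, z.im) := by simp
    simp only [hk]
    rw [h2, h1]
    apply Complex.ext <;> simp [Complex.equivRealProd]
  have hkI : ∀ z : ℂ, ∀ n : ℤ, k (z + n) = k z + n := by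
    intro z n
    have := (per_int (P := univ) (c := 1) (fun z => by simp) (fun z _ => hkp z) n z trivial).2
    simpa using this
  have hinj : Function.Injective k := by
    intro z w hzw
    have h1 : QA z = QA w := F.injective (by rw [← hkl, ← hkl, hzw])
    obtain ⟨n, hn⟩ := QA_eq.1 h1
    rw [hn, hkI] at hzw
    have : (n : ℂ) = 0 := by linear_combination hzw
    rw [hn, this, add_zero]
  have hsurj : Function.Surjective k := by
    intro w
    obtain ⟨z, hz⟩ := QA_surj (F.symm (QA w))
    have h1 : QA w = QA (k z) := by rw [hkl, hz, F.apply_symm_apply]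
    obtain ⟨n, hn⟩ := QA_eq.1 h1
    exact ⟨z + n, by rw [hkI, hn]⟩
  have hopen : IsOpenMap k := by
    intro S hS
    rw [isOpen_iff_mem_nhds]
    rintro _ ⟨z, hz, rfl⟩
    set S' := S ∩ k ⁻¹' Metric.ball (k z) (1 / 4) with hS'
    have hS'o : IsOpen S' := hS.inter (Metric.isOpen_ball.preimage hkc)
    have ho : IsOpen (QA ⁻¹' (F '' (QA '' S')) ∩ Metric.ball (k z) (1 / 4)) :=
      ((F.isOpenMap _ (QA_open _ hS'o)).preimage QA_cont).inter Metric.isOpen_ball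
    refine mem_of_superset (ho.mem_nhds ⟨?_, by simp⟩) ?_
    · exact ⟨QA z, ⟨z, ⟨hz, by simp⟩, rfl⟩, (hkl z).symm⟩
    · rintro w ⟨⟨_, ⟨y, hy, rfl⟩, hyw⟩, hw⟩
      rw [← hkl] at hyw
      obtain ⟨n, hn⟩ := QA_eq.1 hyw
      have h1 := hy.2
      rw [mem_preimage, Metric.mem_ball, dist_eq_norm] at h1
      rw [Metric.mem_ball, dist_eq_norm] at hw
      have h2 : ‖(n : ℂ)‖ < 1 := by
        have : (n : ℂ) = (k y - k z) - (w - k z) := by rw [hn]; ring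
        rw [this]
        exact (norm_sub_le _ _).trans_lt (by linarith)
      rw [Complex.norm_intCast] at h2
      have h3 : n = 0 := Int.abs_lt_one_iff.1 (by exact_mod_cast h2)
      rw [h3] at hn
      exact ⟨y, hy.1, by simpa using hn⟩
  refine ⟨(Equiv.ofBijective k ⟨hinj, hsurj⟩).toHomeomorphOfContinuousOpen hkc hopen, hkl, hkp, ?_, hKinv⟩
  intro s hs
  have h1 := harea (F '' s) ((Homeomorph.measurableEmbedding F).measurableSet_image.2 hs)
  rw [← h1, preimage_image_eq _ F.injective]

end Ann


section FinalPart
open Topology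

theorem locConn_A : LocallyConnectedSpace 𝔸 := by
  have hq : IsQuotientMap QA := QA_open.isQuotientMap QA_cont QA_surj
  exact hq.locallyConnectedSpace

theorem ccIn_open {K : Set 𝔸} (hK : IsCompact K) (a : 𝔸) : IsOpen (connectedComponentIn Kᶜ a) := by
  have := locConn_A
  exact hK.isClosed.isOpen_compl.connectedComponentIn

theorem preconn_top (M : ℝ) : IsPreconnected {a : 𝔸 | M < a.2} := by
  have h1 : IsPreconnected {z : ℂ | M < z.im} := (convex_halfSpace_im_gt M).isPreconnected
  have h2 := h1.image QA QA_cont.continuousOn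
  have : QA '' {z : ℂ | M < z.im} = {a : 𝔸 | M < a.2} := by
    ext a
    constructor
    · rintro ⟨z, hz, rfl⟩; exact hz
    · intro ha
      obtain ⟨z, rfl⟩ := QA_surj a
      exact ⟨z, ha, rfl⟩
  rwa [this] at h2

def ptT (M : ℝ) : 𝔸 := (0, M + 1)

theorem top_sub {K : Set 𝔸} {M : ℝ} (hM : ∀ a ∈ K, |a.2| ≤ M) :
    {a : 𝔸 | M < a.2} ⊆ connectedComponentIn Kᶜ (ptT M) := by
  refine (preconn_top M).subset_connectedComponentIn (by simp [ptT]) ?_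
  intro a ha haK
  have := (abs_le.1 (hM a haK)).2
  simp only [mem_ofPred_eq] at ha
  linarith

theorem neg_bd {K : Set 𝔸} {M : ℝ} (hM : ∀ a ∈ K, |a.2| ≤ M) : ∀ a ∈ (-K : Set 𝔸), |a.2| ≤ M := by
  intro a ha
  have := hM _ ha
  simpa using this

theorem ptT_notMem {K : Set 𝔸} {M : ℝ} (hM : ∀ a ∈ K, |a.2| ≤ M) : ptT M ∉ K := by
  intro h
  have := (abs_le.1 (hM _ h)).2
  simp only [ptT] at this
  linarith

theorem cc_neg {K : Set 𝔸} {M : ℝ} (hM : ∀ a ∈ K, |a.2| ≤ M) (a : 𝔸) :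
    a ∈ connectedComponentIn (-K)ᶜ (ptT M) ↔ -a ∈ connectedComponentIn Kᶜ (-ptT M) := by
  have h1 := (Homeomorph.neg 𝔸).image_connectedComponentIn (s := (-K)ᶜ) (x := ptT M)
    (ptT_notMem (neg_bd hM))
  have h2 : (Homeomorph.neg 𝔸) '' (-K)ᶜ = Kᶜ := by
    rw [image_compl_eq (Homeomorph.neg 𝔸).bijective]
    simp
  rw [h2] at h1
  have h3 : (Homeomorph.neg 𝔸) (ptT M) = -ptT M := rfl
  rw [h3] at h1
  rw [← h1]
  constructor
  · intro h; exact ⟨a, h, rfl⟩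
  · rintro ⟨b, hb, hba⟩
    have : b = a := neg_injective hba
    rwa [← this]

theorem bot_sub {K : Set 𝔸} {M : ℝ} (hM : ∀ a ∈ K, |a.2| ≤ M) :
    {a : 𝔸 | a.2 < -M} ⊆ connectedComponentIn Kᶜ (-ptT M) := by
  intro a ha
  have h1 := (cc_neg hM (-a)).1 (top_sub (neg_bd hM) (by
    simp only [mem_ofPred_eq, Prod.snd_neg] at ha ⊢; linarith))
  rwa [neg_neg] at h1

theorem bdd_strip (M : ℝ) : IsCompact {a : 𝔸 | |a.2| ≤ M} := by
  have : {a : 𝔸 | |a.2| ≤ M} = univ ×ˢ Icc (-M) M := by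
    ext a; simp [abs_le]
  rw [this]
  exact isCompact_univ.prod isCompact_Icc

theorem top_unb (M : ℝ) : ¬ Bornology.IsBounded {a : 𝔸 | M < a.2} := by
  intro h
  have h1 : Bornology.IsBounded (Prod.snd '' {a : 𝔸 | M < a.2}) := h.image_snd
  obtain ⟨B, hB⟩ := h1.bddAbove
  have h2 : max B M + 1 ∈ Prod.snd '' {a : 𝔸 | M < a.2} :=
    ⟨(0, max B M + 1), by simp only [mem_ofPred_eq]; linarith [le_max_right B M], rfl⟩
  have := hB h2
  linarith [le_max_left B M]

theorem bot_unb (M : ℝ) : ¬ Bornology.IsBounded {a : 𝔸 | a.2 < -M} := by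
  intro h
  have h1 : Bornology.IsBounded (Prod.snd '' {a : 𝔸 | a.2 < -M}) := h.image_snd
  obtain ⟨B, hB⟩ := h1.bddBelow
  have h2 : min B (-M) - 1 ∈ Prod.snd '' {a : 𝔸 | a.2 < -M} :=
    ⟨(0, min B (-M) - 1), by simp only [mem_ofPred_eq]; linarith [min_le_right B (-M)], rfl⟩
  have := hB h2
  linarith [min_le_left B (-M)]

theorem unb_cases {K : Set 𝔸} {M : ℝ} (hM : ∀ a ∈ K, |a.2| ≤ M) {z : 𝔸}
    (hz : ¬ Bornology.IsBounded (connectedComponentIn Kᶜ z)) :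
    connectedComponentIn Kᶜ z = connectedComponentIn Kᶜ (ptT M) ∨
    connectedComponentIn Kᶜ z = connectedComponentIn Kᶜ (-ptT M) := by
  have h1 : ∃ a ∈ connectedComponentIn Kᶜ z, M < |a.2| := by
    by_contra! hc
    exact hz ((bdd_strip M).isBounded.subset hc)
  obtain ⟨a, ha, haM⟩ := h1
  rcases lt_abs.1 haM with h | h
  · left
    rw [connectedComponentIn_eq ha, connectedComponentIn_eq (top_sub hM h)]
  · right
    rw [connectedComponentIn_eq ha, connectedComponentIn_eq (bot_sub hM (show a.2 < -M by linarith))]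

theorem bdd_sub {K : Set 𝔸} {M : ℝ} (hM : ∀ a ∈ K, |a.2| ≤ M) {z : 𝔸}
    (hz : Bornology.IsBounded (connectedComponentIn Kᶜ z)) :
    connectedComponentIn Kᶜ z ⊆ {a | |a.2| ≤ M} := by
  intro a ha
  by_contra hc
  simp only [mem_ofPred_eq, not_le] at hc
  rcases lt_abs.1 hc with h | h
  · rw [connectedComponentIn_eq ha, ← connectedComponentIn_eq (top_sub hM h)] at hz
    exact top_unb M (hz.subset (top_sub hM))
  · rw [connectedComponentIn_eq ha,
      ← connectedComponentIn_eq (bot_sub hM (show a.2 < -M by linarith))] at hz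
    exact bot_unb M (hz.subset (bot_sub hM))

theorem compl_cc_open {K : Set 𝔸} (hK : IsCompact K) (z : 𝔸) :
    IsOpen (Kᶜ \ connectedComponentIn Kᶜ z) := by
  have : Kᶜ \ connectedComponentIn Kᶜ z =
      ⋃ a ∈ Kᶜ \ connectedComponentIn Kᶜ z, connectedComponentIn Kᶜ a := by
    ext b
    simp only [mem_iUnion, exists_prop]
    constructor
    · intro hb; exact ⟨b, hb, mem_connectedComponentIn hb.1⟩
    · rintro ⟨a, ha, hb⟩
      refine ⟨connectedComponentIn_subset _ _ hb, fun hb' => ha.2 ?_⟩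
      rw [connectedComponentIn_eq hb', ← connectedComponentIn_eq hb]
      exact mem_connectedComponentIn ha.1
  rw [this]
  exact isOpen_biUnion fun a _ => ccIn_open hK a

theorem ballA_sub {K : Set 𝔸} {M : ℝ} (hM : ∀ a ∈ K, |a.2| ≤ M) :
    Metric.ball (0 : ℂ) (Real.exp (-(2 * Real.pi * M))) ⊆ (eA '' K)ᶜ := by
  rintro _ hu ⟨a, ha, rfl⟩
  rw [mem_ball_zero_iff, eA_norm, Real.exp_lt_exp] at hu
  have := (abs_le.1 (hM a ha)).2
  nlinarith [Real.pi_pos]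

theorem eA_ball {M : ℝ} {a : 𝔸} :
    eA a ∈ Metric.ball (0 : ℂ) (Real.exp (-(2 * Real.pi * M))) ↔ M < a.2 := by
  rw [mem_ball_zero_iff, eA_norm, Real.exp_lt_exp]
  constructor <;> intro h <;> nlinarith [Real.pi_pos]

theorem eA_im_sub {K S : Set 𝔸} (h : S ⊆ Kᶜ) : eA '' S ⊆ (eA '' K)ᶜ := by
  rintro _ ⟨a, ha, rfl⟩ hc
  exact h ha (eA_inj.mem_set_image.1 hc)

theorem U0_iff {K : Set 𝔸} {M : ℝ} (hK : IsCompact K) (hM : ∀ a ∈ K, |a.2| ≤ M) (a : 𝔸) :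
    eA a ∈ connectedComponentIn (eA '' K)ᶜ 0 ↔ a ∈ connectedComponentIn Kᶜ (ptT M) := by
  set r := Real.exp (-(2 * Real.pi * M)) with hr
  have h0 : (0 : ℂ) ∈ Metric.ball (0 : ℂ) r := Metric.mem_ball_self (Real.exp_pos _)
  constructor
  · intro ha
    have hsub : connectedComponentIn (eA '' K)ᶜ 0 ⊆
        (eA '' connectedComponentIn Kᶜ (ptT M) ∪ Metric.ball 0 r) := by
      refine isPreconnected_connectedComponentIn.subset_left_of_subset_union
        (v := eA '' (Kᶜ \ connectedComponentIn Kᶜ (ptT M)))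
        ((eA_open _ (ccIn_open hK _)).union Metric.isOpen_ball)
        (eA_open _ (compl_cc_open hK _)) ?_ ?_ ?_
      · rw [Set.disjoint_left]
        rintro _ h1 ⟨b, hb, rfl⟩
        rcases h1 with h1 | h1
        · exact hb.2 (eA_inj.mem_set_image.1 h1)
        · exact hb.2 (top_sub hM (eA_ball.1 h1))
      · intro u hu
        have huX := connectedComponentIn_subset _ _ hu
        by_cases hu0 : u = 0
        · left; right; rw [hu0]; exact h0
        · obtain ⟨b, rfl⟩ := eA_surj hu0
          have hbK : b ∉ K := fun h => huX ⟨b, h, rfl⟩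
          by_cases hb : b ∈ connectedComponentIn Kᶜ (ptT M)
          · left; left; exact ⟨b, hb, rfl⟩
          · right; exact ⟨b, ⟨hbK, hb⟩, rfl⟩
      · exact ⟨0, mem_connectedComponentIn (ballA_sub hM h0), Or.inr h0⟩
    rcases hsub ha with h | h
    · exact eA_inj.mem_set_image.1 h
    · exact top_sub hM (eA_ball.1 h)
  · intro ha
    have h1 : Metric.ball (0 : ℂ) r ⊆ connectedComponentIn (eA '' K)ᶜ 0 :=
      (convex_ball _ _).isPreconnected.subset_connectedComponentIn h0 (ballA_sub hM)
    have h2 : eA (ptT M) ∈ connectedComponentIn (eA '' K)ᶜ 0 :=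
      h1 (eA_ball.2 (by simp [ptT]))
    have hp : ptT M ∈ connectedComponentIn Kᶜ (ptT M) := mem_connectedComponentIn (ptT_notMem hM)
    have h3 : eA '' connectedComponentIn Kᶜ (ptT M) ⊆
        connectedComponentIn (eA '' K)ᶜ (eA (ptT M)) :=
      (isPreconnected_connectedComponentIn.image eA eA_cont.continuousOn).subset_connectedComponentIn
        ⟨_, hp, rfl⟩ (eA_im_sub (connectedComponentIn_subset _ _))
    rw [connectedComponentIn_eq h2]
    exact h3 ⟨a, ha, rfl⟩

theorem inv_X (K : Set 𝔸) : Inv.inv ⁻¹' (eA '' K) = eA '' (-K) := by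
  ext u
  constructor
  · rintro ⟨a, ha, hau⟩
    refine ⟨-a, by simpa using ha, ?_⟩
    rw [eA_neg, hau, inv_inv]
  · rintro ⟨a, ha, rfl⟩
    exact ⟨-a, ha, eA_neg a⟩

theorem U1_iff {K : Set 𝔸} {M : ℝ} (hK : IsCompact K) (hM : ∀ a ∈ K, |a.2| ≤ M) (a : 𝔸) :
    (eA a)⁻¹ ∈ connectedComponentIn (Inv.inv ⁻¹' (eA '' K))ᶜ 0 ↔
      a ∈ connectedComponentIn Kᶜ (-ptT M) := by
  rw [inv_X, ← eA_neg, U0_iff hK.neg (neg_bd hM), cc_neg hM, neg_neg]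

theorem top_lower {K : Set 𝔸} {M : ℝ} (hM : ∀ a ∈ K, |a.2| ≤ M)
    (hne : connectedComponentIn Kᶜ (ptT M) ≠ connectedComponentIn Kᶜ (-ptT M)) {a : 𝔸}
    (ha : a ∈ connectedComponentIn Kᶜ (ptT M)) : -M ≤ a.2 := by
  by_contra hc
  push Not at hc
  exact hne (by rw [connectedComponentIn_eq ha, connectedComponentIn_eq (bot_sub hM hc)])

theorem bot_upper {K : Set 𝔸} {M : ℝ} (hM : ∀ a ∈ K, |a.2| ≤ M)
    (hne : connectedComponentIn Kᶜ (ptT M) ≠ connectedComponentIn Kᶜ (-ptT M)) {a : 𝔸}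
    (ha : a ∈ connectedComponentIn Kᶜ (-ptT M)) : a.2 ≤ M := by
  by_contra hc
  push Not at hc
  exact hne (by rw [connectedComponentIn_eq ha, connectedComponentIn_eq (top_sub hM hc)])

/-- components in the plane of bounded components in the annulus -/
theorem cc_plane {K : Set 𝔸} {M : ℝ} (hK : IsCompact K) (hM : ∀ a ∈ K, |a.2| ≤ M) {z : 𝔸}
    (hz : z ∉ K) (hb : Bornology.IsBounded (connectedComponentIn Kᶜ z)) :
    connectedComponentIn (eA '' K)ᶜ (eA z) = eA '' connectedComponentIn Kᶜ z := by
  have hzm : z ∈ connectedComponentIn Kᶜ z := mem_connectedComponentIn hz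
  apply Subset.antisymm
  · set r := Real.exp (-(2 * Real.pi * M)) with hr
    have h0 : (0 : ℂ) ∈ Metric.ball (0 : ℂ) r := Metric.mem_ball_self (Real.exp_pos _)
    refine isPreconnected_connectedComponentIn.subset_left_of_subset_union
        (v := eA '' (Kᶜ \ connectedComponentIn Kᶜ z) ∪ Metric.ball 0 r)
        (eA_open _ (ccIn_open hK _))
        ((eA_open _ (compl_cc_open hK _)).union Metric.isOpen_ball) ?_ ?_ ?_
    · rw [Set.disjoint_left]
      rintro _ ⟨b, hb', rfl⟩ h1
      rcases h1 with h1 | h1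
      · exact (eA_inj.mem_set_image.1 h1).2 hb'
      · have h2 := (abs_le.1 (show |b.2| ≤ M from bdd_sub hM hb hb')).2
        have h3 := eA_ball.1 h1
        linarith
    · intro u hu
      have huX := connectedComponentIn_subset _ _ hu
      by_cases hu0 : u = 0
      · right; right; rw [hu0]; exact h0
      · obtain ⟨b, rfl⟩ := eA_surj hu0
        have hbK : b ∉ K := fun h => huX ⟨b, h, rfl⟩
        by_cases hb : b ∈ connectedComponentIn Kᶜ z
        · left; exact ⟨b, hb, rfl⟩
        · right; left; exact ⟨b, ⟨hbK, hb⟩, rfl⟩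
    · exact ⟨eA z, mem_connectedComponentIn (fun h => hz (eA_inj.mem_set_image.1 h)), z, hzm, rfl⟩
  · exact (isPreconnected_connectedComponentIn.image eA eA_cont.continuousOn).subset_connectedComponentIn
        ⟨_, hzm, rfl⟩ (eA_im_sub (connectedComponentIn_subset _ _))

theorem final_core {Φ : 𝔸 ≃ₜ 𝔸} {H : ℂ ≃ₜ ℂ} {K : Set 𝔸} {M : ℝ} (h : Lft Φ H K) (hK : IsCompact K)
    (hKc : IsConnected K) (hfix : ∀ a ∈ K, Φ a ≠ a) (hM : ∀ a ∈ K, |a.2| ≤ M)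
    (hne : connectedComponentIn Kᶜ (ptT M) ≠ connectedComponentIn Kᶜ (-ptT M))
    (hT : Φ '' connectedComponentIn Kᶜ (ptT M) = connectedComponentIn Kᶜ (ptT M))
    (hB : Φ '' connectedComponentIn Kᶜ (-ptT M) = connectedComponentIn Kᶜ (-ptT M))
    {z : 𝔸} (hz : z ∉ K) (hb : Bornology.IsBounded (connectedComponentIn Kᶜ z))
    (hper : Φ z ∈ connectedComponentIn Kᶜ z) : False := by
  have hzm : z ∈ connectedComponentIn Kᶜ z := mem_connectedComponentIn hz
  have hcc := cc_plane hK hM hz hb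
  have hzT : z ∉ connectedComponentIn Kᶜ (ptT M) := fun hc => by
    rw [← connectedComponentIn_eq hc] at hb
    exact top_unb M (hb.subset (top_sub hM))
  have hzB : z ∉ connectedComponentIn Kᶜ (-ptT M) := fun hc => by
    rw [← connectedComponentIn_eq hc] at hb
    exact bot_unb M (hb.subset (bot_sub hM))
  have hcb : Bornology.IsBounded (connectedComponentIn (eA '' K)ᶜ (eA z)) := by
    rw [hcc]
    exact (((bdd_strip M).image eA_cont).isBounded).subset (image_mono (bdd_sub hM hb))
  have h00 : (0 : ℂ) ∉ connectedComponentIn (eA '' K)ᶜ (eA z) := by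
    rw [hcc]; rintro ⟨a, _, ha⟩; exact eA_ne a ha
  obtain ⟨s, hs, hsE⟩ := (h.gsys hK hKc hfix).exists_sec hcb h00
  have hu1 : eA (Φ z) ∈ connectedComponentIn (eA '' K)ᶜ (eA z) := by
    rw [hcc]; exact ⟨_, hper, rfl⟩
  have hp : eA z ∈ connectedComponentIn (eA '' K)ᶜ (eA z) := by
    rw [hcc]; exact ⟨_, hzm, rfl⟩
  have hQz : QA (s (eA z)) = z := eA_inj (by rw [eA_QA]; exact hsE _ hp)
  have hQ1 : QA (s (eA (Φ z))) = Φ z := eA_inj (by rw [eA_QA]; exact hsE _ hu1)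
  obtain ⟨k, hk⟩ : ∃ k : ℤ, s (eA (Φ z)) = H (s (eA z)) + k := by
    apply QA_eq.1
    rw [hQ1, h.lift, hQz]
  have h' := h.shift k
  set G := H.trans (Homeomorph.addRight (k : ℂ)) with hG
  have hGl := h'.lift
  have hGl' : ∀ w, QA (G.symm w) = Φ.symm (QA w) := fun w => by
    apply Φ.injective
    rw [← hGl, G.apply_symm_apply, Φ.apply_symm_apply]
  have hTi : ∀ a ∈ connectedComponentIn Kᶜ (ptT M), Φ a ∈ connectedComponentIn Kᶜ (ptT M) :=
    fun a ha => by rw [← hT]; exact ⟨a, ha, rfl⟩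
  have hTi' : ∀ a ∈ connectedComponentIn Kᶜ (ptT M), Φ.symm a ∈ connectedComponentIn Kᶜ (ptT M) :=
    fun a ha => by
      rw [← hT] at ha; obtain ⟨b, hb, rfl⟩ := ha; rwa [Φ.symm_apply_apply]
  have hBi : ∀ a ∈ connectedComponentIn Kᶜ (-ptT M), Φ a ∈ connectedComponentIn Kᶜ (-ptT M) :=
    fun a ha => by rw [← hB]; exact ⟨a, ha, rfl⟩
  have hBi' : ∀ a ∈ connectedComponentIn Kᶜ (-ptT M), Φ.symm a ∈ connectedComponentIn Kᶜ (-ptT M) :=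
    fun a ha => by
      rw [← hB] at ha; obtain ⟨b, hb, rfl⟩ := ha; rwa [Φ.symm_apply_apply]
  have hUz : ∀ w, EE w ∈ connectedComponentIn (eA '' K)ᶜ 0 ↔
      QA w ∈ connectedComponentIn Kᶜ (ptT M) := fun w => by rw [← eA_QA, U0_iff hK hM]
  have hWz : ∀ w, EE (-w) ∈ connectedComponentIn (Inv.inv ⁻¹' (eA '' K))ᶜ 0 ↔
      QA w ∈ connectedComponentIn Kᶜ (-ptT M) := fun w => by
    rw [← eA_QA, QA_neg, eA_neg, U1_iff hK hM]
  refine global_core (p := eA z) (s := s) (h'.gsys hK hKc hfix) ?_ ?_ ?_ ?_ ?_ ?_ ?_ ?_ ?_ ?_ hs hsE ?_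
  · refine (Metric.isBounded_closedBall (x := (0 : ℂ)) (r := Real.exp (2 * Real.pi * M))).subset ?_
    intro u hu
    rw [mem_closedBall_zero_iff]
    by_cases hu0 : u = 0
    · rw [hu0, norm_zero]; positivity
    · obtain ⟨a, rfl⟩ := eA_surj hu0
      have := top_lower hM hne ((U0_iff hK hM a).1 hu)
      rw [eA_norm, Real.exp_le_exp]
      nlinarith [Real.pi_pos]
  · intro w hw
    rw [hUz] at hw ⊢
    rw [hGl]; exact hTi _ hw
  · intro w hw
    rw [hUz] at hw ⊢
    rw [hGl']; exact hTi' _ hw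
  · refine (Metric.isBounded_closedBall (x := (0 : ℂ)) (r := Real.exp (2 * Real.pi * M))).subset ?_
    intro u hu
    rw [mem_closedBall_zero_iff]
    by_cases hu0 : u = 0
    · rw [hu0, norm_zero]; positivity
    · obtain ⟨a, ha⟩ := eA_surj (inv_ne_zero hu0)
      have hua : u = (eA a)⁻¹ := by rw [ha, inv_inv]
      rw [hua] at hu
      have := bot_upper hM hne ((U1_iff hK hM a).1 hu)
      rw [hua, ← eA_neg, eA_norm, Real.exp_le_exp, Prod.snd_neg]
      nlinarith [Real.pi_pos]
  · intro w hw
    rw [← neg_neg w, hWz] at hw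
    rw [hWz, hGl]; exact hBi _ hw
  · intro w hw
    rw [← neg_neg w, hWz] at hw
    rw [hWz, hGl']; exact hBi' _ hw
  · intro u hu hu'
    by_contra hu0
    obtain ⟨a, rfl⟩ := eA_surj hu0
    have h1 := (U0_iff hK hM a).1 hu
    have h2 := (U1_iff hK hM a).1 hu'
    exact hne (by rw [connectedComponentIn_eq h1, connectedComponentIn_eq h2])
  · exact fun hc => hz (eA_inj.mem_set_image.1 hc)
  · exact fun hc => hzT ((U0_iff hK hM z).1 hc)
  · exact fun hc => hzB ((U1_iff hK hM z).1 hc)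
  · exact ⟨eA (Φ z), hu1, hk⟩

theorem cc_image {Φ : 𝔸 ≃ₜ 𝔸} {K : Set 𝔸} (hinv : Φ '' K = K) {z : 𝔸} (hz : z ∈ Kᶜ) :
    Φ '' connectedComponentIn Kᶜ z = connectedComponentIn Kᶜ (Φ z) := by
  rw [Φ.image_connectedComponentIn hz, image_compl_eq Φ.bijective, hinv]

theorem unb_image (Φ : 𝔸 ≃ₜ 𝔸) {S : Set 𝔸} (hS : ¬ Bornology.IsBounded S) :
    ¬ Bornology.IsBounded (Φ '' S) := by
  intro h
  apply hS
  have h1 := (h.isCompact_closure.image Φ.symm.continuous).isBounded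
  refine h1.subset ?_
  intro a ha
  exact ⟨Φ a, subset_closure ⟨a, ha, rfl⟩, Φ.symm_apply_apply a⟩

theorem recur {Φ : 𝔸 ≃ₜ 𝔸} {H : ℂ ≃ₜ ℂ} {K : Set 𝔸} {M : ℝ} (h : Lft Φ H K) (hK : IsCompact K)
    (hM : ∀ a ∈ K, |a.2| ≤ M) {z : 𝔸} (hz : z ∈ Kᶜ)
    (hb : Bornology.IsBounded (connectedComponentIn Kᶜ z)) :
    ∃ n : ℕ, 1 ≤ n ∧ Φ^[n] z ∈ connectedComponentIn Kᶜ z := by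
  have hit : ∀ i : ℕ, Φ^[i] z ∈ Kᶜ ∧ Φ^[i] '' connectedComponentIn Kᶜ z = connectedComponentIn Kᶜ (Φ^[i] z)
      ∧ volume (Φ^[i] '' connectedComponentIn Kᶜ z) = volume (connectedComponentIn Kᶜ z)
      ∧ Bornology.IsBounded (connectedComponentIn Kᶜ (Φ^[i] z)) := by
    intro i
    induction i with
    | zero => exact ⟨hz, by simp, by simp, hb⟩
    | succ i ih =>
      obtain ⟨h1, h2, h3, h4⟩ := ih
      have e : Φ^[i + 1] '' connectedComponentIn Kᶜ z = Φ '' (Φ^[i] '' connectedComponentIn Kᶜ z) := by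
        rw [Function.iterate_succ', image_comp]
      have h5 : Φ '' connectedComponentIn Kᶜ (Φ^[i] z) = connectedComponentIn Kᶜ (Φ^[i + 1] z) := by
        rw [cc_image h.inv h1, Function.iterate_succ_apply']
      refine ⟨?_, ?_, ?_, ?_⟩
      · rw [Function.iterate_succ_apply']
        intro hc
        rw [← h.inv] at hc
        exact h1 (Φ.injective.mem_set_image.1 hc)
      · rw [e, h2, h5]
      · rw [e, h.vol _ (by rw [h2]; exact (ccIn_open hK _).measurableSet), h3]
      · by_contra hc
        rw [← h5] at hc
        exact hc (((h4.isCompact_closure.image Φ.continuous).isBounded).subset (image_mono subset_closure))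
  set D := connectedComponentIn Kᶜ z with hD
  have hDo : IsOpen D := ccIn_open hK z
  have hDpos : volume D ≠ 0 := (hDo.measure_pos volume ⟨z, mem_connectedComponentIn hz⟩).ne'
  have hstrip := bdd_strip M
  set μ : Measure 𝔸 := volume.restrict {a : 𝔸 | |a.2| ≤ M} with hμ
  have hμi : ∀ i : ℕ, μ (Φ^[i] '' D) = volume D := by
    intro i
    obtain ⟨h1, h2, h3, h4⟩ := hit i
    rw [hμ, Measure.restrict_eq_self _ (by rw [h2]; exact bdd_sub hM h4), h3]
  have hfin : μ univ < ∑' i : ℕ, μ (Φ^[i] '' D) := by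
    simp_rw [hμi]
    rw [ENNReal.tsum_const_eq_top_of_ne_zero hDpos, hμ, Measure.restrict_apply_univ]
    exact hstrip.measure_lt_top
  obtain ⟨i, j, hij, a, hai, haj⟩ := exists_nonempty_inter_of_measure_univ_lt_tsum_measure μ
    (fun i => by
      rw [(hit i).2.1]; exact (ccIn_open hK _).measurableSet.nullMeasurableSet) hfin
  have key : ∀ i j : ℕ, i < j → ∀ a, a ∈ Φ^[i] '' D → a ∈ Φ^[j] '' D →
      ∃ n : ℕ, 1 ≤ n ∧ Φ^[n] z ∈ D := by
    rintro i j hij _ ⟨b, hb, rfl⟩ ⟨c, hc, hbc⟩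
    refine ⟨j - i, by omega, ?_⟩
    have e : j = i + (j - i) := by omega
    rw [e, Function.iterate_add_apply] at hbc
    have h1 := (Φ.injective.iterate i) hbc
    have h2 : b ∈ connectedComponentIn Kᶜ (Φ^[j - i] z) := by
      rw [← (hit (j - i)).2.1]; exact ⟨c, hc, h1⟩
    rw [hD, connectedComponentIn_eq hb, ← connectedComponentIn_eq h2]
    exact mem_connectedComponentIn (hit (j - i)).1
  rcases lt_or_gt_of_ne hij with h1 | h1
  · exact key i j h1 a hai haj
  · exact key j i h1 a haj hai

theorem final_thm {F : 𝔸 ≃ₜ 𝔸} {H : ℂ ≃ₜ ℂ} {K : Set 𝔸} {M : ℝ} (h : Lft F H K) (hK : IsCompact K)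
    (hKc : IsConnected K) (hnoper : ∀ z ∈ K, ∀ n : ℕ, 1 ≤ n → (⇑F)^[n] z ≠ z)
    (hM : ∀ a ∈ K, |a.2| ≤ M)
    (hne : connectedComponentIn Kᶜ (ptT M) ≠ connectedComponentIn Kᶜ (-ptT M))
    {z : 𝔸} (hz : z ∈ Kᶜ) (hb : Bornology.IsBounded (connectedComponentIn Kᶜ z)) : False := by
  set T := connectedComponentIn Kᶜ (ptT M) with hT
  set B := connectedComponentIn Kᶜ (-ptT M) with hB
  have hTu : ¬ Bornology.IsBounded T := fun hc => top_unb M (hc.subset (top_sub hM))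
  have hBu : ¬ Bornology.IsBounded B := fun hc => bot_unb M (hc.subset (bot_sub hM))
  have hTm : ptT M ∈ Kᶜ := ptT_notMem hM
  have hBm : -ptT M ∈ Kᶜ := fun hc => ptT_notMem (neg_bd hM) hc
  have h1 : F '' T = T ∨ F '' T = B := by
    have := unb_image F hTu
    rw [hT, cc_image h.inv hTm] at this ⊢
    exact unb_cases hM this
  have h2 : F '' B = T ∨ F '' B = B := by
    have := unb_image F hBu
    rw [hB, cc_image h.inv hBm] at this ⊢
    exact unb_cases hM this
  have hinj : F '' T ≠ F '' B := fun hc => hne (F.injective.image_injective hc)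
  obtain ⟨Φ2, H2, hl2, hΦ2⟩ := h.iterate 2
  have e2 : ∀ S : Set 𝔸, Φ2 '' S = F '' (F '' S) := fun S => by
    rw [image_image]; exact image_congr fun a _ => hΦ2 a
  have h3 : Φ2 '' T = T ∧ Φ2 '' B = B := by
    rw [e2, e2]
    rcases h1 with h1 | h1 <;> rcases h2 with h2 | h2
    · exact absurd (h1.trans h2.symm) hinj
    · simp only [h1, h2, and_self]
    · simp only [h1, h2, and_self]
    · exact absurd (h1.trans h2.symm) hinj
  obtain ⟨n, hn, hzn⟩ := recur hl2 hK hM hz hb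
  obtain ⟨Φ, H', hl, hΦ⟩ := hl2.iterate n
  have hΦi : ∀ S : Set 𝔸, Φ2 '' S = S → Φ '' S = S := by
    intro S hS
    have : (Φ : 𝔸 → 𝔸) = Φ2^[n] := funext hΦ
    rw [this, image_iterate_eq]
    exact Function.iterate_fixed hS n
  have hfix : ∀ a ∈ K, Φ a ≠ a := by
    intro a ha
    have h4 : (Φ2 : 𝔸 → 𝔸) = F^[2] := funext hΦ2
    rw [hΦ, h4, ← Function.iterate_mul]
    exact hnoper a ha _ (by omega)
  exact final_core hl hK hKc hfix hM hne (hΦi _ h3.1) (hΦi _ h3.2) hz hb (by rw [hΦ]; exact hzn)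

end FinalPart

/-- An area preserving homeomorphism of the annulus homotopic to the identity (encoded by
the existence of a lift commuting with the deck transformation) leaving invariant an
essential continuum `K` (compact, connected, whose complement has exactly two unbounded
components) containing no periodic point: then `K` is filled, i.e. every connected
component of `𝔸 \ K` is unbounded. -/
theorem stmt5
    (F : 𝔸 ≃ₜ 𝔸) (f : ℝ × ℝ → ℝ × ℝ) (hf : Continuous f)
    (hlift : ∀ p, πA (f p) = F (πA p)) (hdeck : ∀ p, f (TA p) = TA (f p))
    (harea : ∀ s : Set 𝔸, MeasurableSet s → volume ((⇑F) ⁻¹' s) = volume s)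
    (K : Set 𝔸) (hKne : K.Nonempty) (hKcpt : IsCompact K) (hKconn : IsConnected K)
    (hKinv : F '' K = K)
    (hess : ∃ x ∈ Kᶜ, ∃ y ∈ Kᶜ,
      ¬ Bornology.IsBounded (connectedComponentIn Kᶜ x) ∧
      ¬ Bornology.IsBounded (connectedComponentIn Kᶜ y) ∧
      connectedComponentIn Kᶜ x ≠ connectedComponentIn Kᶜ y ∧
      ∀ z ∈ Kᶜ, ¬ Bornology.IsBounded (connectedComponentIn Kᶜ z) →
        (connectedComponentIn Kᶜ z = connectedComponentIn Kᶜ x ∨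
         connectedComponentIn Kᶜ z = connectedComponentIn Kᶜ y))
    (hnoper : ∀ z ∈ K, ∀ n : ℕ, 1 ≤ n → (⇑F)^[n] z ≠ z) :
    ∀ z ∈ Kᶜ, ¬ Bornology.IsBounded (connectedComponentIn Kᶜ z) := by
  intro z hz hb
  obtain ⟨H, hl⟩ := lft_of F f hf hlift hdeck harea K hKinv
  obtain ⟨M, hM⟩ : ∃ M : ℝ, ∀ a ∈ K, |a.2| ≤ M := by
    obtain ⟨M, hM⟩ := (hKcpt.image (f := fun a : 𝔸 => |a.2|) (by fun_prop)).bddAbove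
    exact ⟨M, fun a ha => hM ⟨a, ha, rfl⟩⟩
  obtain ⟨x, hx, y, hy, hxu, hyu, hxy, -⟩ := hess
  refine final_thm hl hKcpt hKconn hnoper hM ?_ hz hb
  intro hc
  apply hxy
  rcases unb_cases hM hxu with h1 | h1 <;> rcases unb_cases hM hyu with h2 | h2 <;>
    simp only [h1, h2, hc]
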